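/- arXiv:1909.04023 — 12 statements merged into one kernel-verified Lean document; each statement's English description precedes it below -/
import Mathlib

section
/- Let k be a field of characteristic zero and let A be a finitely generated k-algebra which is a domain of Gelfand–Kirillov dimension one; concretely, assume there exist a finite-dimensional k-subspace V of A with 1 ∈ V which generates A as a k-algebra and a constant C such that dim_k V^n ≤ C·n for all n ≥ 1, and assume A is infinite-dimensional over k. Then A is cancellative: for every k-algebra B, any k-algebra isomorphism A[t] ≅ B[t] between the polynomial rings in one central variable implies that A and B are isomorphic as k-algebras. -/
open Polynomial

theorem cz_torsionFree (k B : Type*) [Field k] [CharZero k] [Ring B] [Algebra k B] :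
    IsAddTorsionFree B := by
  constructor
  intro n hn a b hab
  have h : (n : k) • a = (n : k) • b := by
    simpa [Nat.cast_smul_eq_nsmul] using hab
  exact smul_right_injective B (Nat.cast_ne_zero.mpr hn : (n : k) ≠ 0) h

/-- If the iso carries constants to constants then it is an iso of coefficient rings. -/
theorem cz_step0 {k A B : Type*} [Field k] [CharZero k] [Ring A] [Algebra k A]
    [Ring B] [IsDomain B] [Algebra k B] (φ : A[X] ≃ₐ[k] B[X])
    (h : ∀ a : A, derivative (φ (C a)) = 0) : Nonempty (A ≃ₐ[k] B) := by
  have := cz_torsionFree k B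
  have hdeg : ∀ a : A, φ (C a) = C ((φ (C a)).coeff 0) := fun a =>
    eq_C_of_natDegree_eq_zero (Polynomial.derivative_eq_zero.1 (h a))
  let f : A →ₐ[k] B :=
    AlgHom.ofLinearMap
      ((lcoeff B 0).restrictScalars k ∘ₗ φ.toLinearMap ∘ₗ (CAlgHom (R := k) (A := A)).toLinearMap)
      (by simp) (by
        intro x y
        simp [mul_coeff_zero])
  have hf : ∀ a, φ (C a) = C (f a) := hdeg
  have hφ : ∀ g : A[X], φ g = (g.map (f : A →+* B)).comp (φ X) := by
    intro g
    induction g using Polynomial.induction_on' with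
    | add p q hp hq => simp [hp, hq, Polynomial.map_add]
    | monomial n a =>
      rw [← C_mul_X_pow_eq_monomial]
      simp [hf, Polynomial.map_mul, Polynomial.map_pow]
  have hinj : Function.Injective f := by
    intro a b hab
    have : φ (C a) = φ (C b) := by rw [hf, hf, hab]
    exact C_injective (φ.injective this)
  have hX : (φ X).natDegree ≠ 0 := by
    intro h0
    have h1 := hφ (φ.symm X)
    rw [φ.apply_symm_apply] at h1
    have h2 := congrArg natDegree h1
    rw [natDegree_comp, h0] at h2
    simp at h2
  refine ⟨AlgEquiv.ofBijective f ⟨hinj, fun b => ?_⟩⟩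
  have h1 := hφ (φ.symm (C b))
  rw [φ.apply_symm_apply] at h1
  have h2 := congrArg natDegree h1
  rw [natDegree_comp, natDegree_C] at h2
  have h3 : (map (f : A →+* B) (φ.symm (C b))).natDegree = 0 := by
    rcases Nat.mul_eq_zero.1 h2.symm with h | h
    · exact h
    · exact absurd h hX
  rw [natDegree_map_eq_of_injective (by exact hinj)] at h3
  obtain ⟨a, ha⟩ := natDegree_eq_zero.1 h3
  refine ⟨a, C_injective ?_⟩
  rw [← hf, ha, φ.apply_symm_apply]

/-- Derivations of finite-dimensional division algebras in char zero are inner. -/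
theorem cz_inner {k D : Type*} [Field k] [CharZero k] [Ring D] [IsDomain D] [Algebra k D]
    [Module.Finite k D] (e : D →ₗ[k] D) (he : ∀ a b, e (a * b) = e a * b + a * e b) :
    ∃ z : D, ∀ b, e b = z * b - b * z := by
  let L := Algebra.lmul k D
  let τ := LinearMap.trace k D
  let F : D →ₗ[k] Module.Dual k D :=
    LinearMap.mk₂ k (fun z a => τ (L z * L a))
      (by intros; simp [add_mul]) (by intros; simp)
      (by intros; simp [mul_add]) (by intros; simp)
  have hF : ∀ z a, F z a = τ (L z * L a) := fun _ _ => rfl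
  have hFinj : Function.Injective F := by
    rw [injective_iff_map_eq_zero]
    intro z hz
    by_contra hne
    obtain ⟨u, hu⟩ := FiniteDimensional.isUnit k hne
    have h1 : F z (↑u⁻¹ : D) = 0 := by rw [hz]; rfl
    rw [hF, ← map_mul, ← hu, Units.mul_inv, map_one] at h1
    have h2 : τ 1 = (Module.finrank k D : k) := LinearMap.trace_one k D
    rw [h2] at h1
    have h3 : Module.finrank k D ≠ 0 := Module.finrank_pos.ne'
    exact h3 (by exact_mod_cast h1)
  have hFsurj : Function.Surjective F :=
    (LinearMap.injective_iff_surjective_of_finrank_eq_finrank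
      (Subspace.dual_finrank_eq).symm).1 hFinj
  obtain ⟨z, hz⟩ := hFsurj (τ ∘ₗ LinearMap.mulLeft k (e : Module.End k D) ∘ₗ L.toLinearMap)
  have hz' : ∀ a, τ (L z * L a) = τ ((e : Module.End k D) * L a) := fun a => by
    have := LinearMap.congr_fun hz a
    simpa [hF] using this
  have hcomm : ∀ b, (e : Module.End k D) * L b - L b * e = L (e b) := by
    intro b
    ext x
    simp [L, he]
  refine ⟨z, fun b => hFinj ?_⟩
  ext a
  rw [hF, hF, ← hcomm, map_sub L, map_mul L z, map_mul L b, sub_mul, sub_mul, map_sub, map_sub]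
  have e1 : τ (L b * (e : Module.End k D) * L a) = τ ((e : Module.End k D) * L (a * b)) := by
    rw [mul_assoc, LinearMap.trace_mul_comm, map_mul L, mul_assoc]
  have e2 : τ (L b * L z * L a) = τ (L z * L (a * b)) := by
    rw [mul_assoc, LinearMap.trace_mul_comm, map_mul L, mul_assoc]
  rw [e1, e2, mul_assoc, mul_assoc, ← map_mul L, hz', hz']

/-- iterated homogeneous operator -/
def czE {k A : Type*} [Field k] [Ring A] [Algebra k A] (T : ℕ → A →ₗ[k] A) (l : ℕ) :
    ℕ → ℕ → A →ₗ[k] A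
  | 0, _ => LinearMap.id
  | (m + 1), i => czE T l m (i + l) ∘ₗ T i

theorem czE_mul {k A : Type*} [Field k] [Ring A] [Algebra k A] (T : ℕ → A →ₗ[k] A) (l : ℕ)
    (hT : ∀ i j a b, T (i + j) (a * b) = T i a * b + a * T j b) :
    ∀ n p q i j a b, p + q = n → czE T l (p + 1) i a = 0 → czE T l (q + 1) j b = 0 →
      czE T l n (i + j) (a * b) = (n.choose p) • (czE T l p i a * czE T l q j b) := by
  intro n
  induction n with
  | zero =>
    intro p q i j a b h _ _
    obtain ⟨rfl, rfl⟩ : p = 0 ∧ q = 0 := by omega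
    simp [czE]
  | succ n ih =>
    intro p q i j a b h ha hb
    have key : czE T l (n + 1) (i + j) (a * b)
        = czE T l n ((i + l) + j) (T i a * b) + czE T l n (i + (j + l)) (a * T j b) := by
      simp only [czE, LinearMap.comp_apply, hT, map_add]
      congr 2
      all_goals (congr 1; try omega)
    rw [key]
    rcases p with _ | p
    · have hTa : T i a = 0 := by simpa [czE] using ha
      rcases q with _ | q
      · omega
      · rw [hTa, ih 0 q i (j + l) a (T j b) (by omega) ha (by simpa [czE] using hb)]
        simp [czE]
    · rw [ih p q (i + l) j (T i a) b (by omega) (by simpa [czE] using ha) hb]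
      rcases q with _ | q
      · have hTb : T j b = 0 := by simpa [czE] using hb
        obtain rfl : p = n := by omega
        rw [hTb]
        simp [czE]
      · rw [ih (p + 1) q i (j + l) a (T j b) (by omega) ha (by simpa [czE] using hb)]
        simp only [czE, LinearMap.comp_apply]
        rw [← add_smul, Nat.choose_succ_succ]

theorem cz_exists_max {k A : Type*} [Field k] [Ring A] [Algebra k A] (T : ℕ → A →ₗ[k] A) (l : ℕ)
    (hnil : ∀ a i, ∃ m, czE T l m i a = 0) (a : A) (i : ℕ) (ha : a ≠ 0) :
    ∃ m, czE T l m i a ≠ 0 ∧ czE T l (m + 1) i a = 0 := by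
  classical
  have hx := hnil a i
  have h0 : Nat.find hx ≠ 0 := by
    intro h
    have := Nat.find_spec hx
    rw [h] at this
    exact ha (by simpa [czE] using this)
  obtain ⟨m, hm⟩ := Nat.exists_eq_succ_of_ne_zero h0
  refine ⟨m, Nat.find_min hx (by omega), ?_⟩
  have := Nat.find_spec hx
  rwa [hm] at this

theorem cz_c_zero {k A : Type*} [Field k] [CharZero k] [Ring A] [IsDomain A] [Algebra k A]
    (T : ℕ → A →ₗ[k] A) (l : ℕ)
    (hT : ∀ i j a b, T (i + j) (a * b) = T i a * b + a * T j b)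
    (hnil : ∀ a i, ∃ m, czE T l m i a = 0) : T 1 1 = 0 := by
  have := cz_torsionFree k A
  by_contra hc
  obtain ⟨p, hp, hp'⟩ := cz_exists_max T l hnil 1 1 one_ne_zero
  obtain ⟨q, hq, hq'⟩ := cz_exists_max T l hnil (T 1 1) l hc
  have h1 := czE_mul T l hT (p + q) p q 1 l 1 (T 1 1) rfl hp' hq'
  have h2 : czE T l (p + q) (1 + l) (1 * T 1 1) ≠ 0 := by
    rw [h1]
    exact smul_ne_zero (Nat.choose_pos (by omega)).ne' (mul_ne_zero hp hq)
  apply h2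
  have h3 : ∀ r, czE T l (p + 1 + r) 1 1 = 0 := by
    have comp : ∀ m r i a, czE T l (m + r) i a = czE T l r (i + m * l) (czE T l m i a) := by
      intro m
      induction m with
      | zero => intro r i a; simp [czE]
      | succ m ih =>
        intro r i a
        rw [show m + 1 + r = (m + r) + 1 by omega]
        simp only [czE, LinearMap.comp_apply, ih]
        congr 2
        ring
    intro r
    rw [comp, hp', map_zero]
  have h4 := h3 q
  rw [show p + 1 + q = (p + q) + 1 by omega] at h4
  simpa [czE] using h4

theorem cz_lnd {k A : Type*} [Field k] [CharZero k] [Ring A] [IsDomain A] [Algebra k A]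
    (S : Finset A) (hS : Algebra.adjoin k (S : Set A) = ⊤)
    (δ : A[X] →ₗ[k] A[X]) (hδ : ∀ f g, δ (f * g) = δ f * g + f * δ g)
    (hnil : ∀ f, ∃ m : ℕ, (δ ^ m) f = 0) (hne : ∃ a, δ (C a) ≠ 0) :
    ∃ d : A →ₗ[k] A, (∀ a b, d (a * b) = d a * b + a * d b) ∧
      (∀ a, ∃ m : ℕ, (d ^ m) a = 0) ∧ d ≠ 0 := by
  classical
  have hδ1 : δ 1 = 0 := by
    have := hδ 1 1
    simpa using this
  -- coefficient derivations
  let dd : ℕ → A →ₗ[k] A := fun i =>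
    (lcoeff A i).restrictScalars k ∘ₗ δ ∘ₗ (CAlgHom (R := k) (A := A)).toLinearMap
  have hdd : ∀ i a, dd i a = (δ (C a)).coeff i := fun _ _ => rfl
  have hddmul : ∀ i a b, dd i (a * b) = dd i a * b + a * dd i b := by
    intro i a b
    simp [hdd, C_mul, hδ]
  let c : ℕ → A := fun i => (δ X).coeff (i + 1)
  have hXcomm : ∀ g, δ X * g = g * δ X := by
    intro g
    have h1 := hδ X g
    rw [X_mul, hδ, X_mul (p := δ g)] at h1
    have h2 : δ X * g + δ g * X = g * δ X + δ g * X := by rw [← h1, add_comm]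
    exact add_right_cancel h2
  have hc : ∀ i a, c i * a = a * c i := by
    intro i a
    have := congrArg (fun f => coeff f (i + 1)) (hXcomm (C a))
    simpa using this
  have hXpow : ∀ i, δ (X ^ (i + 1)) = (i + 1) • (δ X * X ^ i) := by
    intro i
    induction i with
    | zero => simp
    | succ i ih =>
      rw [pow_succ, hδ, ih, ← hXcomm, smul_mul_assoc, mul_assoc, ← pow_succ, ← succ_nsmul]
  have hmono : ∀ (a : A) (i j : ℕ),
      (δ (C a * X ^ i)).coeff (j + i) = dd j a + (i : A) * (c j * a) := by
    intro a i j
    rw [hδ, coeff_add, coeff_mul_X_pow, hdd]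
    congr 1
    rcases i with _ | i
    · simp [hδ1]
    · rw [hXpow, coeff_C_mul, coeff_smul, ← add_assoc, add_right_comm, coeff_mul_X_pow]
      rw [hc, nsmul_eq_mul, ← mul_assoc, ← mul_assoc, (Nat.cast_commute (i + 1) a).eq]
  -- bound
  obtain ⟨N, hN⟩ : ∃ N, ∀ a, (δ (C a)).natDegree ≤ N := by
    refine ⟨S.sup (fun a => (δ (C a)).natDegree), fun a => ?_⟩
    have ha : a ∈ Algebra.adjoin k (S : Set A) := by rw [hS]; trivial
    induction ha using Algebra.adjoin_induction with
    | mem x hx => exact Finset.le_sup (f := fun a => (δ (C a)).natDegree) hx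
    | algebraMap r =>
      have : C (algebraMap k A r) = r • (1 : A[X]) := by
        rw [Algebra.smul_def, mul_one]; rfl
      rw [this, map_smul, hδ1]; simp
    | add x y _ _ hx hy =>
      rw [C_add, map_add]
      exact natDegree_add_le_of_degree_le hx hy
    | mul x y _ _ hx hy =>
      rw [C_mul, hδ]
      exact natDegree_add_le_of_degree_le ((natDegree_mul_C_le _ _).trans hx)
        ((natDegree_C_mul_le _ _).trans hy)
  let P : ℕ → Prop := fun j => dd j ≠ 0 ∨ c j ≠ 0
  let M := max N (δ X).natDegree
  have hPM : ∀ j, M < j → ¬ P j := by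
    intro j hj hP
    rcases hP with h | h
    · apply h
      ext a
      rw [hdd]
      exact coeff_eq_zero_of_natDegree_lt ((hN a).trans_lt ((le_max_left _ _).trans_lt hj))
    · apply h
      exact coeff_eq_zero_of_natDegree_lt
        (((le_max_right N _).trans_lt hj).trans (Nat.lt_succ_self j))
  obtain ⟨l, hl, hlmax⟩ : ∃ l, P l ∧ ∀ j, l < j → ¬ P j := by
    obtain ⟨a, ha⟩ := hne
    obtain ⟨j, hj⟩ : ∃ j, P j := by
      refine ⟨(δ (C a)).natDegree, Or.inl ?_⟩
      intro h
      have h2 := hdd (δ (C a)).natDegree a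
      rw [h] at h2
      exact ha (leadingCoeff_eq_zero.1 h2.symm)
    have hjM : j ≤ M := by
      by_contra h
      exact hPM j (by omega) hj
    refine ⟨Nat.findGreatest P M, Nat.findGreatest_spec hjM hj, fun i hi hPi => ?_⟩
    by_cases hiM : i ≤ M
    · exact Nat.findGreatest_is_greatest hi hiM hPi
    · exact hPM i (by omega) hPi
  have hdl : ∀ j, l < j → dd j = 0 := fun j hj => by
    by_contra h; exact hlmax j hj (Or.inl h)
  have hcl : ∀ j, l < j → c j = 0 := fun j hj => by
    by_contra h; exact hlmax j hj (Or.inr h)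
  let T : ℕ → A →ₗ[k] A := fun i => dd l + (LinearMap.mulLeft k ((i : A) * c l))
  have hTa : ∀ i a, T i a = dd l a + (i : A) * (c l * a) := fun i a => by
    simp [T]
  have hTmul : ∀ i j a b, T (i + j) (a * b) = T i a * b + a * T j b := by
    intro i j a b
    have e1 : a * ((j : A) * (c l * b)) = (j : A) * (c l * (a * b)) := by
      rw [← mul_assoc, ← (Nat.cast_commute j a).eq, mul_assoc, ← mul_assoc a, ← hc, mul_assoc]
    simp only [hTa, hddmul, Nat.cast_add, add_mul, mul_add, e1, mul_assoc]
    abel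
  have hlead : ∀ (f : A[X]) n m, f.natDegree ≤ n → l ≤ m →
      (δ f).coeff (m + n) = if m = l then T n (f.coeff n) else 0 := by
    intro f n m hf hm
    conv_lhs => rw [f.as_sum_range' (n + 1) (by omega)]
    rw [map_sum, finsetSum_coeff, Finset.sum_range_succ, Finset.sum_eq_zero, zero_add]
    · rw [← C_mul_X_pow_eq_monomial, hmono]
      split_ifs with h
      · rw [h, hTa]
      · rw [hdl m (by omega), hcl m (by omega)]; simp
    · intro i hi
      have hi' := Finset.mem_range.1 hi
      rw [← C_mul_X_pow_eq_monomial, show m + n = (m + n - i) + i by omega, hmono,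
        hdl _ (by omega), hcl _ (by omega)]
      simp
  have hleaddeg : ∀ (f : A[X]) n, f.natDegree ≤ n → (δ f).natDegree ≤ n + l := by
    intro f n hf
    rw [natDegree_le_iff_coeff_eq_zero]
    intro j hj
    have := hlead f n (j - n) hf (by omega)
    rw [show j - n + n = j by omega, if_neg (by omega)] at this
    exact this
  have hE : ∀ m (f : A[X]) n, f.natDegree ≤ n →
      czE T l m n (f.coeff n) = ((δ ^ m) f).coeff (n + m * l) := by
    intro m
    induction m with
    | zero => intro f n _; simp [czE]
    | succ m ih =>
      intro f n hf
      have h1 := ih (δ f) (n + l) (hleaddeg f n hf)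
      rw [add_comm n l, hlead f n l hf le_rfl, if_pos rfl] at h1
      rw [pow_succ, Module.End.mul_apply, czE, LinearMap.comp_apply, add_comm n l, h1]
      congr 1
      ring
  have hEnil : ∀ a i, ∃ m, czE T l m i a = 0 := by
    intro a i
    obtain ⟨m, hm⟩ := hnil (C a * X ^ i)
    refine ⟨m, ?_⟩
    have := hE m (C a * X ^ i) i (natDegree_C_mul_X_pow_le a i)
    rw [hm] at this
    simpa using this
  have hc0 : c l = 0 := by
    have h1 := cz_c_zero T l hTmul hEnil
    have h2 : dd l 1 = 0 := by rw [hdd, C_1, hδ1]; simp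
    rw [hTa, h2] at h1
    simpa using h1
  have hTd : ∀ i, T i = dd l := by
    intro i
    ext a
    rw [hTa, hc0]; simp
  have hEd : ∀ m i a, czE T l m i a = (dd l ^ m) a := by
    intro m
    induction m with
    | zero => intro i a; simp [czE]
    | succ m ih =>
      intro i a
      rw [czE, LinearMap.comp_apply, ih, hTd, pow_succ, Module.End.mul_apply]
  refine ⟨dd l, hddmul l, fun a => ?_, ?_⟩
  · obtain ⟨m, hm⟩ := hEnil a 0
    exact ⟨m, by rw [← hEd m 0, hm]⟩
  · rcases hl with h | h
    · exact h
    · exact absurd hc0 h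

/-- at most quadratic growth -/
def czQ (k R : Type*) [Field k] [Ring R] [Algebra k R] : Prop :=
  ∃ U : Submodule k R, 1 ∈ U ∧ U.FG ∧ Algebra.adjoin k (U : Set R) = ⊤ ∧
    ∃ C : ℕ, ∀ n : ℕ, 1 ≤ n → Module.finrank k ↥(U ^ n) ≤ C * n ^ 2

/-- polynomials of degree at most n with coefficients in V^n -/
def czP {k A : Type*} [Field k] [Ring A] [Algebra k A] (V : Submodule k A) (n : ℕ) :
    Submodule k A[X] where
  carrier := {f | (∀ i, n < i → f.coeff i = 0) ∧ ∀ i, f.coeff i ∈ V ^ n}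
  add_mem' := by
    rintro f g ⟨h1, h2⟩ ⟨h3, h4⟩
    exact ⟨fun i hi => by rw [coeff_add, h1 i hi, h3 i hi, add_zero],
      fun i => by rw [coeff_add]; exact add_mem (h2 i) (h4 i)⟩
  zero_mem' := ⟨fun i _ => by simp, fun i => by simp⟩
  smul_mem' := by
    rintro r f ⟨h1, h2⟩
    exact ⟨fun i hi => by rw [coeff_smul, h1 i hi, smul_zero],
      fun i => by rw [coeff_smul]; exact Submodule.smul_mem _ _ (h2 i)⟩

theorem czP_mul {k A : Type*} [Field k] [Ring A] [Algebra k A] (V : Submodule k A) (m n : ℕ) :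
    czP V m * czP V n ≤ czP V (m + n) := by
  rw [Submodule.mul_le]
  rintro f ⟨h1, h2⟩ g ⟨h3, h4⟩
  refine ⟨fun i hi => ?_, fun i => ?_⟩
  · rw [coeff_mul]
    refine Finset.sum_eq_zero fun p hp => ?_
    have hp' := Finset.HasAntidiagonal.mem_antidiagonal.1 hp
    rcases lt_or_ge m p.1 with h | h
    · rw [h1 _ h, zero_mul]
    · rw [h3 _ (by omega), mul_zero]
  · rw [coeff_mul]
    refine Submodule.sum_mem _ fun p hp => ?_
    rw [pow_add]
    exact Submodule.mul_mem_mul (h2 _) (h4 _)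

theorem czP_finrank {k A : Type*} [Field k] [Ring A] [Algebra k A] (V : Submodule k A)
    (hV : V.FG) (n : ℕ) : Module.Finite k (czP V n) ∧
      Module.finrank k (czP V n) ≤ (n + 1) * Module.finrank k ↥(V ^ n) := by
  have : Module.Finite k ↥(V ^ n) := Module.Finite.iff_fg.2 (hV.pow n)
  let F : czP V n →ₗ[k] (Fin (n + 1) → ↥(V ^ n)) :=
    { toFun := fun f i => ⟨f.1.coeff i, f.2.2 i⟩
      map_add' := fun f g => by ext i; simp
      map_smul' := fun r f => by ext i; simp }
  have hF : Function.Injective F := by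
    intro f g h
    ext i
    by_cases hi : n < i
    · rw [f.2.1 i hi, g.2.1 i hi]
    · have := congrFun h ⟨i, by omega⟩
      exact congrArg Subtype.val this
  refine ⟨Module.Finite.of_injective F hF, ?_⟩
  have := LinearMap.finrank_le_finrank_of_injective hF
  simpa [Module.finrank_pi_fintype] using this

theorem czQ_of {k A : Type*} [Field k] [Ring A] [Algebra k A]
    (V : Submodule k A) (hV1 : (1 : A) ∈ V) (hV : V.FG)
    (hVgen : Algebra.adjoin k (V : Set A) = ⊤)
    (C : ℕ) (hgrowth : ∀ n : ℕ, 1 ≤ n → Module.finrank k ↥(V ^ n) ≤ C * n) :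
    czQ k A[X] := by
  have hC : ∀ v ∈ V, Polynomial.C v ∈ czP V 1 := fun v hv => by
    refine ⟨fun i hi => by rw [coeff_C, if_neg (by omega)], fun i => ?_⟩
    rw [coeff_C, pow_one]
    split_ifs
    · exact hv
    · exact zero_mem _
  have hX : (X : A[X]) ∈ czP V 1 := by
    refine ⟨fun i hi => by rw [coeff_X, if_neg (by omega)], fun i => ?_⟩
    rw [coeff_X, pow_one]
    split_ifs
    · exact hV1
    · exact zero_mem _
  refine ⟨czP V 1, by simpa using hC 1 hV1, Module.Finite.iff_fg.1 (czP_finrank V hV 1).1,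
    ?_, 2 * C, fun n hn => ?_⟩
  · rw [eq_top_iff]
    rintro f -
    have hA : ∀ a : A, Polynomial.C a ∈ Algebra.adjoin k (czP V 1 : Set A[X]) := by
      intro a
      have ha : a ∈ Algebra.adjoin k (V : Set A) := by rw [hVgen]; trivial
      induction ha using Algebra.adjoin_induction with
      | mem x hx => exact Algebra.subset_adjoin (hC x hx)
      | algebraMap r => exact Subalgebra.algebraMap_mem _ r
      | add x y _ _ hx hy => rw [C_add]; exact add_mem hx hy
      | mul x y _ _ hx hy => rw [C_mul]; exact mul_mem hx hy
    induction f using Polynomial.induction_on' with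
    | add p q hp hq => exact add_mem hp hq
    | monomial n a =>
      rw [← C_mul_X_pow_eq_monomial]
      exact mul_mem (hA a) (pow_mem (Algebra.subset_adjoin hX) n)
  · have hle : ∀ n, 1 ≤ n → czP V 1 ^ n ≤ czP V n := by
      intro n hn
      induction n, hn using Nat.le_induction with
      | base => rw [pow_one]
      | succ n hn ih =>
        rw [pow_succ]
        exact (mul_le_mul' ih le_rfl).trans (czP_mul V n 1)
    obtain ⟨h1, h2⟩ := czP_finrank V hV n
    calc Module.finrank k ↥(czP V 1 ^ n) ≤ Module.finrank k (czP V n) :=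
          Submodule.finrank_mono (hle n hn)
      _ ≤ (n + 1) * Module.finrank k ↥(V ^ n) := h2
      _ ≤ (n + n) * (C * n) := Nat.mul_le_mul (by omega) (hgrowth n hn)
      _ = 2 * C * n ^ 2 := by ring

theorem czQ_equiv {k R S : Type*} [Field k] [Ring R] [Algebra k R] [Ring S] [Algebra k S]
    (φ : R ≃ₐ[k] S) (h : czQ k R) : czQ k S := by
  obtain ⟨U, h1, h2, h3, C, h4⟩ := h
  refine ⟨U.map (φ : R →ₐ[k] S).toLinearMap, ⟨1, h1, by simp⟩, h2.map _, ?_, C, fun n hn => ?_⟩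
  · have := (φ : R →ₐ[k] S).map_adjoin (U : Set R)
    rw [h3, Algebra.map_top, (AlgHom.range_eq_top _).2 φ.surjective] at this
    rw [this]
    rfl
  · rw [← Submodule.map_pow]
    have : Module.Finite k ↥(U ^ n) := Module.Finite.iff_fg.2 (h2.pow n)
    exact (Submodule.finrank_map_le _ _).trans (h4 n hn)

theorem czQ_fg {k A : Type*} [Field k] [Ring A] [Algebra k A] (h : czQ k A[X]) :
    ∃ S : Finset A, Algebra.adjoin k (S : Set A) = ⊤ := by
  obtain ⟨U, h1, ⟨s, rfl⟩, h3, -⟩ := h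
  have hft : Algebra.FiniteType k A[X] := ⟨⟨s, by
    rw [← h3]
    exact (Algebra.adjoin_span k).symm⟩⟩
  let ev : A[X] →+* A := eval₂RingHom' (RingHom.id A) 0 (fun a => Commute.zero_right _)
  let ev' : A[X] →ₐ[k] A := { ev with
    commutes' := fun r => by
      change eval₂ (RingHom.id A) 0 (Polynomial.C (algebraMap k A r)) = _
      simp }
  have hs : Function.Surjective ev' := fun a => ⟨C a, by
    change eval₂ (RingHom.id A) 0 (Polynomial.C a) = _
    simp⟩
  obtain ⟨S, hS⟩ := (hft.of_surjective ev' hs).out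
  exact ⟨S, hS⟩

theorem cz_dpow {k A : Type*} [Field k] [Ring A] [Algebra k A]
    (d : A →ₗ[k] A) (hd : ∀ a b, d (a * b) = d a * b + a * d b) (p q : ℕ) (a b : A)
    (ha : (d ^ (p + 1)) a = 0) (hb : (d ^ (q + 1)) b = 0) :
    (d ^ (p + q)) (a * b) = ((p + q).choose p) • ((d ^ p) a * (d ^ q) b) := by
  have hE : ∀ m i a, czE (fun _ => d) 0 m i a = (d ^ m) a := by
    intro m
    induction m with
    | zero => intro i a; simp [czE]
    | succ m ih =>
      intro i a
      rw [czE, LinearMap.comp_apply, ih, pow_succ, Module.End.mul_apply]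
  have := czE_mul (fun _ => d) 0 (fun _ _ => hd) (p + q) p q 0 0 a b rfl
    (by rw [hE, ha]) (by rw [hE, hb])
  simpa only [hE] using this

theorem cz_xpow {k A : Type*} [Field k] [CharZero k] [Ring A] [IsDomain A] [Algebra k A]
    (d : A →ₗ[k] A) (hd : ∀ a b, d (a * b) = d a * b + a * d b) (x : A)
    (hx : d x ≠ 0) (hx2 : d (d x) = 0) (n : ℕ) :
    (d ^ (n + 1)) (x ^ n) = 0 ∧ (d ^ n) (x ^ n) ≠ 0 := by
  have := cz_torsionFree k A
  induction n with
  | zero =>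
    have : d 1 = 0 := by simpa using hd 1 1
    simp [this]
  | succ n ih =>
    have h2 : (d ^ (1 + 1)) x = 0 := by simpa [pow_succ] using hx2
    have h3 : (d ^ (n + 1 + 1)) (x ^ n) = 0 := by
      rw [pow_succ', Module.End.mul_apply, ih.1, map_zero]
    rw [pow_succ x n]
    constructor
    · rw [cz_dpow d hd (n + 1) 1 _ _ h3 h2, ih.1]; simp
    · rw [cz_dpow d hd n 1 _ _ ih.1 h2]
      refine smul_ne_zero (Nat.choose_pos (by omega)).ne' (mul_ne_zero ih.2 (by simpa using hx))

theorem cz_dker {k A : Type*} [Field k] [Ring A] [Algebra k A]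
    (d : A →ₗ[k] A) (hd : ∀ a b, d (a * b) = d a * b + a * d b) (c a : A) (hc : d c = 0) (m : ℕ) :
    (d ^ m) (c * a) = c * (d ^ m) a := by
  induction m with
  | zero => simp
  | succ m ih => rw [pow_succ', Module.End.mul_apply, ih, hd, hc, zero_mul, zero_add,
      Module.End.mul_apply]

theorem cz_indep {k A : Type*} [Field k] [CharZero k] [Ring A] [IsDomain A] [Algebra k A]
    (d : A →ₗ[k] A) (hd : ∀ a b, d (a * b) = d a * b + a * d b) (x : A)
    (hx : d x ≠ 0) (hx2 : d (d x) = 0) (n : ℕ) (c : ℕ → A) (hc : ∀ i, d (c i) = 0)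
    (h : ∑ i ∈ Finset.range n, c i * x ^ i = 0) : ∀ i < n, c i = 0 := by
  induction n with
  | zero => intro i hi; omega
  | succ n ih =>
    have hlow : ∀ i < n, (d ^ n) (x ^ i) = 0 := by
      intro i hi
      obtain ⟨r, rfl⟩ := Nat.exists_eq_add_of_lt hi
      rw [show i + r + 1 = r + (i + 1) by omega, pow_add, Module.End.mul_apply,
        (cz_xpow d hd x hx hx2 i).1, map_zero]
    have h1 := congrArg (d ^ n) h
    rw [map_sum, Finset.sum_range_succ, Finset.sum_eq_zero, zero_add, map_zero,
      cz_dker d hd _ _ (hc n)] at h1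
    · have hn : c n = 0 :=
        (mul_eq_zero.1 h1).resolve_right (cz_xpow d hd x hx hx2 n).2
      rw [Finset.sum_range_succ, hn, zero_mul, add_zero] at h
      intro i hi
      rcases Nat.lt_succ_iff_lt_or_eq.1 hi with h' | rfl
      · exact ih h i h'
      · exact hn
    · intro i hi
      rw [cz_dker d hd _ _ (hc i), hlow i (Finset.mem_range.1 hi), mul_zero]

/-- kernel of a derivation -/
def czK {k A : Type*} [Field k] [Ring A] [Algebra k A]
    (d : A →ₗ[k] A) (hd : ∀ a b, d (a * b) = d a * b + a * d b) : Subalgebra k A where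
  carrier := {a | d a = 0}
  mul_mem' := by
    intro a b ha hb
    have ha' : d a = 0 := ha
    have hb' : d b = 0 := hb
    change d (a * b) = 0
    rw [hd, ha', hb', zero_mul, mul_zero, add_zero]
  add_mem' := by
    intro a b ha hb
    have ha' : d a = 0 := ha
    have hb' : d b = 0 := hb
    change d (a + b) = 0
    rw [map_add, ha', hb', add_zero]
  algebraMap_mem' := by
    intro r
    change d (algebraMap k A r) = 0
    have h1 : d 1 = 0 := by simpa using hd 1 1
    rw [Algebra.algebraMap_eq_smul_one, map_smul, h1, smul_zero]

theorem cz_pow_mono {k R : Type*} [Field k] [Ring R] [Algebra k R] (U : Submodule k R)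
    (h1 : 1 ∈ U) {m n : ℕ} (h : m ≤ n) : U ^ m ≤ U ^ n := by
  have h1' : (1 : Submodule k R) ≤ U := Submodule.one_le.2 h1
  obtain ⟨r, rfl⟩ := Nat.exists_eq_add_of_le h
  rw [pow_add]
  have : (1 : Submodule k R) ≤ U ^ r := Submodule.one_le.2 (by
    have := Submodule.pow_mem_pow U h1 r
    rwa [one_pow] at this)
  calc U ^ m = U ^ m * 1 := (mul_one _).symm
    _ ≤ U ^ m * U ^ r := mul_le_mul' le_rfl this

theorem cz_exists_pow {k R : Type*} [Field k] [Ring R] [Algebra k R] (U : Submodule k R)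
    (h1 : 1 ∈ U) (hgen : Algebra.adjoin k (U : Set R) = ⊤) (f : R) : ∃ m, f ∈ U ^ m := by
  have hf : f ∈ Algebra.adjoin k (U : Set R) := by rw [hgen]; trivial
  induction hf using Algebra.adjoin_induction with
  | mem x hx => exact ⟨1, by rwa [pow_one]⟩
  | algebraMap r => exact ⟨0, by rw [pow_zero]; exact Submodule.algebraMap_mem r⟩
  | add x y _ _ hx hy =>
    obtain ⟨m, hm⟩ := hx
    obtain ⟨n, hn⟩ := hy
    exact ⟨max m n, add_mem (cz_pow_mono U h1 (le_max_left _ _) hm)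
      (cz_pow_mono U h1 (le_max_right _ _) hn)⟩
  | mul x y _ _ hx hy =>
    obtain ⟨m, hm⟩ := hx
    obtain ⟨n, hn⟩ := hy
    exact ⟨m + n, by rw [pow_add]; exact Submodule.mul_mem_mul hm hn⟩

theorem cz_ker_finite {k A : Type*} [Field k] [CharZero k] [Ring A] [IsDomain A] [Algebra k A]
    (hQ : czQ k A[X])
    (d : A →ₗ[k] A) (hd : ∀ a b, d (a * b) = d a * b + a * d b) (x : A)
    (hx : d x ≠ 0) (hx2 : d (d x) = 0) : Module.Finite k (czK d hd) := by
  classical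
  obtain ⟨U, h1, hfg, hgen, M, hM⟩ := hQ
  obtain ⟨p, hp⟩ := cz_exists_pow U h1 hgen (C x)
  obtain ⟨q, hq⟩ := cz_exists_pow U h1 hgen X
  have hrank : Module.rank k (czK d hd) ≤ ((M * (1 + p + q) ^ 2 : ℕ) : Cardinal) := by
    apply rank_le
    intro s hs
    choose g hg using fun f => cz_exists_pow U h1 hgen f
    let w := s.sup (fun a => g (C (a : A))) + 1
    let W : Submodule k (czK d hd) := Submodule.span k (s : Set (czK d hd))
    have hWfr : Module.finrank k W = s.card := finrank_span_finset_eq_card hs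
    have hWfin : Module.Finite k W := Module.Finite.span_finset k s
    have hWU : ∀ c ∈ W, C (c : A) ∈ U ^ w := by
      intro c hc
      induction hc using Submodule.span_induction with
      | mem a ha =>
        refine cz_pow_mono U h1 ?_ (hg (C (a : A)))
        exact (Finset.le_sup (f := fun a : czK d hd => g (C (a : A))) ha).trans (Nat.le_succ _)
      | zero => simp
      | add a b _ _ ha hb => simpa using add_mem ha hb
      | smul r a _ ha =>
        have : C ((r • a : czK d hd) : A) = r • C (a : A) := by
          rw [smul_C]; rfl
        rw [this]
        exact Submodule.smul_mem _ _ ha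
    let N := w + (p * w + q * w)
    let F : (Fin w → Fin w → W) →ₗ[k] A[X] :=
      { toFun := fun c => ∑ j : Fin w, ∑ i : Fin w, C ((c j i : czK d hd) : A) * C x ^ (i : ℕ) * X ^ (j : ℕ)
        map_add' := fun a b => by
          simp [add_mul, Finset.sum_add_distrib]
        map_smul' := fun r a => by
          simp only [Finset.smul_sum, RingHom.id_apply]
          refine Finset.sum_congr rfl fun j _ => Finset.sum_congr rfl fun i _ => ?_
          rw [← smul_mul_assoc, ← smul_mul_assoc, smul_C]
          rfl }
    have hFmem : ∀ c, F c ∈ U ^ N := by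
      intro c
      change (∑ j : Fin w, ∑ i : Fin w,
        C ((c j i : czK d hd) : A) * C x ^ (i : ℕ) * X ^ (j : ℕ)) ∈ U ^ N
      refine Submodule.sum_mem _ fun j _ => Submodule.sum_mem _ fun i _ => ?_
      have e1 := hWU _ (c j i).2
      have e2 : (C x ^ (i : ℕ) : A[X]) ∈ U ^ (p * w) :=
        cz_pow_mono U h1 (Nat.mul_le_mul le_rfl i.2.le)
          (by rw [pow_mul]; exact Submodule.pow_mem_pow _ hp _)
      have e3 : (X ^ (j : ℕ) : A[X]) ∈ U ^ (q * w) :=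
        cz_pow_mono U h1 (Nat.mul_le_mul le_rfl j.2.le)
          (by rw [pow_mul]; exact Submodule.pow_mem_pow _ hq _)
      have := Submodule.mul_mem_mul (Submodule.mul_mem_mul e1 e2) e3
      rwa [← pow_add, ← pow_add, add_assoc] at this
    have hFinj : Function.Injective F := by
      rw [injective_iff_map_eq_zero]
      intro c hc
      have hrow : ∀ j : Fin w, ∑ i : Fin w, ((c j i : czK d hd) : A) * x ^ (i : ℕ) = 0 := by
        intro j
        have h := congrArg (fun f => coeff f (j : ℕ)) hc
        change coeff (∑ j : Fin w, ∑ i : Fin w,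
          C ((c j i : czK d hd) : A) * C x ^ (i : ℕ) * X ^ (j : ℕ)) (j : ℕ) = coeff 0 (j : ℕ) at h
        simp only [finsetSum_coeff, ← C_pow, ← C_mul, coeff_C_mul_X_pow, coeff_zero] at h
        rw [Finset.sum_eq_single j] at h
        · simpa using h
        · intro b _ hb
          refine Finset.sum_eq_zero fun i _ => if_neg ?_
          intro h'
          exact hb (Fin.ext h'.symm)
        · simp
      funext j i
      let cc : ℕ → A := fun i => if h : i < w then ((c j ⟨i, h⟩ : czK d hd) : A) else 0
      have h2 := cz_indep d hd x hx hx2 w cc (fun i => by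
        by_cases h : i < w
        · simp only [cc, dif_pos h]
          exact (c j ⟨i, h⟩ : czK d hd).2
        · simp [cc, h]) (by
        rw [← Fin.sum_univ_eq_sum_range (fun i => cc i * x ^ i), ← hrow j]
        refine Finset.sum_congr rfl fun i _ => ?_
        simp [cc]) i i.2
      apply Subtype.ext
      apply Subtype.ext
      simpa [cc] using h2
    have hfinU : Module.Finite k ↥(U ^ N) := Module.Finite.iff_fg.2 (hfg.pow N)
    have hle := LinearMap.finrank_le_finrank_of_injective
      (f := F.codRestrict (U ^ N) hFmem)
      (fun a b hab => hFinj (congrArg Subtype.val hab))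
    have hfr : Module.finrank k (Fin w → Fin w → W) = w * (w * s.card) := by
      simp [Module.finrank_pi_fintype, hWfr]
    rw [hfr] at hle
    have hw : 0 < w := Nat.succ_pos _
    have h3 := hle.trans (hM N (by omega))
    have hN : N = w * (1 + p + q) := by simp only [N]; ring
    rw [hN] at h3
    have h4 : (w * w) * s.card ≤ (w * w) * (M * (1 + p + q) ^ 2) := by
      calc (w * w) * s.card = w * (w * s.card) := by ring
        _ ≤ _ := h3
        _ = _ := by ring
    exact Nat.le_of_mul_le_mul_left h4 (Nat.mul_pos hw hw)
  exact Module.rank_lt_aleph0_iff.1 (hrank.trans_lt (Cardinal.natCast_lt_aleph0))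

theorem cz_structure {k A : Type*} [Field k] [CharZero k] [Ring A] [IsDomain A] [Algebra k A]
    (hQ : czQ k A[X])
    (d : A →ₗ[k] A) (hd : ∀ a b, d (a * b) = d a * b + a * d b)
    (hnil : ∀ a, ∃ m : ℕ, (d ^ m) a = 0) (hne : d ≠ 0) :
    ∃ K : Subalgebra k A, Module.Finite k K ∧ Nonempty (A ≃ₐ[k] K[X]) := by
  classical
  -- local slice
  obtain ⟨x, hx, hx2⟩ : ∃ x, d x ≠ 0 ∧ d (d x) = 0 := by
    obtain ⟨a, ha⟩ : ∃ a, d a ≠ 0 := by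
      by_contra h
      push Not at h
      exact hne (LinearMap.ext h)
    have hex := hnil a
    have h2 : 2 ≤ Nat.find hex := by
      rw [Nat.le_find_iff]
      intro m hm
      interval_cases m
      · intro h
        have h0 : a = 0 := by simpa using h
        exact ha (by rw [h0, map_zero])
      · simpa using ha
    obtain ⟨r, hr⟩ := Nat.exists_eq_add_of_le h2
    have hs := Nat.find_spec hex
    have hm := Nat.find_min hex (m := r + 1) (by omega)
    rw [hr, show 2 + r = r + 1 + 1 by omega, pow_succ', pow_succ'] at hs
    rw [pow_succ'] at hm
    exact ⟨(d ^ r) a, hm, hs⟩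
  have hfin := cz_ker_finite hQ d hd x hx hx2
  let K := czK d hd
  have hK : ∀ a, a ∈ K ↔ d a = 0 := fun a => Iff.rfl
  have hunit : ∀ u ∈ K, u ≠ 0 → ∃ v ∈ K, v * u = 1 := by
    intro u hu hu0
    have : (⟨u, hu⟩ : K) ≠ 0 := fun h => hu0 (congrArg Subtype.val h)
    obtain ⟨v, hv⟩ := (FiniteDimensional.isUnit k this).exists_left_inv
    exact ⟨v, v.2, congrArg Subtype.val hv⟩
  obtain ⟨v, hv, hvu⟩ := hunit (d x) hx2 hx
  have hd1 : d 1 = 0 := by simpa using hd 1 1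
  let y := v * x
  have hy : d y = 1 := by
    simp only [y]
    rw [hd, (hK v).1 hv, zero_mul, zero_add, hvu]
  let e : K →ₗ[k] K :=
    LinearMap.codRestrict (Subalgebra.toSubmodule K)
      ((LinearMap.mulLeft k y - LinearMap.mulRight k y) ∘ₗ K.val.toLinearMap) (by
        intro c
        have hc : d (c : A) = 0 := c.2
        change d (y * (c : A) - (c : A) * y) = 0
        rw [map_sub, hd y, hd _ y, hc, hy]
        simp)
  have he : ∀ c : K, ((e c : K) : A) = y * c - c * y := fun _ => rfl
  obtain ⟨z, hz⟩ := cz_inner e (by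
    intro a b
    apply Subtype.ext
    push_cast
    simp only [he]
    push_cast
    noncomm_ring)
  let t : A := y - z
  have ht : d t = 1 := by
    have : d (z : A) = 0 := z.2
    simp only [t]
    rw [map_sub, hy, this, sub_zero]
  have htne : d t ≠ 0 := by rw [ht]; exact one_ne_zero
  have ht2 : d (d t) = 0 := by rw [ht, hd1]
  have hcomm : ∀ c : K, Commute (K.val c) t := by
    intro c
    have h1 : y * (c : A) - c * y = z * c - c * z := by
      rw [← he, hz]; push_cast; rfl
    change (c : A) * (y - z) = (y - z) * c
    rw [mul_sub, sub_mul]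
    have h2 : y * (c : A) = z * c - c * z + c * y := by rw [← h1]; abel
    rw [h2]; abel
  let ev : K[X] →+* A := eval₂RingHom' (K.val : K →+* A) t hcomm
  have hev : ∀ p, ev p = eval₂ (K.val : K →+* A) t p := fun _ => rfl
  let Ψ : K[X] →ₐ[k] A := { ev with
    commutes' := fun r => by
      change eval₂ (K.val : K →+* A) t (Polynomial.C (algebraMap k K r)) = _
      rw [eval₂_C]
      rfl }
  have hΨ : ∀ p, Ψ p = eval₂ (K.val : K →+* A) t p := fun _ => rfl
  have hinj : Function.Injective Ψ := by
    rw [injective_iff_map_eq_zero]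
    intro p hp
    rw [hΨ, eval₂_eq_sum_range] at hp
    have h := cz_indep d hd t htne ht2 _ (fun i => (p.coeff i : A)) (fun i => (p.coeff i).2) hp
    ext i
    by_cases hi : i < p.natDegree + 1
    · simpa using h i hi
    · rw [coeff_eq_zero_of_natDegree_lt (by omega)]; simp
  have hsurj : Function.Surjective Ψ := by
    have key : ∀ m a, (d ^ m) a = 0 → ∃ p, Ψ p = a := by
      intro m
      induction m with
      | zero => intro a ha; exact ⟨0, by simpa using ha.symm⟩
      | succ m ih =>
        intro a ha
        obtain ⟨g1, g2⟩ := cz_xpow d hd t htne ht2 m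
        have g3 : (d ^ m) (t ^ m) ∈ K := by
          rw [hK, ← Module.End.mul_apply, ← pow_succ']; exact g1
        have g4 : (d ^ m) a ∈ K := by
          rw [hK, ← Module.End.mul_apply, ← pow_succ']; exact ha
        obtain ⟨v, hv, hv1⟩ := hunit _ g3 g2
        have hc := K.mul_mem g4 hv
        obtain ⟨p, hp⟩ := ih (a - (d ^ m) a * v * t ^ m) (by
          rw [map_sub, cz_dker d hd _ _ hc, mul_assoc, hv1, mul_one, sub_self])
        refine ⟨p + C (⟨_, hc⟩ : K) * X ^ m, ?_⟩
        rw [map_add, hp, hΨ (_ * _), C_mul_X_pow_eq_monomial, eval₂_monomial]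
        change _ + (d ^ m) a * v * t ^ m = a
        abel
    intro a
    obtain ⟨m, hm⟩ := hnil a
    exact key m a hm
  exact ⟨K, hfin, ⟨(AlgEquiv.ofBijective Ψ ⟨hinj, hsurj⟩).symm⟩⟩

theorem cz_half {k A B : Type*} [Field k] [CharZero k] [Ring A] [IsDomain A] [Algebra k A]
    [Ring B] [Algebra k B] (hQ : czQ k A[X]) (φ : A[X] ≃ₐ[k] B[X])
    (h : ∃ a : A, derivative (φ (C a)) ≠ 0) :
    ∃ K : Subalgebra k A, Module.Finite k K ∧ Nonempty (A ≃ₐ[k] K[X]) := by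
  obtain ⟨S, hS⟩ := czQ_fg hQ
  let D : B[X] →ₗ[k] B[X] :=
    { toFun := fun f => derivative f
      map_add' := fun f g => derivative_add
      map_smul' := fun r f => by simp }
  let δ : A[X] →ₗ[k] A[X] := φ.symm.toLinearMap ∘ₗ D ∘ₗ φ.toLinearMap
  have hδ : ∀ f, δ f = φ.symm (derivative (φ f)) := fun _ => rfl
  have hδm : ∀ m f, (δ ^ m) f = φ.symm ((⇑derivative)^[m] (φ f)) := by
    intro m
    induction m with
    | zero => intro f; simp
    | succ m ih =>
      intro f
      rw [pow_succ, Module.End.mul_apply, ih, hδ, φ.apply_symm_apply, Function.iterate_succ_apply]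
  obtain ⟨d, h1, h2, h3⟩ := cz_lnd S hS δ
    (fun f g => by simp only [hδ, map_mul, derivative_mul, map_add, φ.symm_apply_apply])
    (fun f => ⟨(φ f).natDegree + 1, by
      rw [hδm, iterate_derivative_eq_zero (Nat.lt_succ_self _), map_zero]⟩)
    (by
      obtain ⟨a, ha⟩ := h
      refine ⟨a, fun h0 => ha ?_⟩
      rw [hδ] at h0
      simpa using h0)
  exact cz_structure hQ d h1 h2 h3

theorem cz_hom {k D E : Type*} [Field k] [Ring D] [IsDomain D] [Algebra k D] [Module.Finite k D]
    [Ring E] [Nontrivial E] [Algebra k E] (φ : D[X][X] ≃ₐ[k] E[X][X]) :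
    ∃ f : D →ₐ[k] E, Function.Injective f := by
  let ev : E[X][X] →+* E := (constantCoeff : E[X] →+* E).comp (constantCoeff : E[X][X] →+* E[X])
  let ev' : E[X][X] →ₐ[k] E := { ev with
    commutes' := fun r => by
      change ((C (C (algebraMap k E r)) : E[X][X]).coeff 0).coeff 0 = _
      simp }
  let f : D →ₐ[k] E := ev'.comp ((φ : D[X][X] →ₐ[k] E[X][X]).comp
    ((CAlgHom (R := k) (A := D[X])).comp (CAlgHom (R := k) (A := D))))
  refine ⟨f, ?_⟩
  rw [injective_iff_map_eq_zero]
  intro a ha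
  by_contra h0
  exact ((FiniteDimensional.isUnit k h0).map f).ne_zero ha

/-- Affine domains of Gelfand–Kirillov dimension one over a field of
characteristic zero are cancellative. -/
theorem stmt_0 (k A : Type*) [Field k] [CharZero k]
    [Ring A] [IsDomain A] [Algebra k A]
    (V : Submodule k A) (hV1 : (1 : A) ∈ V)
    (hVfd : FiniteDimensional k V)
    (hVgen : Algebra.adjoin k (V : Set A) = ⊤)
    (C : ℕ) (hgrowth : ∀ n : ℕ, 1 ≤ n → Module.finrank k ↥(V ^ n) ≤ C * n)
    (hinf : ¬ Module.Finite k A) :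
    ∀ (B : Type*) [Ring B] [Algebra k B],
      (Polynomial A ≃ₐ[k] Polynomial B) → Nonempty (A ≃ₐ[k] B) := by
  intro B _ _ φ
  have hQA : czQ k A[X] := czQ_of V hV1 (Module.Finite.iff_fg.1 hVfd) hVgen C hgrowth
  have hQB : czQ k B[X] := czQ_equiv φ hQA
  have hBX : IsDomain B[X] := φ.symm.toMulEquiv.isDomain A[X]
  have hB : IsDomain B := (C_injective (R := B)).isDomain (Polynomial.C : B →+* B[X])
  by_cases h1 : ∀ a : A, derivative (φ (Polynomial.C a)) = 0
  · exact cz_step0 φ h1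
  by_cases h2 : ∀ b : B, derivative (φ.symm (Polynomial.C b)) = 0
  · exact (cz_step0 φ.symm h2).map AlgEquiv.symm
  push Not at h1 h2
  obtain ⟨K, hK, ⟨α⟩⟩ := cz_half hQA φ h1
  obtain ⟨L, hL, ⟨β⟩⟩ := cz_half hQB φ.symm h2
  let Φ : K[X][X] ≃ₐ[k] L[X][X] := ((mapAlgEquiv α).symm.trans φ).trans (mapAlgEquiv β)
  obtain ⟨f, hf⟩ := cz_hom Φ
  obtain ⟨g, hg⟩ := cz_hom Φ.symm
  have hfr : Module.finrank k K = Module.finrank k L :=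
    le_antisymm (LinearMap.finrank_le_finrank_of_injective (f := f.toLinearMap) hf)
      (LinearMap.finrank_le_finrank_of_injective (f := g.toLinearMap) hg)
  have hfs : Function.Surjective f :=
    (LinearMap.injective_iff_surjective_of_finrank_eq_finrank hfr (f := f.toLinearMap)).1 hf
  exact ⟨(α.trans (mapAlgEquiv (AlgEquiv.ofBijective f ⟨hf, hfs⟩))).trans β.symm⟩
end

section
/- For every prime number p there exist a field k of characteristic p, a finitely generated k-algebra A which is a domain of Gelfand–Kirillov dimension one (i.e., there are a finite-dimensional k-subspace V ∋ 1 generating A as a k-algebra and a constant C with dim_k V^n ≤ C·n for all n ≥ 1, and A is infinite-dimensional over k), and a k-algebra B such that the polynomial rings A[t] and B[t] are isomorphic as k-algebras but A and B are not isomorphic as k-algebras. -/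
open Polynomial

set_option linter.unusedSectionVars false
section gen
variable {k K E : Type} [Field k] [Field K] [Algebra k K] [Ring E] [Algebra k E]

/-- left-coefficient evaluation -/
noncomputable def psi (L : K →ₐ[k] E) (g : E[X]) (q : K[X]) : E[X] :=
  eval₂ ((C : E →+* E[X]).comp (L : K →+* E)) g q

theorem psi_sum (L : K →ₐ[k] E) (g : E[X]) (q : K[X]) :
    psi L g q = ∑ i ∈ Finset.range (q.natDegree + 1), C (L (q.coeff i)) * g ^ i := by
  simp [psi, eval₂_eq_sum_range]

theorem psi_natDegree_le (L : K →ₐ[k] E) (g : E[X]) (q : K[X]) :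
    (psi L g q).natDegree ≤ q.natDegree * g.natDegree := by
  rw [psi_sum]
  apply natDegree_sum_le_of_forall_le
  intro i hi
  have hi' : i ≤ q.natDegree := by simpa [Nat.lt_succ_iff] using hi
  calc _ ≤ (g ^ i).natDegree := natDegree_C_mul_le _ _
    _ ≤ i * g.natDegree := natDegree_pow_le
    _ ≤ _ := by gcongr

theorem psi_coeff (L : K →ₐ[k] E) (g : E[X]) (q : K[X]) (b : K)
    (hb : g.leadingCoeff = L b) (hm : g.natDegree ≠ 0) :
    (psi L g q).coeff (q.natDegree * g.natDegree) = L (q.leadingCoeff * b ^ q.natDegree) := by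
  rw [psi_sum, finsetSum_coeff, Finset.sum_range_succ, Finset.sum_eq_zero, zero_add, coeff_C_mul,
    coeff_pow_mul_natDegree, hb]
  · simp
  · intro i hi
    rw [coeff_C_mul, coeff_eq_zero_of_natDegree_lt (p := g ^ i), mul_zero]
    refine lt_of_le_of_lt natDegree_pow_le ?_
    have := Finset.mem_range.1 hi
    exact Nat.mul_lt_mul_of_pos_right this (Nat.pos_of_ne_zero hm)

variable [Nontrivial E]

theorem psi_natDegree (L : K →ₐ[k] E) (g : E[X]) (q : K[X]) (b : K) (hb0 : b ≠ 0)
    (hb : g.leadingCoeff = L b) :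
    (psi L g q).natDegree = q.natDegree * g.natDegree := by
  by_cases hm : g.natDegree = 0
  · have := psi_natDegree_le L g q
    simp_all
  by_cases hq : q = 0
  · simp [hq, psi]
  apply le_antisymm (psi_natDegree_le L g q)
  apply le_natDegree_of_ne_zero
  rw [psi_coeff L g q b hb hm]
  have : q.leadingCoeff * b ^ q.natDegree ≠ 0 := by
    simp [hq, hb0]
  rwa [map_ne_zero_iff L (L : K →+* E).injective]

theorem psi_leadingCoeff (L : K →ₐ[k] E) (D : E) (q : K[X]) :
    (psi L (X + C D) q).leadingCoeff = L q.leadingCoeff := by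
  have h1 : (X + C D).leadingCoeff = L 1 := by simp
  have h := psi_natDegree L (X + C D) q 1 one_ne_zero h1
  have h2 := psi_coeff L (X + C D) q 1 h1 (by simp)
  rw [leadingCoeff, h, h2]
  simp

theorem psi_natDegree' (L : K →ₐ[k] E) (D : E) (q : K[X]) :
    (psi L (X + C D) q).natDegree = q.natDegree := by
  have h1 : (X + C D).leadingCoeff = L 1 := by simp
  simpa using psi_natDegree L (X + C D) q 1 one_ne_zero h1

/-- The Ore extension as a subalgebra of `E[X]`. -/
noncomputable def ore (L : K →ₐ[k] E) (D : E) : Subalgebra k E[X] :=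
  Algebra.adjoin k (Set.range (fun a => C (L a)) ∪ {X + C D})

theorem C_mem_ore (L : K →ₐ[k] E) (D : E) (a : K) : C (L a) ∈ ore L D :=
  Algebra.subset_adjoin (Or.inl ⟨a, rfl⟩)

theorem x_mem_ore (L : K →ₐ[k] E) (D : E) : X + C D ∈ ore L D :=
  Algebra.subset_adjoin (Or.inr rfl)

theorem psi_add (L : K →ₐ[k] E) (g : E[X]) (q r : K[X]) :
    psi L g (q + r) = psi L g q + psi L g r := eval₂_add _ _

theorem psi_monomial (L : K →ₐ[k] E) (g : E[X]) (n : ℕ) (a : K) :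
    psi L g (monomial n a) = C (L a) * g ^ n := by simp [psi, eval₂_monomial]

theorem C_mul_psi (L : K →ₐ[k] E) (g : E[X]) (q : K[X]) (a : K) :
    C (L a) * psi L g q = psi L g (C a * q) := by
  induction q using Polynomial.induction_on' with
  | add p q hp hq => rw [mul_add, psi_add, psi_add, mul_add, hp, hq]
  | monomial n b => rw [C_mul_monomial, psi_monomial, psi_monomial, map_mul, C_mul, mul_assoc]

theorem x_mul_psi (L : K →ₐ[k] E) (D : E) (δ : K → K)
    (hD : ∀ a, D * L a = L a * D + L (δ a)) (q : K[X]) :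
    ∃ r, (X + C D) * psi L (X + C D) q = psi L (X + C D) r := by
  induction q using Polynomial.induction_on' with
  | add p q hp hq =>
    obtain ⟨r, hr⟩ := hp
    obtain ⟨s, hs⟩ := hq
    exact ⟨r + s, by rw [psi_add, psi_add, mul_add, hr, hs]⟩
  | monomial n b =>
    refine ⟨monomial (n+1) b + monomial n (δ b), ?_⟩
    rw [psi_add, psi_monomial, psi_monomial, psi_monomial, pow_succ', ← mul_assoc, ← mul_assoc,
      ← add_mul]
    congr 1
    rw [add_mul, ← C_mul, hD, mul_add, X_mul_C]
    simp [add_assoc]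

theorem mem_ore (L : K →ₐ[k] E) (D : E) (δ : K → K)
    (hD : ∀ a, D * L a = L a * D + L (δ a)) (P : E[X]) :
    P ∈ ore L D ↔ ∃ q, P = psi L (X + C D) q := by
  constructor
  · intro h
    have key : ∀ Q, (∃ q, Q = psi L (X + C D) q) → ∃ q, P * Q = psi L (X + C D) q := by
      induction h using Algebra.adjoin_induction with
      | mem x hx =>
        rintro Q ⟨q, rfl⟩
        rcases hx with ⟨a, rfl⟩ | hx
        · exact ⟨_, C_mul_psi _ _ _ _⟩
        · rw [Set.mem_singleton_iff.1 hx]; exact x_mul_psi L D δ hD q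
      | algebraMap r =>
        rintro Q ⟨q, rfl⟩
        refine ⟨C (algebraMap k K r) * q, ?_⟩
        rw [← C_mul_psi]
        simp [Polynomial.algebraMap_apply]
      | add x y _ _ hx hy =>
        intro Q hQ
        obtain ⟨r, hr⟩ := hx Q hQ
        obtain ⟨s, hs⟩ := hy Q hQ
        exact ⟨r + s, by rw [psi_add, add_mul, hr, hs]⟩
      | mul x y _ _ hx hy =>
        intro Q hQ
        rw [mul_assoc]
        exact hx _ (hy _ hQ)
    simpa using key 1 ⟨1, by simp [psi]⟩
  · rintro ⟨q, rfl⟩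
    rw [psi_sum]
    exact sum_mem fun i _ => mul_mem (C_mem_ore _ _ _) (pow_mem (x_mem_ore _ _) _)

theorem lc_ore (L : K →ₐ[k] E) (D : E) (δ : K → K)
    (hD : ∀ a, D * L a = L a * D + L (δ a)) (P : E[X]) (hP : P ∈ ore L D) (h0 : P ≠ 0) :
    ∃ b, b ≠ 0 ∧ P.leadingCoeff = L b := by
  obtain ⟨q, rfl⟩ := (mem_ore L D δ hD P).1 hP
  refine ⟨q.leadingCoeff, ?_, psi_leadingCoeff _ _ _⟩
  rintro h
  apply h0
  rw [leadingCoeff_eq_zero] at h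
  simp [h, psi]

theorem ore_domain (L : K →ₐ[k] E) (D : E) (δ : K → K)
    (hD : ∀ a, D * L a = L a * D + L (δ a)) : IsDomain (ore L D) := by
  have : NoZeroDivisors (ore L D) := by
    constructor
    rintro ⟨P, hP⟩ ⟨Q, hQ⟩ h
    by_contra! hc
    obtain ⟨hP0, hQ0⟩ := hc
    obtain ⟨a, ha, ha'⟩ := lc_ore L D δ hD P hP (fun h => hP0 (Subtype.ext h))
    obtain ⟨b, hb, hb'⟩ := lc_ore L D δ hD Q hQ (fun h => hQ0 (Subtype.ext h))
    have h1 : P * Q = 0 := congrArg Subtype.val h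
    have h2 : P.leadingCoeff * Q.leadingCoeff ≠ 0 := by
      rw [ha', hb', ← map_mul, map_ne_zero_iff L (L : K →+* E).injective]
      exact mul_ne_zero ha hb
    rw [← leadingCoeff_mul' h2, h1] at h2
    simp at h2
  exact NoZeroDivisors.to_isDomain _

theorem ore_infinite (L : K →ₐ[k] E) (D : E) : ¬ Module.Finite k (ore L D) := by
  intro h
  obtain ⟨q, hq, hq'⟩ := Algebra.IsIntegral.isIntegral (R := k) (⟨X + C D, x_mem_ore L D⟩ : ore L D)
  have h1 := congrArg Subtype.val hq'
  have h2 : psi L (X + C D) (q.map (algebraMap k K)) = 0 := by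
    rw [← aeval_def] at hq'
    have h3 := congrArg (ore L D).val hq'
    rw [← aeval_algHom_apply, map_zero] at h3
    rw [← h3, psi, eval₂_map, aeval_def]
    congr 1
    ext; simp [Polynomial.algebraMap_apply]
  have h3 := psi_leadingCoeff L D (q.map (algebraMap k K))
  rw [h2, (hq.map _).leadingCoeff] at h3
  simp at h3

/-- the filtration -/
noncomputable def filt (A : Subalgebra k E[X]) (n : ℕ) : Submodule k A :=
  (((degreeLE E n).restrictScalars k)).comap A.val.toLinearMap

theorem mem_filt (A : Subalgebra k E[X]) (n : ℕ) (P : A) :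
    P ∈ filt A n ↔ (P : E[X]).natDegree ≤ n := by
  simp [filt, mem_degreeLE, natDegree_le_iff_degree_le]

theorem filt_finrank [FiniteDimensional k E] (A : Subalgebra k E[X]) (n : ℕ) :
    Module.Finite k (filt A n) ∧
    Module.finrank k (filt A n) ≤ (n + 1) * Module.finrank k E := by
  let e : (degreeLT E (n+1)) ≃ₗ[k] (Fin (n+1) → E) := (degreeLTEquiv E (n+1)).restrictScalars k
  have hf : ∀ P : filt A n, (P : A).1 ∈ degreeLT E (n+1) := by
    intro P
    have := (mem_filt A n P).1 P.2
    rw [mem_degreeLT]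
    refine lt_of_le_of_lt degree_le_natDegree ?_
    exact_mod_cast Nat.lt_succ_of_le this
  let g : filt A n →ₗ[k] degreeLT E (n+1) :=
    { toFun := fun P => ⟨(P : A).1, hf P⟩
      map_add' := fun _ _ => rfl
      map_smul' := fun _ _ => rfl }
  have hi : Function.Injective (e.toLinearMap.comp g) := by
    apply e.injective.comp
    intro P Q h
    exact Subtype.ext (Subtype.ext (congrArg (fun z : degreeLT E (n+1) => (z : E[X])) h))
  refine ⟨Module.Finite.of_injective _ hi, ?_⟩
  have := LinearMap.finrank_le_finrank_of_injective hi
  simpa [Module.finrank_pi_fintype] using this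

theorem filt_pow (A : Subalgebra k E[X]) (n : ℕ) : (filt A 1) ^ n ≤ filt A n := by
  induction n with
  | zero => 
    rw [pow_zero, Submodule.one_le, mem_filt]; simp
  | succ n ih =>
    rw [pow_succ, Submodule.mul_le]
    intro P hP Q hQ
    have h1 := (mem_filt _ _ _).1 (ih hP)
    have h2 := (mem_filt _ _ _).1 hQ
    rw [mem_filt]
    exact natDegree_mul_le.trans (by omega)

theorem ore_growth [FiniteDimensional k E] (L : K →ₐ[k] E) (D : E) :
    ∃ (V : Submodule k (ore L D)) (C : ℕ),
        (1 : ore L D) ∈ V ∧ FiniteDimensional k V ∧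
        Algebra.adjoin k (V : Set (ore L D)) = ⊤ ∧
        ∀ n : ℕ, 1 ≤ n → Module.finrank k ↥(V ^ n) ≤ C * n := by
  refine ⟨filt _ 1, 2 * Module.finrank k E, ?_, (filt_finrank _ _).1, ?_, ?_⟩
  · rw [mem_filt]; simp
  · rw [eq_top_iff]
    have h : ore L D ≤ (Algebra.adjoin k (filt (ore L D) 1 : Set (ore L D))).map (ore L D).val := by
      apply Algebra.adjoin_le
      rintro x (⟨a, rfl⟩ | hx)
      · refine ⟨⟨_, C_mem_ore L D a⟩, Algebra.subset_adjoin ?_, rfl⟩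
        rw [SetLike.mem_coe, mem_filt]
        simp
      · rw [Set.mem_singleton_iff.1 hx]
        refine ⟨⟨_, x_mem_ore L D⟩, Algebra.subset_adjoin ?_, rfl⟩
        rw [SetLike.mem_coe, mem_filt]
        exact (natDegree_add_le _ _).trans (by simp [natDegree_X_le])
    rintro ⟨P, hP⟩ -
    obtain ⟨Q, hQ, hQP⟩ := h hP
    have : Q = ⟨P, hP⟩ := Subtype.ext hQP
    exact this ▸ hQ
  · intro n hn
    have := (filt_finrank (ore L D) n).1
    refine (Submodule.finrank_mono (filt_pow _ n)).trans ((filt_finrank _ _).2.trans ?_)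
    nlinarith [Nat.zero_le (Module.finrank k E)]


section swap

theorem CX_comm (P : E[X][X]) : Commute (C X : E[X][X]) P := by
  induction P using Polynomial.induction_on' with
  | add p q hp hq => exact hp.add_right hq
  | monomial n a =>
    rw [commute_iff_eq, C_mul_monomial, monomial_mul_C, X_mul]

theorem X_comm (P : E[X][X]) : Commute (X : E[X][X]) P := commute_X P

theorem Y_comm (p : ℕ) (P : E[X][X]) : Commute ((C X) ^ p + X : E[X][X]) P :=
  ((CX_comm P).pow_left p).add_left (X_comm P)

theorem S_comm (p : ℕ) (P : E[X][X]) : Commute (C X - ((C X) ^ p + X) ^ p : E[X][X]) P :=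
  (CX_comm P).sub_left ((Y_comm p P).pow_left p)

variable (k E) in
/-- the involution of `E[X][t]` -/
noncomputable def phi (p : ℕ) : E[X][X] →ₐ[k] E[X][X] :=
  eval₂AlgHom
    (eval₂AlgHom ((CAlgHom : E[X] →ₐ[k] E[X][X]).comp (CAlgHom : E →ₐ[k] E[X])) ((C X) ^ p + X)
      (fun _ => (Y_comm p _).symm))
    (C X - ((C X) ^ p + X) ^ p) (fun _ => (S_comm p _).symm)

theorem phi_CC (p : ℕ) (e : E) : phi k E p (C (C e)) = C (C e) := by
  simp [phi]

theorem phi_CX (p : ℕ) : phi k E p (C X) = (C X) ^ p + X := by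
  simp [phi]

theorem phi_X (p : ℕ) : phi k E p X = C X - ((C X) ^ p + X) ^ p := by
  simp [phi]

theorem phi_phi (p : ℕ) (P : E[X][X]) : phi k E p (phi k E p P) = P := by
  have hX : phi k E p (phi k E p X) = X := by
    rw [phi_X, map_sub, map_pow, map_add, map_pow, phi_CX, phi_X]; abel_nf
  have hCX : phi k E p (phi k E p (C X)) = C X := by
    rw [phi_CX, map_add, map_pow, phi_CX, phi_X]; abel_nf
  have hC : ∀ Q : E[X], phi k E p (phi k E p (C Q)) = C Q := by
    intro Q
    induction Q using Polynomial.induction_on' with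
    | add p q hp hq => simp only [map_add, hp, hq]
    | monomial n a =>
      rw [← C_mul_X_pow_eq_monomial]
      simp only [map_mul, map_pow, hCX, phi_CC]
  induction P using Polynomial.induction_on' with
  | add p q hp hq => simp only [map_add, hp, hq]
  | monomial n a =>
    rw [← C_mul_X_pow_eq_monomial]
    simp only [map_mul, map_pow, hX, hC]

/-- the image of `A[t]` in `E[X][t]` -/
noncomputable def hat (A : Subalgebra k E[X]) : Subalgebra k E[X][X] :=
  (mapAlgHom A.val : A[X] →ₐ[k] E[X][X]).range

theorem C_mem_hat (A : Subalgebra k E[X]) (P : E[X]) (hP : P ∈ A) : C P ∈ hat A :=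
  ⟨C ⟨P, hP⟩, by simp⟩

theorem X_mem_hat (A : Subalgebra k E[X]) : X ∈ hat A := ⟨X, by simp⟩

theorem phi_hat (p : ℕ) [Fact p.Prime] [CharP k p] (L : K →ₐ[k] E) (D₁ D₂ : E)
    (h1 : D₁ ^ p = D₂) (h2 : D₂ ^ p = D₁) (P : E[X][X]) (hP : P ∈ hat (ore L D₁)) :
    phi k E p P ∈ hat (ore L D₂) := by
  have : CharP E p := charP_of_injective_algebraMap (algebraMap k E).injective p
  have hy : C (X + C D₂) ∈ hat (ore L D₂) := C_mem_hat _ _ (x_mem_ore _ _)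
  have hyp : (C X) ^ p + X + C (C D₁) ∈ hat (ore L D₂) := by
    have : (C X) ^ p + X + C (C D₁) = (C (X + C D₂)) ^ p + X := by
      rw [C_add, add_pow_char_of_commute _ (CX_comm _), ← C_pow (a := C D₂), ← C_pow (a := D₂), h2]
      abel
    rw [this]
    exact add_mem (pow_mem hy _) (X_mem_hat _)
  have hX : phi k E p X ∈ hat (ore L D₂) := by
    have : phi k E p X = C (X + C D₂) - ((C X) ^ p + X + C (C D₁)) ^ p := by
      rw [phi_X, add_pow_char_of_commute _ (Y_comm p _), ← C_pow (a := C D₁), ← C_pow (a := D₁), h1,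
        C_add]
      abel
    rw [this]
    exact sub_mem hy (pow_mem hyp _)
  have hC : ∀ Q ∈ ore L D₁, phi k E p (C Q) ∈ hat (ore L D₂) := by
    intro Q hQ
    induction hQ using Algebra.adjoin_induction with
    | mem x hx =>
      rcases hx with ⟨a, rfl⟩ | hx
      · rw [phi_CC]
        exact C_mem_hat _ _ (C_mem_ore _ _ _)
      · rw [Set.mem_singleton_iff.1 hx, C_add, map_add, phi_CC, phi_CX]
        exact hyp
    | algebraMap r =>
      have : (C (algebraMap k E[X] r) : E[X][X]) = algebraMap k E[X][X] r := rfl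
      rw [this, AlgHom.commutes]
      exact Subalgebra.algebraMap_mem _ r
    | add x y _ _ hx hy => rw [C_add, map_add]; exact add_mem hx hy
    | mul x y _ _ hx hy => rw [C_mul, map_mul]; exact mul_mem hx hy
  obtain ⟨Q, rfl⟩ := hP
  induction Q using Polynomial.induction_on' with
  | add p q hp hq => rw [map_add, map_add]; exact add_mem hp hq
  | monomial n a =>
    rw [← C_mul_X_pow_eq_monomial]
    have : (mapAlgHom (ore L D₁).val : (ore L D₁)[X] →ₐ[k] E[X][X]).toRingHom (C a * X ^ n)
      = C (a : E[X]) * X ^ n := by simp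
    erw [this]
    rw [map_mul, map_pow]
    exact mul_mem (hC _ a.2) (pow_mem hX _)

theorem ore_poly_equiv (p : ℕ) [Fact p.Prime] [CharP k p] (L : K →ₐ[k] E) (D₁ D₂ : E)
    (h1 : D₁ ^ p = D₂) (h2 : D₂ ^ p = D₁) :
    Nonempty ((ore L D₁)[X] ≃ₐ[k] (ore L D₂)[X]) := by
  have hi : ∀ D : E, Function.Injective (mapAlgHom (ore L D).val : (ore L D)[X] →ₐ[k] E[X][X]) :=
    fun D => map_injective _ Subtype.val_injective
  let e := fun D : E => AlgEquiv.ofInjective _ (hi D)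
  let m : hat (ore L D₁) ≃ₐ[k] hat (ore L D₂) :=
    AlgEquiv.ofAlgHom
      (((phi k E p).comp (hat (ore L D₁)).val).codRestrict _
        (fun P => phi_hat p L D₁ D₂ h1 h2 P P.2))
      (((phi k E p).comp (hat (ore L D₂)).val).codRestrict _
        (fun P => phi_hat p L D₂ D₁ h2 h1 P P.2))
      (AlgHom.ext fun P => Subtype.ext (phi_phi (k := k) (E := E) p P.1))
      (AlgHom.ext fun P => Subtype.ext (phi_phi (k := k) (E := E) p P.1))
  exact ⟨(e D₁).trans (m.trans (e D₂).symm)⟩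

theorem ore_not_iso (p : ℕ) [Fact p.Prime] [CharP K p] (L : K →ₐ[k] E) (D₁ D₂ : E)
    (δ₁ δ₂ : K → K) (hk : ∀ a : K, ∃ c : k, algebraMap k K c = a ^ p)
    (hD₁ : ∀ a, D₁ * L a = L a * D₁ + L (δ₁ a))
    (hD₂ : ∀ a, D₂ * L a = L a * D₂ + L (δ₂ a))
    (hb : ¬ ∃ b, ∀ a, δ₁ a = b * δ₂ a) :
    IsEmpty (ore L D₁ ≃ₐ[k] ore L D₂) := by
  constructor
  intro f
  have hp0 : p ≠ 0 := (Fact.out : p.Prime).ne_zero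
  have Linj : Function.Injective L := (L : K →+* E).injective
  have deg0 : ∀ P ∈ ore L D₂, P.natDegree = 0 → ∃ b, P = C (L b) := by
    intro P hP h
    obtain ⟨q, rfl⟩ := (mem_ore L D₂ δ₂ hD₂ P).1 hP
    rw [psi_natDegree'] at h
    obtain ⟨b, rfl⟩ := natDegree_eq_zero.1 h
    exact ⟨b, by simp [psi]⟩
  let ι₁ : K → ore L D₁ := fun a => ⟨_, C_mem_ore L D₁ a⟩
  let ι₂ : K → ore L D₂ := fun a => ⟨_, C_mem_ore L D₂ a⟩
  have hι : ∀ a, f (ι₁ a) = ι₂ a := by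
    intro a
    obtain ⟨c, hc⟩ := hk a
    have h1 : (ι₁ a) ^ p = algebraMap k _ c := by
      apply Subtype.ext
      change (C (L a)) ^ p = C (algebraMap k E c)
      rw [← C_pow, ← map_pow, ← hc, AlgHom.commutes]
    have h2 : (f (ι₁ a)) ^ p = algebraMap k _ c := by
      rw [← map_pow, h1, AlgEquiv.commutes]
    have h3 : ((f (ι₁ a)) : E[X]) ^ p = C (L (a ^ p)) := by
      rw [← hc, AlgHom.commutes]
      exact congrArg Subtype.val h2
    by_cases h0 : (f (ι₁ a) : E[X]) = 0
    · rw [h0, zero_pow hp0] at h3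
      have h4 := C_eq_zero.1 h3.symm
      rw [← map_zero L] at h4
      have h5 := Linj h4
      have h6 : a = 0 := by simpa [hp0] using h5
      apply Subtype.ext
      rw [h0, h6]
      change 0 = C (L 0)
      simp
    obtain ⟨b, hb0, hb⟩ := lc_ore L D₂ δ₂ hD₂ _ (f (ι₁ a)).2 h0
    have h4 : (f (ι₁ a) : E[X]).natDegree = 0 := by
      have h5 := congrArg natDegree h3
      rw [natDegree_C, natDegree_pow'] at h5
      · simpa [hp0] using h5
      · rw [hb, ← map_pow]
        exact fun h => pow_ne_zero p hb0 (Linj (h.trans (map_zero L).symm))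
    obtain ⟨c, hc⟩ := deg0 _ (f (ι₁ a)).2 h4
    rw [hc, ← C_pow, ← map_pow] at h3
    have h5 := Linj (C_injective h3)
    have h6 : c = a := frobenius_inj K p h5
    exact Subtype.ext (by rw [hc, h6])
  let x₁ : ore L D₁ := ⟨_, x_mem_ore L D₁⟩
  let x₂ : ore L D₂ := ⟨_, x_mem_ore L D₂⟩
  set g := f x₁ with hg
  have hfq : ∀ P : ore L D₁, ∀ q, (P : E[X]) = psi L (X + C D₁) q → (f P : E[X]) = psi L g q := by
    intro P q hq
    have : P = ∑ i ∈ Finset.range (q.natDegree + 1), ι₁ (q.coeff i) * x₁ ^ i := by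
      apply Subtype.ext
      rw [hq, psi_sum]
      simp [ι₁, x₁]
    rw [this, psi_sum, map_sum]
    simp only [map_mul, hι, map_pow]
    simp [ι₂, hg]
  have hcomm : ∀ a, g * ι₂ a = ι₂ a * g + ι₂ (δ₁ a) := by
    intro a
    rw [← hι, ← hι, hg, ← map_mul, ← map_mul, ← map_add]
    congr 1
    apply Subtype.ext
    change (X + C D₁) * C (L a) = C (L a) * (X + C D₁) + C (L (δ₁ a))
    rw [add_mul, ← C_mul, hD₁, mul_add, X_mul_C]
    simp [add_assoc]
  have hg1 : (g : E[X]).natDegree = 1 := by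
    obtain ⟨q, hq⟩ := (mem_ore L D₁ δ₁ hD₁ _).1 (f.symm x₂).2
    have h1 := hfq _ q hq
    rw [AlgEquiv.apply_symm_apply] at h1
    have h2 : (x₂ : E[X]).natDegree = 1 := by simp [x₂]
    have hg0 : (g : E[X]) ≠ 0 := by
      intro h
      have := psi_natDegree_le L g q
      rw [← h1, h2, h] at this
      simp at this
    obtain ⟨b, hb0, hb⟩ := lc_ore L D₂ δ₂ hD₂ _ g.2 hg0
    have h3 := psi_natDegree L g q b hb0 hb
    rw [← h1, h2] at h3
    exact Nat.eq_one_of_mul_eq_one_left h3.symm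
  obtain ⟨q, hq⟩ := (mem_ore L D₂ δ₂ hD₂ _).1 g.2
  rw [hq, psi_natDegree'] at hg1
  apply hb
  refine ⟨q.coeff 1, fun a => ?_⟩
  have h1 : (g : E[X]) = C (L (q.coeff 0)) + C (L (q.coeff 1)) * (X + C D₂) := by
    rw [hq, psi_sum, hg1]
    simp [Finset.sum_range_succ]
  have h2 : (g : E[X]) * C (L a) = C (L a) * g + C (L (δ₁ a)) := congrArg Subtype.val (hcomm a)
  have h3 := congrArg (fun P => coeff P 0) h2
  simp only [h1, mul_add, add_mul, mul_assoc, coeff_add, coeff_C_mul, X_mul_C, ← C_mul] at h3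
  rw [hD₂] at h3
  simp [mul_add, ← mul_assoc, ← map_mul, mul_comm a] at h3
  rw [add_assoc, add_left_cancel_iff, add_left_cancel_iff] at h3
  apply Linj
  rw [← h3]

end swap
end gen
theorem div_aux {K : Type} [Field K] {p : ℕ} (hp : 0 < p) (x y : K) (hy : y ≠ 0) :
    x / y = x * y ^ (p - 1) * (y⁻¹) ^ p := by
  obtain ⟨n, rfl⟩ : ∃ n, p = n + 1 := ⟨p - 1, (Nat.sub_add_cancel hp).symm⟩
  rw [Nat.add_sub_cancel, pow_succ, inv_pow]
  field_simp

theorem exists_alpha (p : ℕ) [Fact p.Prime] :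
    ∃ α : GaloisField p 2, α ^ p ≠ α := by
  by_contra! h
  have hp : p.Prime := Fact.out
  have hc : Nat.card (GaloisField p 2) = p ^ 2 := GaloisField.card p 2 two_ne_zero
  have : Finite (GaloisField p 2) := Nat.finite_of_card_ne_zero (by rw [hc]; exact pow_ne_zero 2 hp.ne_zero)
  have := Fintype.ofFinite (GaloisField p 2)
  rw [Nat.card_eq_fintype_card] at hc
  have h1 : (X ^ p - X : (GaloisField p 2)[X]) ≠ 0 := FiniteField.X_pow_card_sub_X_ne_zero _ hp.one_lt
  have h2 := card_le_degree_of_subset_roots (p := (X ^ p - X : (GaloisField p 2)[X]))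
    (Z := Finset.univ) (by
      intro x _
      rw [mem_roots h1]
      simp [h x])
  rw [FiniteField.X_pow_card_sub_X_natDegree_eq _ hp.one_lt, Finset.card_univ, hc] at h2
  nlinarith [hp.two_le]

theorem exists_der {F : Type} [Field F] (K : Type) [Field K] [Algebra F K]
    [Algebra (MvPolynomial (Fin 2) F) K] [IsScalarTower F (MvPolynomial (Fin 2) F) K]
    [IsFractionRing (MvPolynomial (Fin 2) F) K] (c : Fin 2 → K) :
    ∃ d : K →+ K, (∀ x y, d (x * y) = x * d y + d x * y) ∧
      ∀ i, d (algebraMap (MvPolynomial (Fin 2) F) K (MvPolynomial.X i)) = c i := by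
  let φ₀ : MvPolynomial (Fin 2) F →+* TrivSqZeroExt K K :=
    MvPolynomial.eval₂Hom ((TrivSqZeroExt.inlHom K K).comp (algebraMap F K))
      (fun i => TrivSqZeroExt.inl (algebraMap (MvPolynomial (Fin 2) F) K (MvPolynomial.X i)) + TrivSqZeroExt.inr (c i))
  have hfst : ((TrivSqZeroExt.fstHom K K K : TrivSqZeroExt K K →+* K)).comp φ₀
      = algebraMap (MvPolynomial (Fin 2) F) K := by
    apply MvPolynomial.ringHom_ext
    · intro a
      simp [φ₀, IsScalarTower.algebraMap_apply F (MvPolynomial (Fin 2) F) K]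
    · intro i
      simp [φ₀]
  have hu : ∀ y : nonZeroDivisors (MvPolynomial (Fin 2) F), IsUnit (φ₀ y) := by
    intro y
    rw [TrivSqZeroExt.isUnit_iff_isUnit_fst]
    have := RingHom.congr_fun hfst y
    change (φ₀ y).fst = _ at this
    rw [this]
    exact IsLocalization.map_units K y
  let φ : K →+* TrivSqZeroExt K K := IsLocalization.lift hu
  have hφ : ∀ x, (φ x).fst = x := by
    have : ((TrivSqZeroExt.fstHom K K K : TrivSqZeroExt K K →+* K)).comp φ = RingHom.id K := by
      apply IsLocalization.ringHom_ext (nonZeroDivisors (MvPolynomial (Fin 2) F))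
      rw [RingHom.comp_assoc, IsLocalization.lift_comp, hfst]
      rfl
    exact fun x => RingHom.congr_fun this x
  refine ⟨⟨⟨fun x => (φ x).snd, by simp⟩, by simp⟩, ?_, ?_⟩
  · intro x y
    simp [hφ, mul_comm]
  · intro i
    change (φ _).snd = _
    rw [IsLocalization.lift_eq]
    simp [φ₀]

theorem exists_field (p : ℕ) [Fact p.Prime] :
    ∃ (K : Type) (_ : Field K) (_ : CharP K p) (u v α : K), u ≠ 0 ∧ v ≠ 0 ∧
      (α ^ p) ^ p = α ∧ α ^ p ≠ α ∧
      Algebra.adjoin (frobenius K p).fieldRange {u, v} = ⊤ ∧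
      ∀ a b : K, ∃ d : K →+ K, (∀ x y, d (x * y) = x * d y + d x * y) ∧ d u = a ∧ d v = b := by
  have hp : p.Prime := Fact.out
  obtain ⟨α, hα⟩ := exists_alpha p
  have hα2 : ∀ a : GaloisField p 2, (a ^ p) ^ p = a := by
    intro a
    have hc : Nat.card (GaloisField p 2) = p ^ 2 := GaloisField.card p 2 two_ne_zero
    have : Finite (GaloisField p 2) := Nat.finite_of_card_ne_zero (by rw [hc]; exact pow_ne_zero 2 hp.ne_zero)
    have := Fintype.ofFinite (GaloisField p 2)
    rw [Nat.card_eq_fintype_card] at hc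
    rw [← pow_mul, ← sq, ← hc, FiniteField.pow_card]
  let F := GaloisField p 2
  let P := MvPolynomial (Fin 2) F
  let K := FractionRing P
  have hch : CharP K p := charP_of_injective_algebraMap (algebraMap F K).injective p
  have hne : ∀ i, algebraMap P K (MvPolynomial.X i) ≠ 0 := fun i => by
    rw [map_ne_zero_iff _ (IsFractionRing.injective P K)]
    exact MvPolynomial.X_ne_zero i
  refine ⟨K, inferInstance, hch, algebraMap P K (MvPolynomial.X 0),
    algebraMap P K (MvPolynomial.X 1), algebraMap F K α, hne 0, hne 1, ?_, ?_, ?_, ?_⟩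
  · rw [← map_pow, ← map_pow, hα2]
  · rw [← map_pow]
    exact fun h => hα ((algebraMap F K).injective h)
  · set S := Algebra.adjoin (frobenius K p).fieldRange
      {algebraMap P K (MvPolynomial.X 0), algebraMap P K (MvPolynomial.X 1)} with hS
    have hpow : ∀ a : K, a ^ p ∈ S := fun a =>
      S.algebraMap_mem (⟨a ^ p, ⟨a, rfl⟩⟩ : (frobenius K p).fieldRange)
    have hPS : ∀ f : P, algebraMap P K f ∈ S := by
      intro f
      induction f using MvPolynomial.induction_on with
      | C a =>
        rw [← hα2 a, map_pow, map_pow]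
        exact hpow _
      | add f g hf hg => rw [map_add]; exact add_mem hf hg
      | mul_X f i hf =>
        rw [map_mul]
        refine mul_mem hf (Algebra.subset_adjoin ?_)
        fin_cases i <;> simp
    rw [eq_top_iff]
    rintro x -
    obtain ⟨f, g, hg, rfl⟩ := IsFractionRing.div_surjective (A := P) x
    have hg0 : algebraMap P K g ≠ 0 := by
      rw [map_ne_zero_iff _ (IsFractionRing.injective P K)]
      exact nonZeroDivisors.ne_zero hg
    have : algebraMap P K f / algebraMap P K g =
        algebraMap P K f * (algebraMap P K g) ^ (p - 1) * ((algebraMap P K g)⁻¹) ^ p := by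
      exact div_aux hp.pos _ _ hg0
    rw [this]
    exact mul_mem (mul_mem (hPS f) (pow_mem (hPS g) _)) (hpow _)
  · intro a b
    obtain ⟨d, hd, hd'⟩ := exists_der (F := F) K ![a, b]
    exact ⟨d, hd, hd' 0, hd' 1⟩

theorem der_pow (p : ℕ) [Fact p.Prime] {K : Type} [Field K] [CharP K p] (u v α : K)
    (D D' : Module.End (frobenius K p).fieldRange K)
    (hD : ∀ x y, D (x * y) = x * D y + D x * y) (hD' : ∀ x y, D' (x * y) = x * D' y + D' x * y)
    (hα : (α ^ p) ^ p = α)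
    (hS : Algebra.adjoin (frobenius K p).fieldRange {u, v} = ⊤)
    (h1 : D u = u) (h2 : D v = α * v) (h3 : D' u = u) (h4 : D' v = α ^ p * v) :
    D ^ p = D' := by
  have h1' : D 1 = 0 := by simpa using hD 1 1
  have h2' : D' 1 = 0 := by simpa using hD' 1 1
  have hp : p.Prime := Fact.out
  have key : ∀ w ∈ Submonoid.closure ({u, v} : Set K),
      ∃ c : K, (c ^ p) ^ p = c ∧ D w = c * w ∧ D' w = c ^ p * w := by
    intro w hw
    induction hw using Submonoid.closure_induction with
    | mem x hx =>
      rcases hx with rfl | hx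
      · exact ⟨1, by simp, by simp [h1], by simp [h3]⟩
      · rw [Set.mem_singleton_iff.1 hx]
        exact ⟨α, hα, h2, h4⟩
    | one => exact ⟨0, by simp [hp.ne_zero], by simp [h1'], by simp [h2', hp.ne_zero]⟩
    | mul x y _ _ hx hy =>
      obtain ⟨c, hc1, hc2, hc3⟩ := hx
      obtain ⟨e, he1, he2, he3⟩ := hy
      refine ⟨c + e, ?_, ?_, ?_⟩
      · rw [add_pow_char, add_pow_char, hc1, he1]
      · rw [hD, hc2, he2]; ring
      · rw [hD', hc3, he3, add_pow_char]; ring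
  have hspan : Submodule.span (frobenius K p).fieldRange
      (Submonoid.closure ({u, v} : Set K) : Set K) = ⊤ := by
    rw [← Algebra.adjoin_eq_span, hS, Algebra.top_toSubmodule]
  apply LinearMap.ext_on hspan
  intro w hw
  obtain ⟨c, hc1, hc2, hc3⟩ := key w hw
  have hn : ∀ n, (D ^ n) w = c ^ n * w := by
    intro n
    induction n with
    | zero => simp
    | succ n ih =>
      rw [pow_succ', Module.End.mul_apply, ih]
      have := D.map_smul (⟨c ^ n, ⟨(c ^ p) ^ n, by
        rw [frobenius_def, ← pow_mul, mul_comm n p, pow_mul, hc1]⟩⟩ : (frobenius K p).fieldRange) w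
      change D (c ^ n * w) = c ^ n * D w at this
      rw [this, hc2]; ring
  rw [hn, hc3]

theorem der_lin (p : ℕ) [Fact p.Prime] {K : Type} [Field K] [CharP K p] (d : K →+ K)
    (hd : ∀ x y, d (x * y) = x * d y + d x * y) :
    ∃ D : Module.End (frobenius K p).fieldRange K, ∀ x, D x = d x := by
  have h1 : d 1 = 0 := by simpa using hd 1 1
  have hpow : ∀ (c : K) (n : ℕ), d (c ^ (n + 1)) = (n + 1 : ℕ) * c ^ n * d c := by
    intro c n
    induction n with
    | zero => simp
    | succ n ih => rw [pow_succ, hd, ih]; push_cast; ring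
  have hp : p.Prime := Fact.out
  have hdp : ∀ c, d (c ^ p) = 0 := by
    intro c
    obtain ⟨n, hn⟩ : ∃ n, p = n + 1 := ⟨p - 1, (Nat.sub_add_cancel hp.one_le).symm⟩
    have := hpow c n
    rw [← hn] at this
    simpa using this
  refine ⟨{ toFun := d, map_add' := d.map_add, map_smul' := ?_ }, fun x => rfl⟩
  rintro ⟨_, c, rfl⟩ x
  change d (c ^ p * x) = c ^ p * d x
  rw [hd, hdp]; simp

theorem stmt_1 (p : ℕ) (hp : p.Prime) :
    ∃ (k : Type) (_ : Field k) (_ : CharP k p)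
      (A : Type) (_ : Ring A) (_ : Algebra k A),
      IsDomain A ∧
      (∃ (V : Submodule k A) (C : ℕ),
        (1 : A) ∈ V ∧ FiniteDimensional k V ∧
        Algebra.adjoin k (V : Set A) = ⊤ ∧
        ∀ n : ℕ, 1 ≤ n → Module.finrank k ↥(V ^ n) ≤ C * n) ∧
      ¬ Module.Finite k A ∧
      ∃ (B : Type) (_ : Ring B) (_ : Algebra k B),
        Nonempty (Polynomial A ≃ₐ[k] Polynomial B) ∧
        IsEmpty (A ≃ₐ[k] B) := by
  have : Fact p.Prime := ⟨hp⟩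
  obtain ⟨K, _, _, u, v, α, hu, hv, hα, hα', hS, hder⟩ := exists_field p
  obtain ⟨d₁, hd₁, hd₁u, hd₁v⟩ := hder u (α * v)
  obtain ⟨d₂, hd₂, hd₂u, hd₂v⟩ := hder u (α ^ p * v)
  obtain ⟨D₁, hD₁⟩ := der_lin p d₁ hd₁
  obtain ⟨D₂, hD₂⟩ := der_lin p d₂ hd₂
  simp only [← hD₁] at hd₁ hd₁u hd₁v
  simp only [← hD₂] at hd₂ hd₂u hd₂v
  have h12 : D₁ ^ p = D₂ := der_pow p u v α D₁ D₂ hd₁ hd₂ hα hS hd₁u hd₁v hd₂u hd₂v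
  have h21 : D₂ ^ p = D₁ := der_pow p u v (α ^ p) D₂ D₁ hd₂ hd₁ (by rw [hα]) hS hd₂u hd₂v hd₁u
    (by rw [hα, hd₁v])
  have hchk : CharP (frobenius K p).fieldRange p :=
    (RingHom.charP_iff (algebraMap (frobenius K p).fieldRange K)
      (algebraMap (frobenius K p).fieldRange K).injective p).2 inferInstance
  have hk : ∀ a : K, ∃ c : (frobenius K p).fieldRange,
      algebraMap (frobenius K p).fieldRange K c = a ^ p := fun a => ⟨⟨a ^ p, a, rfl⟩, rfl⟩
  have hfin : FiniteDimensional (frobenius K p).fieldRange K := by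
    have h : (Algebra.adjoin (frobenius K p).fieldRange {u, v}).toSubmodule.FG := by
      apply fg_adjoin_of_finite (by simp)
      intro x _
      obtain ⟨c, hc⟩ := hk x
      exact IsIntegral.of_pow hp.pos (hc ▸ isIntegral_algebraMap)
    rw [hS, Algebra.top_toSubmodule] at h
    exact ⟨h⟩
  let L : K →ₐ[(frobenius K p).fieldRange] Module.End (frobenius K p).fieldRange K :=
    Algebra.lmul _ K
  have hL₁ : ∀ a, D₁ * L a = L a * D₁ + L (D₁ a) := by
    intro a
    ext x
    exact hd₁ a x
  have hL₂ : ∀ a, D₂ * L a = L a * D₂ + L (D₂ a) := by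
    intro a
    ext x
    exact hd₂ a x
  refine ⟨(frobenius K p).fieldRange, inferInstance, hchk, ore L D₁, inferInstance, inferInstance,
    ore_domain L D₁ D₁ hL₁, ore_growth L D₁, ore_infinite L D₁, ore L D₂, inferInstance,
    inferInstance, ore_poly_equiv p L D₁ D₂ h12 h21,
    ore_not_iso p L D₁ D₂ D₁ D₂ hk hL₁ hL₂ ?_⟩
  rintro ⟨b, hb⟩
  have e1 := hb u
  have e2 := hb v
  rw [hd₁u, hd₂u] at e1
  have hb1 : b = 1 := by
    have : b * u = 1 * u := by rw [one_mul, ← e1]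
    exact mul_right_cancel₀ hu this
  rw [hd₁v, hd₂v, hb1, one_mul] at e2
  exact hα' (mul_right_cancel₀ hv e2).symm
end

section
/- Let A be a prime ring and let p(x) = a_0 + a_1 x + ⋯ + a_d x^d be a polynomial with coefficients a_0,…,a_d ∈ A (so p has degree at most d). If there exist d + 1 pairwise distinct elements z of the center of A such that a_0 + a_1 z + ⋯ + a_d z^d = 0 for each of them, then a_0 = a_1 = ⋯ = a_d = 0, i.e., p is the zero polynomial. -/
/-- In a prime ring, a polynomial of degree at most `d` vanishing at `d + 1`
distinct central elements has all coefficients zero. -/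
theorem stmt_2 (A : Type*) [Ring A]
    (hprime : ∀ a b : A, (∀ r : A, a * r * b = 0) → a = 0 ∨ b = 0)
    (d : ℕ) (a : Fin (d + 1) → A)
    (Z : Finset A) (hZcard : Z.card = d + 1)
    (hZcentral : ∀ z ∈ Z, z ∈ Subring.center A)
    (hroot : ∀ z ∈ Z, ∑ i : Fin (d + 1), a i * z ^ (i : ℕ) = 0) :
    ∀ i, a i = 0 := by
  classical
  rcases subsingleton_or_nontrivial A with hs | hn
  · intro i; exact Subsingleton.elim _ _
  have key : ∀ (c : Subring.center A) (x : A), (c : A) * x = 0 → (c : A) = 0 ∨ x = 0 := by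
    intro c x h
    apply hprime
    intro r
    have hc := Subring.mem_center_iff.1 c.2 r
    rw [← hc, mul_assoc, h, mul_zero]
  haveI : NoZeroDivisors (Subring.center A) := ⟨by
    intro x y h
    have h' : (x : A) * (y : A) = 0 := by
      have := congrArg Subtype.val h
      simpa using this
    rcases key x y h' with h1 | h1
    · left; exact Subtype.ext h1
    · right; exact Subtype.ext h1⟩
  haveI : IsDomain (Subring.center A) := NoZeroDivisors.to_isDomain _
  let e := (Z.equivFinOfCardEq hZcard).symm
  let v : Fin (d + 1) → Subring.center A := fun j => ⟨(e j : A), hZcentral _ (e j).2⟩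
  have hv : Function.Injective v := by
    intro j k h
    apply e.injective
    apply Subtype.ext
    exact congrArg (Subtype.val : Subring.center A → A) h
  have hdet := Matrix.det_vandermonde_ne_zero_iff.2 hv
  have hr : ∀ j, ∑ i, Matrix.vandermonde v j i • a i = 0 := by
    intro j
    rw [← hroot (e j) (e j).2]
    apply Finset.sum_congr rfl
    intro i _
    have hc := Subring.mem_center_iff.1 (v j ^ (i : ℕ)).2 (a i)
    rw [Matrix.vandermonde_apply, Subring.smul_def, smul_eq_mul, ← hc]
    rfl
  intro k
  have hk : (Matrix.vandermonde v).det • a k = 0 := by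
    have h1 : ∑ j, (Matrix.vandermonde v).adjugate k j •
        ∑ i, Matrix.vandermonde v j i • a i = 0 := by
      simp only [hr, smul_zero, Finset.sum_const_zero]
    simp only [Finset.smul_sum, smul_smul] at h1
    rw [Finset.sum_comm] at h1
    simp only [← Finset.sum_smul, ← Matrix.mul_apply, Matrix.adjugate_mul] at h1
    simpa [Matrix.smul_apply, Matrix.one_apply] using h1
  rcases key _ _ hk with h | h
  · exact absurd (Subtype.ext h) hdet
  · exact h
end

section
/- Let k be a field and let A be a finitely generated prime k-algebra whose center is infinite. Then ML^{H'}(A[x]) = ML^{H'}(A); explicitly, a polynomial f in the polynomial ring A[x] satisfies ∂_n(f) = 0 for every n ≥ 1 and every weakly locally nilpotent Hasse-Schmidt derivation ∂ = (∂_n) of the k-algebra A[x] if and only if f is a constant polynomial f = a with a ∈ A satisfying ∂_n(a) = 0 for every n ≥ 1 and every weakly locally nilpotent Hasse-Schmidt derivation ∂ = (∂_n) of A. -/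
/-- A Hasse-Schmidt derivation of a `k`-algebra `A`: a sequence of `k`-linear
maps `D n : A → A` with `D 0 = id` satisfying the higher Leibniz rule. -/
def IsHasseSchmidtDerivation (k A : Type*) [Field k] [Ring A] [Algebra k A]
    (D : ℕ → A →ₗ[k] A) : Prop :=
  D 0 = LinearMap.id ∧
    ∀ (n : ℕ) (a b : A),
      D n (a * b) = ∑ i ∈ Finset.range (n + 1), D i a * D (n - i) b

/-- A sequence of maps is weakly locally nilpotent if each element is
annihilated by all but finitely many of them. -/
def IsWeaklyLocallyNilpotent (k A : Type*) [Field k] [Ring A] [Algebra k A]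
    (D : ℕ → A →ₗ[k] A) : Prop :=
  ∀ a : A, ∃ N : ℕ, ∀ n ≥ N, D n a = 0

/-- The Makar-Limanov invariant `ML^{H'}(A)`: the common kernel of all weakly
locally nilpotent Hasse-Schmidt derivations of `A`. -/
def MLHprime (k A : Type*) [Field k] [Ring A] [Algebra k A] : Set A :=
  {a : A | ∀ D : ℕ → A →ₗ[k] A, IsHasseSchmidtDerivation k A D →
    IsWeaklyLocallyNilpotent k A D → ∀ n ≥ 1, D n a = 0}

open Polynomial in
/-- Coefficientwise extension of a linear map. -/
noncomputable def mlExt {k A : Type*} [Field k] [Ring A] [Algebra k A] (d : A →ₗ[k] A) :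
    Polynomial A →ₗ[k] Polynomial A where
  toFun f := ∑ i ∈ Finset.range (f.natDegree + 1), monomial i (d (f.coeff i))
  map_add' f g := by
    have key : ∀ f : Polynomial A, ∀ j,
        (∑ i ∈ Finset.range (f.natDegree + 1), monomial i (d (f.coeff i))).coeff j
          = d (f.coeff j) := by
      intro f j
      simp only [finsetSum_coeff, coeff_monomial, Finset.sum_ite_eq', Finset.mem_range]
      split_ifs with h
      · rfl
      · rw [coeff_eq_zero_of_natDegree_lt (by omega), map_zero]
    ext j
    rw [coeff_add, key, key, key, coeff_add, map_add]
  map_smul' c f := by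
    have key : ∀ f : Polynomial A, ∀ j,
        (∑ i ∈ Finset.range (f.natDegree + 1), monomial i (d (f.coeff i))).coeff j
          = d (f.coeff j) := by
      intro f j
      simp only [finsetSum_coeff, coeff_monomial, Finset.sum_ite_eq', Finset.mem_range]
      split_ifs with h
      · rfl
      · rw [coeff_eq_zero_of_natDegree_lt (by omega), map_zero]
    ext j
    rw [RingHom.id_apply, coeff_smul, key, key, coeff_smul, map_smul]

open Polynomial in
theorem mlExt_coeff {k A : Type*} [Field k] [Ring A] [Algebra k A] (d : A →ₗ[k] A)
    (f : Polynomial A) (j : ℕ) : (mlExt d f).coeff j = d (f.coeff j) := by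
  change (∑ i ∈ Finset.range (f.natDegree + 1), monomial i (d (f.coeff i))).coeff j = _
  simp only [finsetSum_coeff, coeff_monomial, Finset.sum_ite_eq', Finset.mem_range]
  split_ifs with h
  · rfl
  · rw [coeff_eq_zero_of_natDegree_lt (by omega), map_zero]

open Polynomial in
theorem ml_eq_zero {A : Type*} [Ring A]
    (hprime : ∀ a b : A, (∀ r : A, a * r * b = 0) → a = 0 ∨ b = 0) :
    ∀ (n : ℕ) (p : Polynomial A) (S : Set A), S.Infinite → S ⊆ Subring.center A →
      p.natDegree ≤ n → (∀ c ∈ S, p.eval c = 0) → p = 0 := by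
  intro n
  induction n with
  | zero =>
    intro p S hS _ hp h
    obtain ⟨c, hc⟩ := hS.nonempty
    rw [eq_C_of_natDegree_le_zero hp] at h ⊢
    have := h c hc
    rw [eval_C] at this
    rw [this, C_0]
  | succ n ih =>
    intro p S hS hSc hp h
    obtain ⟨c, hc⟩ := hS.nonempty
    nontriviality A
    have hdiv := modByMonic_add_div p (X - C c)
    have hmod : p %ₘ (X - C c) = 0 := by
      have hdeg : (p %ₘ (X - C c)).degree ≤ 0 := by
        have := degree_modByMonic_lt p (monic_X_sub_C c)
        rw [degree_X_sub_C] at this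
        exact Nat.WithBot.lt_one_iff_le_zero.1 this
      have h1 := h c hc
      rw [← hdiv, eval_add, eq_C_of_degree_le_zero hdeg, eval_C] at h1
      have h2 : eval c ((X - C c) * (p /ₘ (X - C c))) = 0 := by
        rw [eval, eval₂_mul_noncomm _ _
          (fun k => (Subring.mem_center_iff.1 (hSc hc) _))]
        change (X - C c).eval c * eval c _ = 0
        rw [eval_sub, eval_X, eval_C, sub_self, zero_mul]
      rw [h2, add_zero] at h1
      rw [eq_C_of_degree_le_zero hdeg, h1, C_0]
    rw [hmod, zero_add] at hdiv
    have hq : p /ₘ (X - C c) = 0 := by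
      refine ih _ (S \ {c}) (hS.sdiff (Set.finite_singleton c))
        (fun x hx => hSc hx.1) ?_ ?_
      · rw [natDegree_divByMonic _ (monic_X_sub_C c), natDegree_X_sub_C]; omega
      · intro d hd
        have hdc := hSc hd.1
        have hcc := hSc hc
        have hsub : d - c ∈ Subring.center A := sub_mem hdc hcc
        have h1 := h d hd.1
        rw [← hdiv, eval, eval₂_mul_noncomm _ _
          (fun k => (Subring.mem_center_iff.1 hdc _))] at h1
        change (X - C c).eval d * eval d _ = 0 at h1
        rw [eval_sub, eval_X, eval_C] at h1
        rcases hprime (d - c) (eval d (p /ₘ (X - C c))) (fun r => by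
          rw [← Subring.mem_center_iff.1 hsub r, mul_assoc, h1, mul_zero]) with h2 | h2
        · exact absurd (sub_eq_zero.1 h2) hd.2
        · exact h2
    rw [← hdiv, hq, mul_zero]

/-- For a finitely generated prime `k`-algebra `A` with infinite centre,
`ML^{H'}(A[x]) = ML^{H'}(A)`. -/
theorem stmt_3 (k A : Type*) [Field k] [Ring A] [Algebra k A]
    (hfg : Algebra.FiniteType k A)
    (hprime : ∀ a b : A, (∀ r : A, a * r * b = 0) → a = 0 ∨ b = 0)
    (hcenter : (Subring.center A : Set A).Infinite) :
    ∀ f : Polynomial A,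
      f ∈ MLHprime k (Polynomial A) ↔
        ∃ a ∈ MLHprime k A, f = Polynomial.C a := by
  intro f
  constructor
  · intro hf
    have hC : f = Polynomial.C (f.coeff 0) := by
      have h := hf (fun n => (Polynomial.hasseDeriv n).restrictScalars k) ⟨?_, ?_⟩ ?_
      · ext n
        rcases Nat.eq_zero_or_pos n with rfl | hn
        · simp
        · have := congrArg (fun p => Polynomial.coeff p 0) (h n hn)
          simp only [LinearMap.coe_restrictScalars, Polynomial.hasseDeriv_coeff,
            zero_add, Nat.choose_self, Nat.cast_one, one_mul, Polynomial.coeff_zero] at this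
          rw [this, Polynomial.coeff_C, if_neg (by omega)]
      · ext1 p
        simp
      · intro n a b
        simp only [LinearMap.coe_restrictScalars]
        rw [Polynomial.hasseDeriv_mul, Finset.Nat.sum_antidiagonal_eq_sum_range_succ
          (fun i j => Polynomial.hasseDeriv i a * Polynomial.hasseDeriv j b)]
      · intro p
        refine ⟨p.natDegree + 1, fun n hn => ?_⟩
        exact Polynomial.hasseDeriv_eq_zero_of_lt_natDegree p n (by omega)
    refine ⟨f.coeff 0, ?_, hC⟩
    intro D hD hN n hn
    have h := hf (fun n => mlExt (D n)) ⟨?_, ?_⟩ ?_ n hn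
    · have := congrArg (fun p => Polynomial.coeff p 0) h
      simpa only [mlExt_coeff, Polynomial.coeff_zero] using this
    · ext1 p
      ext j
      rw [mlExt_coeff, hD.1]; rfl
    · intro n a b
      ext j
      simp only [mlExt_coeff, Polynomial.coeff_mul, Polynomial.finsetSum_coeff, map_sum, hD.2]
      rw [Finset.sum_comm]
    · intro p
      choose N hN using hN
      refine ⟨(Finset.range (p.natDegree + 1)).sup (fun i => N (p.coeff i)), fun n hn => ?_⟩
      ext j
      rw [mlExt_coeff, Polynomial.coeff_zero]
      by_cases hj : j < p.natDegree + 1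
      · exact hN _ _ (le_trans (Finset.le_sup (f := fun i => N (p.coeff i))
          (Finset.mem_range.2 hj)) hn)
      · rw [Polynomial.coeff_eq_zero_of_natDegree_lt (by omega), map_zero]
  · rintro ⟨a, ha, rfl⟩ D hD hN n hn
    refine ml_eq_zero hprime _ _ _ hcenter subset_rfl le_rfl ?_
    intro c hc
    let E : ℕ → A →ₗ[k] A := fun n =>
      { toFun := fun a => (D n (Polynomial.C a)).eval c
        map_add' := fun a b => by simp
        map_smul' := fun r a => by
          rw [← Polynomial.smul_C, map_smul, Polynomial.eval_smul, RingHom.id_apply] }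
    have hE : ∀ n a, E n a = (D n (Polynomial.C a)).eval c := fun _ _ => rfl
    rw [← hE]
    refine ha E ⟨?_, ?_⟩ ?_ n hn
    · ext1 b
      rw [hE, hD.1]; simp
    · intro n x y
      simp only [hE]
      rw [Polynomial.C_mul, hD.2, Polynomial.eval_finsetSum]
      refine Finset.sum_congr rfl fun i _ => ?_
      exact Polynomial.eval₂_mul_noncomm _ _ (fun k => (Subring.mem_center_iff.1 hc _))
    · intro x
      obtain ⟨N, h⟩ := hN (Polynomial.C x)
      exact ⟨N, fun n hn => by rw [hE, h n hn, Polynomial.eval_zero]⟩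
end

section
/- (Noncommutative slice theorem, derivation form.) Let k be a field of characteristic zero, let A be a k-algebra, let δ be a locally nilpotent k-linear derivation of A, and suppose there exists a central element x of A with δ(x) = 1. Let A_0 = ker(δ). Then every element a ∈ A can be written uniquely as a finite sum a = Σ_i b_i x^i with all b_i ∈ A_0; that is, the sum Σ_{i≥0} A_0 x^i is direct and A = A_0[x]. -/
/-- Noncommutative slice theorem, derivation form: if `δ` is a locally
nilpotent `k`-linear derivation of `A` (char 0) and `x` is a central element
with `δ x = 1`, then `A = A₀[x]` where `A₀ = ker δ`, with uniqueness of
representations. -/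
theorem stmt_4 (k A : Type*) [Field k] [CharZero k] [Ring A] [Algebra k A]
    (δ : A →ₗ[k] A)
    (hder : ∀ a b : A, δ (a * b) = δ a * b + a * δ b)
    (hln : ∀ a : A, ∃ n : ℕ, (δ ^ n) a = 0)
    (x : A) (hx : x ∈ Subring.center A) (hδx : δ x = 1) :
    (∀ a : A, ∃ b : ℕ →₀ A, (∀ i, δ (b i) = 0) ∧
        a = b.sum fun i c => c * x ^ i) ∧
    (∀ b : ℕ →₀ A, (∀ i, δ (b i) = 0) →
        b.sum (fun i c => c * x ^ i) = 0 → b = 0) := by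
  have hpow : ∀ n : ℕ, δ (x ^ (n + 1)) = ((n : k) + 1) • x ^ n := by
    intro n
    induction n with
    | zero => simp [hδx]
    | succ n ih =>
      rw [pow_succ, hder, ih, hδx, smul_mul_assoc, ← pow_succ, mul_one]
      push_cast
      simp only [add_smul, one_smul]
  have hterm : ∀ (c : A) (n : ℕ), δ c = 0 →
      δ (c * x ^ (n + 1)) = ((n : k) + 1) • (c * x ^ n) := by
    intro c n hc
    rw [hder, hc, zero_mul, zero_add, hpow, mul_smul_comm]
  have hne : ∀ n : ℕ, (n : k) + 1 ≠ 0 := fun n => Nat.cast_add_one_ne_zero n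
  constructor
  · let P : A → Prop := fun a => ∃ b : ℕ →₀ A, (∀ i, δ (b i) = 0) ∧
        a = b.sum fun i c => c * x ^ i
    have P0 : P 0 := ⟨0, by simp, by simp⟩
    have Padd : ∀ a b, P a → P b → P (a + b) := by
      rintro a b ⟨f, hf, rfl⟩ ⟨g, hg, rfl⟩
      refine ⟨f + g, fun i => by simp [hf, hg], ?_⟩
      rw [Finsupp.sum_add_index'] <;> simp [add_mul]
    have Psing : ∀ (c : A) (n : ℕ), δ c = 0 → P (c * x ^ n) := by
      intro c n hc
      refine ⟨Finsupp.single n c, fun i => ?_, by simp⟩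
      by_cases h : n = i
      · subst h; simpa using hc
      · simp [Finsupp.single_apply, h]
    have main : ∀ (n : ℕ) (a : A), (δ ^ n) a = 0 → P a := by
      intro n
      induction n with
      | zero => intro a ha; simp at ha; rw [ha]; exact P0
      | succ n ih =>
        intro a ha
        rw [pow_succ, Module.End.mul_apply] at ha
        obtain ⟨b, hb, hab⟩ := ih _ ha
        let t : A := ∑ i ∈ b.support, (((i : k) + 1)⁻¹ • b i) * x ^ (i + 1)
        have hc : ∀ i : ℕ, δ (((i : k) + 1)⁻¹ • b i) = 0 := fun i => by
          rw [map_smul, hb, smul_zero]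
        have ht : P t := Finset.sum_induction _ P Padd P0 (fun i _ => Psing _ _ (hc i))
        have hdt : δ t = δ a := by
          rw [hab, Finsupp.sum, map_sum]
          refine Finset.sum_congr rfl fun i _ => ?_
          rw [hterm _ _ (hc i), smul_mul_assoc, smul_inv_smul₀ (hne i)]
        have h1 : P (a - t) := by
          have := Psing (a - t) 0 (by rw [map_sub, hdt, sub_self])
          simpa using this
        simpa using Padd _ _ h1 ht
    intro a
    obtain ⟨n, hn⟩ := hln a
    exact main n a hn
  · have key : ∀ (n : ℕ) (f : ℕ → A), (∀ i, δ (f i) = 0) →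
        ∑ i ∈ Finset.range n, f i * x ^ i = 0 → ∀ i < n, f i = 0 := by
      intro n
      induction n with
      | zero => intro f _ _ i hi; omega
      | succ n ih =>
        intro f hf hs
        have hd : ∑ i ∈ Finset.range n, (((i : k) + 1) • f (i + 1)) * x ^ i = 0 := by
          have h2 := congrArg δ hs
          rw [Finset.sum_range_succ', map_add, map_sum, map_zero] at h2
          simp only [pow_zero, mul_one, hf, add_zero] at h2
          rw [← h2]
          refine Finset.sum_congr rfl fun i _ => ?_
          rw [hterm _ _ (hf _), smul_mul_assoc]
        have h3 : ∀ i < n, f (i + 1) = 0 := fun i hi =>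
          (smul_eq_zero_iff_right (hne i)).1
            (ih (fun i => ((i : k) + 1) • f (i + 1))
              (fun i => by rw [map_smul, hf, smul_zero]) hd i hi)
        rw [Finset.sum_range_succ', Finset.sum_eq_zero (fun i hi => by
          rw [h3 i (Finset.mem_range.1 hi), zero_mul])] at hs
        intro i hi
        cases i with
        | zero => simpa using hs
        | succ i => exact h3 i (by omega)
    intro b hb hs
    ext i
    have hsub : b.support ⊆ Finset.range (b.support.sup id + 1 + i + 1) := by
      intro j hj
      have : j ≤ b.support.sup id := Finset.le_sup (f := id) hj
      rw [Finset.mem_range]; omega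
    rw [Finsupp.sum_of_support_subset b hsub _ (by simp)] at hs
    exact key _ b hb hs i (by omega)
end

section
/- (Noncommutative slice theorem, Hasse-Schmidt form.) Let k be a field, let A be a k-algebra, and let ∂ = (∂_n)_{n≥0} be an iterative weakly locally nilpotent Hasse-Schmidt derivation of A. Suppose there exists a central element x of A with ∂_1(x) = 1 and ∂_i(x) = 0 for all i ≥ 2. Let A_0 = ∩_{n≥1} ker(∂_n). Then every element a ∈ A can be written uniquely as a finite sum a = Σ_i b_i x^i with all b_i ∈ A_0; that is, the sum Σ_{i≥0} A_0 x^i is direct and A = A_0[x]. -/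
/-- Noncommutative slice theorem, Hasse-Schmidt form: if `∂` is an iterative
weakly locally nilpotent Hasse-Schmidt derivation of `A` and `x` is a central
element with `∂ 1 x = 1` and `∂ i x = 0` for `i ≥ 2`, then `A = A₀[x]` where
`A₀ = ⋂_{n ≥ 1} ker (∂ n)`, with uniqueness of representations. -/
theorem stmt_5 (k A : Type*) [Field k] [Ring A] [Algebra k A]
    (D : ℕ → A →ₗ[k] A)
    (hD0 : D 0 = LinearMap.id)
    (hleib : ∀ (n : ℕ) (a b : A),
      D n (a * b) = ∑ i ∈ Finset.range (n + 1), D i a * D (n - i) b)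
    (hiter : ∀ (i j : ℕ) (a : A), D i (D j a) = (i + j).choose i • D (i + j) a)
    (hwln : ∀ a : A, ∃ N : ℕ, ∀ n ≥ N, D n a = 0)
    (x : A) (hx : x ∈ Subring.center A)
    (hx1 : D 1 x = 1) (hxi : ∀ i ≥ 2, D i x = 0) :
    (∀ a : A, ∃ b : ℕ →₀ A, (∀ i, ∀ n ≥ 1, D n (b i) = 0) ∧
        a = b.sum fun i c => c * x ^ i) ∧
    (∀ b : ℕ →₀ A, (∀ i, ∀ n ≥ 1, D n (b i) = 0) →
        b.sum (fun i c => c * x ^ i) = 0 → b = 0) := by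
  have h0 : ∀ a, D 0 a = a := fun a => by rw [hD0]; rfl
  have hone : ∀ n ≥ 1, D n (1 : A) = 0 := by
    intro n hn
    rw [← hx1, hiter, hxi _ (by omega), smul_zero]
  have hc : ∀ c : A, (∀ n ≥ 1, D n c = 0) → ∀ n y, D n (c * y) = c * D n y := by
    intro c hc n y
    rw [hleib, Finset.sum_eq_single 0]
    · rw [h0, Nat.sub_zero]
    · intro i _ hi
      rw [hc i (by omega), zero_mul]
    · intro h
      simp at h
  have hpow : ∀ m : ℕ, (∀ n > m, D n (x ^ m) = 0) ∧ D m (x ^ m) = 1 := by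
    intro m
    induction m with
    | zero =>
      refine ⟨fun n hn => ?_, ?_⟩
      · rw [pow_zero]
        exact hone n hn
      · rw [pow_zero, h0]
    | succ m ih =>
      refine ⟨fun n hn => ?_, ?_⟩
      · rw [pow_succ, hleib]
        refine Finset.sum_eq_zero fun i _ => ?_
        by_cases hi : m < i
        · rw [ih.1 i hi, zero_mul]
        · rw [hxi (n - i) (by omega), mul_zero]
      · rw [pow_succ, hleib, Finset.sum_eq_single m]
        · rw [ih.2, Nat.add_sub_cancel_left, hx1, one_mul]
        · intro i _ hne
          by_cases hi : m < i
          · rw [ih.1 i hi, zero_mul]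
          · rw [hxi (m + 1 - i) (by omega), mul_zero]
        · intro h
          exact absurd (Finset.mem_range.2 (by omega)) h
  refine ⟨?_, ?_⟩
  · have key : ∀ N : ℕ, ∀ a : A, (∀ n ≥ N, D n a = 0) →
        ∃ b : ℕ →₀ A, (∀ i, ∀ n ≥ 1, D n (b i) = 0) ∧
          a = b.sum fun i c => c * x ^ i := by
      intro N
      induction N with
      | zero =>
        intro a ha
        refine ⟨0, fun i n _ => by simp, ?_⟩
        rw [Finsupp.sum_zero_index, ← h0 a]
        exact ha 0 le_rfl
      | succ N ih =>
        intro a ha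
        have hcA : ∀ n ≥ 1, D n (D N a) = 0 := by
          intro n hn
          rw [hiter, ha _ (by omega), smul_zero]
        obtain ⟨b, hb, hs⟩ := ih (a - D N a * x ^ N) (by
          intro n hn
          rw [map_sub, hc _ hcA]
          rcases Nat.eq_or_lt_of_le hn with h | h
          · subst h
            rw [(hpow _).2, mul_one, sub_self]
          · rw [(hpow N).1 n h, ha n h, mul_zero, sub_zero])
        refine ⟨b + Finsupp.single N (D N a), ?_, ?_⟩
        · intro i n hn
          rw [Finsupp.add_apply, map_add, hb i n hn, zero_add, Finsupp.single_apply]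
          split_ifs
          · exact hcA n hn
          · exact map_zero _
        · rw [Finsupp.sum_add_index' (by simp) (by intros; rw [add_mul]), ← hs,
            Finsupp.sum_single_index (by simp)]
          abel
    intro a
    obtain ⟨N, hN⟩ := hwln a
    exact key N a hN
  · intro b hb hs
    by_contra hne
    have hsup : b.support.Nonempty := Finsupp.support_nonempty_iff.2 hne
    set M := b.support.max' hsup with hM
    have hMm : M ∈ b.support := Finset.max'_mem _ _
    have h1 : D M (b.sum fun i c => c * x ^ i) = b M := by
      rw [Finsupp.sum, map_sum, Finset.sum_eq_single M]
      · rw [hc _ (hb M), (hpow M).2, mul_one]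
      · intro i hi hiM
        have : i ≤ M := Finset.le_max' _ _ hi
        rw [hc _ (hb i), (hpow i).1 M (by omega), mul_zero]
      · intro h
        exact absurd hMm h
    rw [hs, map_zero] at h1
    exact Finsupp.mem_support_iff.1 hMm h1.symm
end

section
/- Let k be a field, let A be a prime k-algebra, let ∂ = (∂_n)_{n≥0} be an iterative weakly locally nilpotent Hasse-Schmidt derivation of A, and let B = ∩_{n≥1} ker(∂_n). Suppose x ∈ A and m ≥ 1 are such that ∂_{m+i}(x) = 0 for all i ≥ 1 and ∂_m(x) is a regular element of A (neither a left nor a right zero divisor). Then the sum B + Bx + Bx^2 + ⋯ is direct: if b_0, …, b_s ∈ B satisfy b_0 + b_1 x + ⋯ + b_s x^s = 0, then b_0 = ⋯ = b_s = 0. -/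
/-- If `∂` is an iterative weakly locally nilpotent Hasse-Schmidt derivation of
a prime `k`-algebra `A`, `B = ⋂_{n ≥ 1} ker (∂ n)`, and `x ∈ A`, `m ≥ 1` are
such that `∂ (m + i) x = 0` for `i ≥ 1` and `∂ m x` is regular, then the sum
`B + Bx + Bx² + ⋯` is direct. -/
theorem stmt_6 (k A : Type*) [Field k] [Ring A] [Algebra k A]
    (hprime : ∀ a b : A, (∀ r : A, a * r * b = 0) → a = 0 ∨ b = 0)
    (D : ℕ → A →ₗ[k] A)
    (hD0 : D 0 = LinearMap.id)
    (hleib : ∀ (n : ℕ) (a b : A),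
      D n (a * b) = ∑ i ∈ Finset.range (n + 1), D i a * D (n - i) b)
    (hiter : ∀ (i j : ℕ) (a : A), D i (D j a) = (i + j).choose i • D (i + j) a)
    (hwln : ∀ a : A, ∃ N : ℕ, ∀ n ≥ N, D n a = 0)
    (x : A) (m : ℕ) (hm : 1 ≤ m)
    (hhigh : ∀ i ≥ 1, D (m + i) x = 0)
    (hregl : ∀ y : A, D m x * y = 0 → y = 0)
    (hregr : ∀ y : A, y * D m x = 0 → y = 0)
    (s : ℕ) (b : Fin (s + 1) → A)
    (hb : ∀ i, ∀ n ≥ 1, D n (b i) = 0)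
    (hsum : ∑ i : Fin (s + 1), b i * x ^ (i : ℕ) = 0) :
    ∀ i, b i = 0 := by
  have key : ∀ c : A, (∀ n ≥ 1, D n c = 0) → ∀ j : ℕ,
      D (m * j) (c * x ^ j) = c * (D m x) ^ j ∧ ∀ n, m * j < n → D n (c * x ^ j) = 0 := by
    intro c hc j
    induction j with
    | zero =>
      refine ⟨by simp [hD0], fun n hn => ?_⟩
      simpa using hc n (by omega)
    | succ j ih =>
      obtain ⟨ih1, ih2⟩ := ih
      have hx : ∀ n, m < n → D n x = 0 := by
        intro n hn
        have := hhigh (n - m) (by omega)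
        rwa [show m + (n - m) = n by omega] at this
      refine ⟨?_, fun n hn => ?_⟩
      · rw [pow_succ, ← mul_assoc, hleib, Finset.sum_eq_single (m * j)]
        · rw [ih1, show m * (j + 1) - m * j = m by rw [mul_add, mul_one]; omega, pow_succ, mul_assoc]
        · intro i hi hne
          rcases lt_or_gt_of_ne hne with h | h
          · rw [hx _ (by rw [mul_add, mul_one]; omega), mul_zero]
          · rw [ih2 i h, zero_mul]
        · intro h
          exact absurd (Finset.mem_range.2 (by rw [mul_add, mul_one]; omega)) h
      · rw [pow_succ, ← mul_assoc, hleib]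
        rw [mul_add, mul_one] at hn
        refine Finset.sum_eq_zero fun i hi => ?_
        rcases le_or_gt i (m * j) with h | h
        · rw [hx _ (by omega), mul_zero]
        · rw [ih2 i h, zero_mul]
  have hpow : ∀ (j : ℕ) (y : A), y * (D m x) ^ j = 0 → y = 0 := by
    intro j
    induction j with
    | zero => intro y h; simpa using h
    | succ j ih =>
      intro y h
      rw [pow_succ, ← mul_assoc] at h
      exact ih y (hregr _ h)
  by_contra hne
  push Not at hne
  obtain ⟨i0, hi0⟩ := hne
  classical
  obtain ⟨t, ht, hmax⟩ := Finset.exists_max_image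
    (Finset.univ.filter fun i => b i ≠ 0) (fun i => i) ⟨i0, by simpa using hi0⟩
  have htne : b t ≠ 0 := by simpa using ht
  apply htne
  apply hpow (t : ℕ)
  have h := congrArg (D (m * (t : ℕ))) hsum
  rw [map_zero, map_sum, Finset.sum_eq_single t] at h
  · rw [← h, (key (b t) (hb t) t).1]
  · intro i _ hit
    by_cases hbi : b i = 0
    · simp [hbi]
    · have hlt : i < t := lt_of_le_of_ne (hmax i (by simpa using hbi)) hit
      exact (key (b i) (hb i) i).2 _ (Nat.mul_lt_mul_of_pos_left hlt (by omega))
  · intro h; exact absurd (Finset.mem_univ t) h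
end

section
/- Let k be a field, let A be a field which is a k-algebra, let ∂ = (∂_n)_{n≥0} be an iterative weakly locally nilpotent Hasse-Schmidt derivation of A over k, and let B = {a ∈ A : ∂_n(a) = 0 for all n ≥ 1} (a k-subalgebra of A, in fact a subfield). If every element of A is algebraic over B — that is, for every a ∈ A there are elements b_0, …, b_s ∈ B, not all zero, with b_0 + b_1 a + ⋯ + b_s a^s = 0 — then A = B. -/
/-- If `A` is a field with an iterative weakly locally nilpotent Hasse-Schmidt
derivation `∂` over `k`, with kernel `B`, and `A` is algebraic over `B`, then
`A = B`. -/
theorem stmt_7 (k A : Type*) [Field k] [Field A] [Algebra k A]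
    (D : ℕ → A →ₗ[k] A)
    (hD0 : D 0 = LinearMap.id)
    (hleib : ∀ (n : ℕ) (a b : A),
      D n (a * b) = ∑ i ∈ Finset.range (n + 1), D i a * D (n - i) b)
    (hiter : ∀ (i j : ℕ) (a : A), D i (D j a) = (i + j).choose i • D (i + j) a)
    (hwln : ∀ a : A, ∃ N : ℕ, ∀ n ≥ N, D n a = 0)
    (halg : ∀ a : A, ∃ (s : ℕ) (b : Fin (s + 1) → A),
      (∀ i, ∀ n ≥ 1, D n (b i) = 0) ∧ (∃ i, b i ≠ 0) ∧
        ∑ i : Fin (s + 1), b i * a ^ (i : ℕ) = 0) :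
    ∀ a : A, ∀ n ≥ 1, D n a = 0 := by
  have hP : ∀ a : A, ∃ P : Polynomial A, ∀ n, P.coeff n = D n a := by
    intro a
    obtain ⟨N, hN⟩ := hwln a
    refine ⟨∑ i ∈ Finset.range N, Polynomial.monomial i (D i a), fun n => ?_⟩
    rw [Polynomial.finsetSum_coeff]
    simp only [Polynomial.coeff_monomial, Finset.sum_ite_eq', Finset.mem_range]
    split_ifs with h
    · rfl
    · exact (hN n (not_lt.mp h)).symm
  choose P hP using hP
  have hmul : ∀ a b, P (a * b) = P a * P b := by
    intro a b
    ext n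
    rw [hP, hleib, Polynomial.coeff_mul,
      Finset.Nat.sum_antidiagonal_eq_sum_range_succ_mk]
    simp only [hP]
  have hne : ∀ a, a ≠ 0 → P a ≠ 0 := by
    intro a ha h
    have := hP a 0
    rw [h, hD0] at this
    exact ha (by simpa using this.symm)
  have h1 : P 1 = 1 := by
    have h := hmul 1 1
    rw [mul_one] at h
    exact (mul_eq_left₀ (hne 1 one_ne_zero)).mp h.symm
  intro a n hn
  by_cases ha : a = 0
  · rw [ha, map_zero]
  have hu : IsUnit (P a) := by
    refine IsUnit.of_mul_eq_one (P a⁻¹) ?_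
    rw [← hmul, mul_inv_cancel₀ ha, h1]
  rw [← hP a n]
  apply Polynomial.coeff_eq_zero_of_natDegree_lt
  rw [Polynomial.natDegree_eq_zero_of_isUnit hu]
  omega
end

section
/- Let k be a field and let A be a finitely generated k-algebra which is a domain of Gelfand–Kirillov dimension one; concretely, assume there are a finite-dimensional k-subspace V ∋ 1 generating A as a k-algebra and a constant C with dim_k V^n ≤ C·n for all n ≥ 1, and that A is infinite-dimensional over k. Let ∂ = (∂_n)_{n≥0} be an iterative weakly locally nilpotent Hasse-Schmidt derivation of A and let B = ∩_{n≥1} ker(∂_n). If B ≠ A, then B is finite-dimensional as a k-vector space. -/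
theorem aux_indep {k A : Type*} [Field k] [Ring A] [IsDomain A] [Algebra k A]
    (D : ℕ → A →ₗ[k] A)
    (hD0 : D 0 = LinearMap.id)
    (hleib : ∀ (n : ℕ) (a b : A),
      D n (a * b) = ∑ i ∈ Finset.range (n + 1), D i a * D (n - i) b)
    (a : A) (d : ℕ) (hd : 1 ≤ d) (had : D d a ≠ 0) (hgt : ∀ n > d, D n a = 0)
    (n : ℕ) (b : ℕ → A) (hb : ∀ i, ∀ m ≥ 1, D m (b i) = 0)
    (h : ∑ i ∈ Finset.range n, b i * a ^ i = 0) : ∀ i < n, b i = 0 := by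
  have hmul : ∀ (i m : ℕ) (x : A), D m (b i * x) = b i * D m x := by
    intro i m x
    rw [hleib, Finset.sum_eq_single 0]
    · simp [hD0]
    · intro j _ hj
      rw [hb i j (by omega), zero_mul]
    · simp
  have hone : ∀ m ≥ 1, D m (1 : A) = 0 := by
    intro m
    induction m using Nat.strong_induction_on with
    | _ m ih =>
      intro hm
      have h1 := hleib m 1 1
      obtain ⟨p, rfl⟩ : ∃ p, m = p + 1 := ⟨m - 1, by omega⟩
      rw [Finset.sum_range_succ, Finset.sum_range_succ', Finset.sum_eq_zero] at h1
      · simpa [hD0] using h1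
      · intro i hi
        rw [Finset.mem_range] at hi
        rw [ih (i + 1) (by omega) (by omega), zero_mul]
  have hpow : ∀ i, (∀ m > d * i, D m (a ^ i) = 0) ∧ D (d * i) (a ^ i) = D d a ^ i := by
    intro i
    induction i with
    | zero => exact ⟨fun m hm => by simpa using hone m (by omega), by simp [hD0]⟩
    | succ i ih =>
      obtain ⟨ih1, ih2⟩ := ih
      rw [Nat.mul_succ]
      refine ⟨fun m hm => ?_, ?_⟩
      · rw [pow_succ, hleib]
        refine Finset.sum_eq_zero fun j _ => ?_
        by_cases hj : d * i < j
        · rw [ih1 j hj, zero_mul]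
        · rw [hgt (m - j) (by omega), mul_zero]
      · rw [pow_succ, hleib, Finset.sum_eq_single (d * i)]
        · rw [ih2, pow_succ, Nat.add_sub_cancel_left]
        · intro j _ hne
          by_cases hj : d * i < j
          · rw [ih1 j hj, zero_mul]
          · rw [hgt (d * i + d - j) (by omega), mul_zero]
        · intro hj
          exact absurd (Finset.mem_range.2 (by omega)) hj
  induction n with
  | zero => intro i hi; omega
  | succ n ih =>
    have hn : b n = 0 := by
      have h2 := congrArg (D (d * n)) h
      rw [map_sum, Finset.sum_range_succ, Finset.sum_eq_zero, hmul, (hpow n).2, map_zero,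
        zero_add] at h2
      · exact (mul_eq_zero.1 h2).resolve_right (pow_ne_zero _ had)
      · intro j hj
        rw [Finset.mem_range] at hj
        rw [hmul, (hpow j).1 _ (Nat.mul_lt_mul_of_pos_left hj (by omega)), mul_zero]
    rw [Finset.sum_range_succ, hn, zero_mul, add_zero] at h
    intro i hi
    rcases Nat.lt_succ_iff_lt_or_eq.1 hi with h3 | rfl
    · exact ih h i h3
    · exact hn

/-- For an affine domain `A` of Gelfand–Kirillov dimension one over `k`, the
kernel `B` of a nontrivial iterative weakly locally nilpotent Hasse-Schmidt
derivation is finite-dimensional over `k`. -/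
theorem stmt_8 (k A : Type*) [Field k] [Ring A] [IsDomain A] [Algebra k A]
    (V : Submodule k A) (hV1 : (1 : A) ∈ V)
    (hVfd : FiniteDimensional k V)
    (hVgen : Algebra.adjoin k (V : Set A) = ⊤)
    (C : ℕ) (hgrowth : ∀ n : ℕ, 1 ≤ n → Module.finrank k ↥(V ^ n) ≤ C * n)
    (hinf : ¬ Module.Finite k A)
    (D : ℕ → A →ₗ[k] A)
    (hD0 : D 0 = LinearMap.id)
    (hleib : ∀ (n : ℕ) (a b : A),
      D n (a * b) = ∑ i ∈ Finset.range (n + 1), D i a * D (n - i) b)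
    (hiter : ∀ (i j : ℕ) (a : A), D i (D j a) = (i + j).choose i • D (i + j) a)
    (hwln : ∀ a : A, ∃ N : ℕ, ∀ n ≥ N, D n a = 0)
    (B : Submodule k A) (hB : ∀ a : A, a ∈ B ↔ ∀ n ≥ 1, D n a = 0)
    (hBne : B ≠ ⊤) :
    FiniteDimensional k B := by
  classical
  have hmono : ∀ {p q : ℕ}, p ≤ q → V ^ p ≤ V ^ q := fun h =>
    pow_le_pow_right' (Submodule.one_le.2 hV1) h
  have hex : ∀ x : A, ∃ n, x ∈ V ^ n := by
    intro x
    have hx : x ∈ Algebra.adjoin k (V : Set A) := by rw [hVgen]; trivial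
    induction hx using Algebra.adjoin_induction with
    | mem x hx => exact ⟨1, by simpa using hx⟩
    | algebraMap r => exact ⟨0, by rw [pow_zero]; exact Submodule.algebraMap_mem r⟩
    | add x y _ _ hx hy =>
      obtain ⟨p, hp⟩ := hx
      obtain ⟨q, hq⟩ := hy
      exact ⟨p + q, add_mem (hmono (by omega) hp) (hmono (by omega) hq)⟩
    | mul x y _ _ hx hy =>
      obtain ⟨p, hp⟩ := hx
      obtain ⟨q, hq⟩ := hy
      exact ⟨p + q, by rw [pow_add]; exact Submodule.mul_mem_mul hp hq⟩
  obtain ⟨a, haB⟩ : ∃ a, a ∉ B := by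
    by_contra! h
    exact hBne (eq_top_iff.2 fun x _ => h x)
  obtain ⟨d, hd, had, hgt⟩ : ∃ d, 1 ≤ d ∧ D d a ≠ 0 ∧ ∀ n > d, D n a = 0 := by
    rw [hB] at haB
    push Not at haB
    obtain ⟨e, he, hea⟩ := haB
    obtain ⟨N, hN⟩ := hwln a
    have heN : e ≤ N := by
      by_contra hc
      exact hea (hN e (by omega))
    refine ⟨Nat.findGreatest (fun n => D n a ≠ 0) N, he.trans (Nat.le_findGreatest heN hea),
      Nat.findGreatest_spec (P := fun n => D n a ≠ 0) heN hea, fun n hn => ?_⟩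
    by_cases hnN : n ≤ N
    · have := Nat.findGreatest_is_greatest hn hnN
      simpa using this
    · exact hN n (by omega)
  obtain ⟨m, hm⟩ := hex a
  have key : ∀ s : Finset B, LinearIndependent k (fun i : s => (i : B)) →
      s.card ≤ C * (1 + m) := by
    intro s hs
    obtain ⟨n, hn1, hn⟩ : ∃ n, 1 ≤ n ∧ ∀ x ∈ s, (x : A) ∈ V ^ n := by
      choose f hf using hex
      refine ⟨1 + ∑ x ∈ s, f x, by omega, fun x hx => hmono ?_ (hf x)⟩
      have := Finset.single_le_sum (f := fun x : B => f x) (fun _ _ => Nat.zero_le _) hx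
      omega
    have hmem : ∀ p : Fin (n + 1) × s, ((p.2 : B) : A) * a ^ (p.1 : ℕ) ∈ V ^ (n + m * n) := by
      intro p
      rw [pow_add]
      refine Submodule.mul_mem_mul (hn _ p.2.2) ?_
      have h1 : a ^ (p.1 : ℕ) ∈ V ^ (m * (p.1 : ℕ)) := by
        rw [pow_mul]; exact Submodule.pow_mem_pow _ hm _
      exact hmono (Nat.mul_le_mul_left _ (by have := p.1.2; omega)) h1
    have hli : LinearIndependent k
        (fun p : Fin (n + 1) × s => ((p.2 : B) : A) * a ^ (p.1 : ℕ)) := by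
      rw [Fintype.linearIndependent_iff]
      intro g hg
      let b : ℕ → B := fun i => if h : i < n + 1 then ∑ x : s, g (⟨i, h⟩, x) • (x : B) else 0
      have hbi : ∀ i : Fin (n + 1), b i = ∑ x : s, g (i, x) • (x : B) := fun i => dif_pos i.2
      have hb := aux_indep D hD0 hleib a d hd had hgt (n + 1) (fun i => (b i : A))
        (fun i => (hB _).1 (b i).2) (by
          rw [← hg, Finset.sum_range, Fintype.sum_prod_type]
          refine Finset.sum_congr rfl fun i _ => ?_
          rw [hbi]
          simp [Finset.sum_mul])
      rintro ⟨i, x⟩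
      have h1 : b i = 0 := Subtype.ext (hb i i.2)
      have h2 : ∑ x : s, g (i, x) • (x : B) = 0 := by rw [← hbi]; exact h1
      exact Fintype.linearIndependent_iff.1 hs (fun x => g (i, x)) h2 x
    have hfin : Module.Finite k ↥(V ^ (n + m * n)) :=
      Module.Finite.iff_fg.2 ((Module.Finite.iff_fg.1 hVfd).pow _)
    have hli' : LinearIndependent k (fun p : Fin (n + 1) × s =>
        (⟨((p.2 : B) : A) * a ^ (p.1 : ℕ), hmem p⟩ : ↥(V ^ (n + m * n)))) :=
      LinearIndependent.of_comp (V ^ (n + m * n)).subtype hli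
    have hc := hli'.fintype_card_le_finrank.trans (hgrowth _ (by omega))
    simp only [Fintype.card_prod, Fintype.card_fin, Fintype.card_coe] at hc
    by_contra! hlt
    have : (n + 1) * (C * (1 + m)) ≤ (n + 1) * s.card := Nat.mul_le_mul_left _ hlt.le
    nlinarith
  have hr : Module.rank k B ≤ (C * (1 + m) : ℕ) := rank_le key
  exact Module.rank_lt_aleph0_iff.1 (hr.trans_lt (Cardinal.natCast_lt_aleph0))
end

section
/- Let k be a field of characteristic zero and let A be a finitely generated prime k-algebra of finite Gelfand–Kirillov dimension; concretely, assume there are a finite-dimensional k-subspace V ∋ 1 generating A as a k-algebra and constants C, m with dim_k V^n ≤ C·n^m for all n ≥ 1. Suppose the center Z(A) of A is a finitely generated k-algebra of Krull dimension at most 1. Then at least one of the following holds: (i) every locally nilpotent k-linear derivation of A vanishes on Z(A) (i.e., ML_Z(A) = Z(A)); or (ii) there is a k-subalgebra A_0 of A which is a prime ring such that A is isomorphic as a k-algebra to the polynomial ring A_0[t]. -/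
lemma aux_dim {R S : Type*} [CommRing R] [CommRing S] (g : R →+* S) (hg : Function.Injective g)
    (hi : g.IsIntegral) : ringKrullDim R ≤ ringKrullDim S := by
  algebraize [g]
  have : FaithfulSMul R S := (faithfulSMul_iff_algebraMap_injective R S).mpr hg
  unfold ringKrullDim
  apply iSup_le
  intro l
  obtain ⟨⟨Q, hQ, hl⟩⟩ := Ideal.nonempty_primesOver (S := S) l.head.asIdeal
  obtain ⟨L, hL, -⟩ := Ideal.exists_ltSeries_of_hasGoingUp l Q
  rw [← hL]
  exact le_iSup (fun p : LTSeries (PrimeSpectrum S) => ((p.length : ℕ∞) : WithBot ℕ∞)) L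

lemma aux_alg {k Z : Type*} [Field k] [CommRing Z] [IsDomain Z] [Algebra k Z]
    (hfg : Algebra.FiniteType k Z) (hdim : ringKrullDim Z ≤ 1) (f s : Z)
    (hf : Transcendental k f) : IsAlgebraic (Algebra.adjoin k (Set.range fun _ : Unit => f)) s := by
  obtain ⟨n, g, hg, hi⟩ := exists_integral_inj_algHom_of_fg k Z
  have h1 := (aux_dim g.toRingHom hg hi).trans hdim
  rw [MvPolynomial.ringKrullDim_of_isNoetherianRing, ringKrullDim_eq_zero_of_field] at h1
  have hn : n ≤ 1 := by
    simp at h1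
    exact_mod_cast h1
  by_contra hs
  have hx : AlgebraicIndependent k (fun _ : Unit => f) :=
    algebraicIndependent_unique_type_iff.mpr hf
  have h2 := ((hx.option_iff_transcendental s).mpr hs).lift_cardinalMk_le_trdeg
  have h3 : Algebra.trdeg k Z ≤ Cardinal.mk (Set.range fun i => g (MvPolynomial.X i)) := by
    have : Algebra.IsAlgebraic (Algebra.adjoin k (Set.range fun i => g (MvPolynomial.X i))) Z := by
      refine ⟨fun z => ?_⟩
      have hr : Algebra.adjoin k (Set.range fun i => g (MvPolynomial.X i)) = g.range := by
        rw [← Algebra.map_top, ← MvPolynomial.adjoin_range_X, AlgHom.map_adjoin, ← Set.range_comp]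
        rfl
      rw [hr]
      apply IsIntegral.isAlgebraic
      obtain ⟨p, hp, hp0⟩ := hi z
      refine ⟨p.map g.rangeRestrict.toRingHom, hp.map _, ?_⟩
      rw [Polynomial.eval₂_map]
      exact hp0
    exact Algebra.IsAlgebraic.trdeg_le_cardinalMk _ _
  have h4 : Algebra.trdeg k Z ≤ 1 := by
    refine h3.trans ?_
    have := Cardinal.mk_range_le_lift (f := fun i => g (MvPolynomial.X i))
    simp at this
    refine this.trans ?_
    exact_mod_cast hn
  have h5 := h2.trans (Cardinal.lift_le.mpr h4)
  simp at h5

lemma aux_unit {k Z : Type*} [Field k] [CommRing Z] [IsDomain Z] [Algebra k Z] (f : Z)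
    (h0 : f ≠ 0) (hf : IsAlgebraic k f) : IsUnit f :=
  IsArtinianRing.isUnit_of_isIntegral_of_nonZeroDivisor (R := k) hf.isIntegral (mem_nonZeroDivisors_of_ne_zero h0)

section
variable {k A : Type*} [Field k] [CharZero k] [Ring A] [Algebra k A]

def kerAlg (δ : A →ₗ[k] A) (hδ : ∀ a b : A, δ (a * b) = δ a * b + a * δ b) : Subalgebra k A where
  carrier := {a | δ a = 0}
  mul_mem' {a b} ha hb := by
    simp only [Set.mem_ofPred_eq] at *
    simp [hδ, ha, hb]
  add_mem' {a b} ha hb := by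
    simp only [Set.mem_ofPred_eq] at *
    simp [ha, hb]
  algebraMap_mem' r := by
    have : δ 1 = 0 := by simpa using hδ 1 1
    simp [Algebra.algebraMap_eq_smul_one, this]

lemma aux_pow (δ : A →ₗ[k] A) (hδ : ∀ a b : A, δ (a * b) = δ a * b + a * δ b)
    (s : A) (hs : ∀ a, s * a = a * s) (n : ℕ) :
    δ (s ^ (n+1)) = (n + 1 : ℕ) • (s ^ n * δ s) := by
  induction n with
  | zero => simp
  | succ n ih =>
    rw [pow_succ, hδ, ih, smul_mul_assoc, mul_assoc, ← hs, ← mul_assoc, ← pow_succ, ← succ_nsmul]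

open Polynomial in
lemma aux_der (δ : A →ₗ[k] A) (hδ : ∀ a b : A, δ (a * b) = δ a * b + a * δ b)
    (s : A) (hs : ∀ a, s * a = a * s) (p : Polynomial (kerAlg δ hδ)) :
    δ (p.eval₂ (kerAlg δ hδ).val.toRingHom s) =
      (derivative p).eval₂ (kerAlg δ hδ).val.toRingHom s * δ s := by
  induction p using Polynomial.induction_on' with
  | add p q hp hq => simp only [eval₂_add, map_add, hp, hq, add_mul]
  | monomial n a =>
    have ha : δ a = 0 := a.2
    cases n with
    | zero => simp [ha]
    | succ n =>
      rw [derivative_monomial, eval₂_monomial, eval₂_monomial, hδ]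
      simp [ha, aux_pow δ hδ s hs]
      simp only [mul_assoc]

open Polynomial in
lemma aux_inj (δ : A →ₗ[k] A) (hδ : ∀ a b : A, δ (a * b) = δ a * b + a * δ b)
    (s : A) (hs : ∀ a, s * a = a * s) (hc : ∀ a, a * δ s = 0 → a = 0)
    (n : ℕ) : ∀ (p : Polynomial (kerAlg δ hδ)), p.natDegree ≤ n →
      p.eval₂ (kerAlg δ hδ).val.toRingHom s = 0 → p = 0 := by
  have key : ∀ p : Polynomial (kerAlg δ hδ), derivative p = 0 →
      p.eval₂ (kerAlg δ hδ).val.toRingHom s = 0 → p = 0 := by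
    intro p hd hp
    have h0 : p.natDegree = 0 := by
      by_contra h
      obtain ⟨m, hm⟩ := Nat.exists_eq_succ_of_ne_zero h
      have h2 : (derivative p).coeff m = 0 := by rw [hd]; simp
      rw [coeff_derivative] at h2
      have h3 : ((m + 1 : ℕ) : k) • p.coeff (m+1) = 0 := by
        rw [← h2, Nat.cast_smul_eq_nsmul, nsmul_eq_mul, Nat.cast_comm]
        push_cast; rfl
      have h4 := (smul_eq_zero.mp h3).resolve_left (Nat.cast_ne_zero.mpr (Nat.succ_ne_zero m))
      rw [← Nat.succ_eq_add_one, ← hm] at h4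
      have : p = 0 := leadingCoeff_eq_zero.mp h4
      simp [this] at h
    rw [eq_C_of_natDegree_eq_zero h0] at hp ⊢
    simp at hp
    simpa using hp
  induction n with
  | zero =>
    intro p hn hp
    refine key p (derivative_of_natDegree_zero (Nat.le_zero.mp hn)) hp
  | succ n ih =>
    intro p hn hp
    refine key p (ih _ ((natDegree_derivative_le p).trans (by omega)) ?_) hp
    apply hc
    rw [← aux_der δ hδ s hs, hp, map_zero]

open Polynomial in
lemma aux_anti (B : Subalgebra k A) (p : Polynomial B) : ∃ q : Polynomial B, derivative q = p := by
  induction p using Polynomial.induction_on' with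
  | add p q hp hq =>
    obtain ⟨a, rfl⟩ := hp
    obtain ⟨b, rfl⟩ := hq
    exact ⟨a + b, by simp⟩
  | monomial n a =>
    refine ⟨monomial (n+1) (((n + 1 : ℕ) : k)⁻¹ • a), ?_⟩
    rw [derivative_monomial, Nat.add_sub_cancel, ← Nat.cast_comm, ← nsmul_eq_mul,
      ← Nat.cast_smul_eq_nsmul k, smul_smul, mul_inv_cancel₀, one_smul]
    exact Nat.cast_ne_zero.mpr (Nat.succ_ne_zero n)

lemma aux_surj (δ : A →ₗ[k] A) (hδ : ∀ a b : A, δ (a * b) = δ a * b + a * δ b)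
    (t : A) (ht : ∀ a, t * a = a * t) (h1 : δ t = 1) (n : ℕ) :
    ∀ a : A, (δ ^ n) a = 0 → ∃ p : Polynomial (kerAlg δ hδ),
      p.eval₂ (kerAlg δ hδ).val.toRingHom t = a := by
  induction n with
  | zero => intro a ha; exact ⟨0, by simpa using ha.symm⟩
  | succ n ih =>
    intro a ha
    obtain ⟨p, hp⟩ := ih (δ a) (by rw [pow_succ] at ha; exact ha)
    obtain ⟨q, rfl⟩ := aux_anti _ p
    have h2 : a - q.eval₂ (kerAlg δ hδ).val.toRingHom t ∈ kerAlg δ hδ := by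
      change δ _ = 0
      rw [map_sub, aux_der δ hδ t ht, hp, h1, mul_one, sub_self]
    refine ⟨Polynomial.C ⟨_, h2⟩ + q, ?_⟩
    rw [Polynomial.eval₂_add, Polynomial.eval₂_C]
    simp

lemma aux_slice (δ : A →ₗ[k] A) (hδ : ∀ a b : A, δ (a * b) = δ a * b + a * δ b)
    (hprime : ∀ a b : A, (∀ r : A, a * r * b = 0) → a = 0 ∨ b = 0)
    (hnil : ∀ a : A, ∃ n : ℕ, (δ ^ n) a = 0)
    (t : A) (ht : ∀ a, t * a = a * t) (h1 : δ t = 1) : ∃ A₀ : Subalgebra k A,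
        (∀ a b : A₀, (∀ r : A₀, a * r * b = 0) → a = 0 ∨ b = 0) ∧
        Nonempty (A ≃ₐ[k] Polynomial A₀) := by
  let e : Polynomial (kerAlg δ hδ) →+* A :=
    Polynomial.eval₂RingHom' (kerAlg δ hδ).val.toRingHom t (fun a => (ht _).symm)
  have he : ∀ p, e p = p.eval₂ (kerAlg δ hδ).val.toRingHom t := fun p => rfl
  have hsurj : Function.Surjective e := fun a => by
    obtain ⟨n, hn⟩ := hnil a
    exact aux_surj δ hδ t ht h1 n a hn
  refine ⟨kerAlg δ hδ, fun a b hab => ?_, ?_⟩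
  · have h := hprime a b (fun r => by
      obtain ⟨p, rfl⟩ := hsurj r
      have ha : (a : A) = e (Polynomial.C a) := by simp [he]
      have hb : (b : A) = e (Polynomial.C b) := by simp [he]
      rw [ha, hb, ← map_mul, ← map_mul]
      have : Polynomial.C a * p * Polynomial.C b = 0 := by
        ext n
        simp [hab]
      rw [this, map_zero])
    simpa using h
  · let e' : Polynomial (kerAlg δ hδ) →ₐ[k] A :=
      AlgHom.mk e (fun r => by
        change e (Polynomial.C (algebraMap k _ r)) = _
        rw [he, Polynomial.eval₂_C]; rfl)
    refine ⟨(AlgEquiv.ofBijective e' ⟨?_, hsurj⟩).symm⟩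
    rw [injective_iff_map_eq_zero]
    intro p hp
    exact aux_inj δ hδ t ht (by simp [h1]) _ p le_rfl hp

end

theorem stmt_9 (k A : Type*) [Field k] [CharZero k] [Ring A] [Algebra k A]
    (hprime : ∀ a b : A, (∀ r : A, a * r * b = 0) → a = 0 ∨ b = 0)
    (V : Submodule k A) (hV1 : (1 : A) ∈ V)
    (hVfd : FiniteDimensional k V)
    (hVgen : Algebra.adjoin k (V : Set A) = ⊤)
    (C m : ℕ) (hgrowth : ∀ n : ℕ, 1 ≤ n → Module.finrank k ↥(V ^ n) ≤ C * n ^ m)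
    (hZfg : Algebra.FiniteType k (Subalgebra.center k A))
    (hZdim : ringKrullDim (Subalgebra.center k A) ≤ 1) :
    (∀ δ : A →ₗ[k] A, (∀ a b : A, δ (a * b) = δ a * b + a * δ b) →
        (∀ a : A, ∃ n : ℕ, (δ ^ n) a = 0) →
        ∀ z ∈ Subalgebra.center k A, δ z = 0) ∨
    (∃ A₀ : Subalgebra k A,
        (∀ a b : A₀, (∀ r : A₀, a * r * b = 0) → a = 0 ∨ b = 0) ∧
        Nonempty (A ≃ₐ[k] Polynomial A₀)) := by
  refine or_iff_not_imp_left.mpr fun hne => ?_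
  push Not at hne
  obtain ⟨δ, hδ, hnil, z, hz, hz0⟩ := hne
  have hcen : ∀ x ∈ Subalgebra.center k A, ∀ a, x * a = a * x := fun x hx a =>
    (Subalgebra.mem_center_iff.mp hx a).symm
  have hpres : ∀ x ∈ Subalgebra.center k A, δ x ∈ Subalgebra.center k A := by
    intro x hx
    rw [Subalgebra.mem_center_iff]
    intro a
    have h := congrArg δ (hcen x hx a)
    rw [hδ, hδ, hcen x hx (δ a), add_comm] at h
    exact (add_left_cancel h).symm
  have hreg : ∀ c ∈ Subalgebra.center k A, c ≠ 0 → ∀ a, a * c = 0 → a = 0 := by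
    intro c hc h0 a ha
    refine (hprime a c fun r => ?_).resolve_right h0
    rw [mul_assoc, ← hcen c hc, ← mul_assoc, ha, zero_mul]
  have : Nontrivial A := ⟨⟨_, _, hz0⟩⟩
  have : NoZeroDivisors (Subalgebra.center k A) := ⟨fun {a b} hab => by
    by_contra! h
    refine h.1 (Subtype.ext (hreg b b.2 (fun hb => h.2 (Subtype.ext hb)) a ?_))
    exact congrArg Subtype.val hab⟩
  have : IsDomain (Subalgebra.center k A) := NoZeroDivisors.to_isDomain _
  -- local slice
  obtain ⟨s, hsz, hs0, hs1⟩ : ∃ s ∈ Subalgebra.center k A, δ s ≠ 0 ∧ δ (δ s) = 0 := by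
    obtain ⟨n, hn⟩ := hnil z
    have H : ∀ n : ℕ, ∀ z ∈ Subalgebra.center k A, δ z ≠ 0 → (δ ^ n) z = 0 →
        ∃ s ∈ Subalgebra.center k A, δ s ≠ 0 ∧ δ (δ s) = 0 := by
      intro n
      induction n with
      | zero => intro z _ h h'; simp at h'; simp [h'] at h
      | succ n ih =>
        intro z hz h h'
        by_cases h2 : δ (δ z) = 0
        · exact ⟨z, hz, h, h2⟩
        · exact ih (δ z) (hpres z hz) h2 (by rw [pow_succ] at h'; exact h')
    exact H n z hz hz0 hn
  let f : Subalgebra.center k A := ⟨δ s, hpres s hsz⟩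
  have hf0 : f ≠ 0 := fun h => hs0 (congrArg Subtype.val h)
  have hfalg : IsAlgebraic k f := by
    by_contra hf
    obtain ⟨p, hp, hp0⟩ := aux_alg hZfg hZdim f ⟨s, hsz⟩ hf
    have hle : (Algebra.adjoin k (Set.range fun _ : Unit => f)).map (Subalgebra.center k A).val
        ≤ kerAlg δ hδ := by
      rw [AlgHom.map_adjoin, Algebra.adjoin_le_iff]
      rintro _ ⟨_, ⟨_, rfl⟩, rfl⟩
      exact hs1
    let φ : Algebra.adjoin k (Set.range fun _ : Unit => f) →+* kerAlg δ hδ :=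
      { toFun := fun x => ⟨((x : Subalgebra.center k A) : A), hle ⟨_, x.2, rfl⟩⟩
        map_one' := rfl
        map_mul' := fun _ _ => rfl
        map_zero' := rfl
        map_add' := fun _ _ => rfl }
    have hφ : Function.Injective φ := fun x y h =>
      Subtype.ext (Subtype.ext (congrArg (fun u : kerAlg δ hδ => (u : A)) h))
    have h1 := aux_inj δ hδ s (hcen s hsz) (hreg _ (hpres s hsz) hs0) _ (p.map φ) le_rfl (by
      rw [Polynomial.eval₂_map]
      have := congrArg (Subalgebra.center k A).val.toRingHom hp0
      rw [Polynomial.aeval_def, Polynomial.hom_eval₂, map_zero] at this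
      exact this)
    exact hp ((Polynomial.map_eq_zero_iff hφ).mp h1)
  obtain ⟨d, hd⟩ := (aux_unit f hf0 hfalg).exists_left_inv
  have hd' : (d : A) * δ s = 1 := congrArg Subtype.val hd
  have hδd : δ (d : A) = 0 := by
    apply hreg _ (hpres s hsz) hs0
    have h := congrArg δ hd'
    rw [hδ, hs1, mul_zero, add_zero] at h
    rw [h]
    simpa using hδ 1 1
  refine aux_slice δ hδ hprime hnil ((d : A) * s)
    (hcen _ (mul_mem d.2 hsz)) ?_
  rw [hδ, hδd, zero_mul, zero_add, hd']
end

section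
/- Let k be a field and let A be a finitely generated k-algebra which is a domain of Gelfand–Kirillov dimension one (there are a finite-dimensional k-subspace V ∋ 1 generating A as a k-algebra and a constant C with dim_k V^n ≤ C·n for all n ≥ 1, and A is infinite-dimensional over k). Suppose that k is inseparably closed in A, meaning every k-subalgebra of A that is a field is a separable (algebraic) extension of k. Suppose further that ML^I(A) ≠ A, i.e., there exist an iterative weakly locally nilpotent Hasse-Schmidt derivation ∂ = (∂_n) of A, an integer n ≥ 1, and a ∈ A with ∂_n(a) ≠ 0. Then A is strongly cancellative: for every d ≥ 1 and every k-algebra B, any k-algebra isomorphism A[t_1,…,t_d] ≅ B[t_1,…,t_d] of polynomial rings in d central variables implies A ≅ B as k-algebras. -/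
lemma comm_cancel {Z R : Type*} [Field Z] [CommRing R] (d : ℕ)
    (e : MvPolynomial (Fin d) R ≃+* MvPolynomial (Option (Fin d)) Z) :
    ∃ y : R, y ≠ 0 ∧ ¬ IsUnit y ∧ ∀ r : R, ∃ p : Polynomial Z,
      r = p.eval₂ ((MvPolynomial.constantCoeff).comp
        (e.symm.toRingHom.comp MvPolynomial.C)) y := by
  set ι : Z →+* R := (MvPolynomial.constantCoeff).comp
        (e.symm.toRingHom.comp MvPolynomial.C) with hι
  have hdomM : IsDomain (MvPolynomial (Fin d) R) := e.toMulEquiv.isDomain _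
  have hinjC : Function.Injective (MvPolynomial.C : R →+* MvPolynomial (Fin d) R) :=
    MvPolynomial.C_injective _ _
  have hdom : IsDomain R := hinjC.isDomain _
  have hufd : UniqueFactorizationMonoid (MvPolynomial (Fin d) R) :=
    e.symm.toMulEquiv.uniqueFactorizationMonoid inferInstance
  -- augmentation
  let ε : R →+* Z := (MvPolynomial.constantCoeff).comp (e.toRingHom.comp MvPolynomial.C)
  have hιe : ∀ z : Z, e (MvPolynomial.C (ι z)) = MvPolynomial.C z := by
    intro z
    by_cases hz : z = 0
    · subst hz; simp
    have hu : IsUnit (e.symm (MvPolynomial.C z)) := by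
      have : IsUnit z := IsUnit.mk0 z hz
      exact (this.map MvPolynomial.C).map e.symm
    obtain ⟨r, -, hr⟩ := MvPolynomial.isUnit_iff_eq_C_of_isReduced.1 hu
    have : ι z = r := by simp [hι, hr]
    rw [this, ← hr]; simp
  have hει : ∀ z, ε (ι z) = z := by
    intro z
    simp [ε, hιe]
  have hdim : ringKrullDim R + d ≤ d + 1 := by
    have h1 := ringKrullDim_add_natCard_le_ringKrullDim_mvPolynomial (R := R) (Fin d)
    rw [ringKrullDim_eq_of_ringEquiv e, MvPolynomial.ringKrullDim_of_isNoetherianRing] at h1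
    simpa using h1
  have hK : Ring.KrullDimLE 1 R := by
    rw [Ring.krullDimLE_iff]
    generalize ringKrullDim R = q at hdim
    induction q with
    | bot => simp
    | coe q =>
      induction q with
      | top => exact absurd (show ((⊤ + (d : ℕ∞) : ℕ∞) : WithBot ℕ∞) ≤ (((d + 1 : ℕ) : ℕ∞) : WithBot ℕ∞) by exact_mod_cast hdim) (by
          rw [WithBot.coe_le_coe]; simp)
      | coe q =>
        have h4 : ((q + d : ℕ) : WithBot ℕ∞) ≤ ((d + 1 : ℕ) : WithBot ℕ∞) := by exact_mod_cast hdim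
        have h5 : q + d ≤ d + 1 := by exact_mod_cast h4
        have h6 : q ≤ 1 := by omega
        exact_mod_cast h6
  have hmax := (Ring.krullDimLE_one_iff_of_noZeroDivisors).1 hK
  have hm : (RingHom.ker ε) ≠ ⊥ := by
    intro hb
    have hinj : Function.Injective ε := (RingHom.injective_iff_ker_eq_bot _).2 hb
    have hsurj : Function.Surjective ε := fun z => ⟨_, hει z⟩
    let E : R ≃+* Z := RingEquiv.ofBijective ε ⟨hinj, hsurj⟩
    have hF : IsField R := E.toMulEquiv.isField (Field.toIsField Z)
    letI := hF.toField
    have h1 : ringKrullDim (MvPolynomial (Fin d) R) = d := by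
      have := MvPolynomial.ringKrullDim_of_isNoetherianRing (R := R) (ι := Fin d)
      rw [this]; rw [ringKrullDim_eq_zero_of_isField hF]; simp
    rw [ringKrullDim_eq_of_ringEquiv e, MvPolynomial.ringKrullDim_of_isNoetherianRing] at h1
    simp at h1
    have h4 : ((d + 1 : ℕ) : WithBot ℕ∞) = ((d : ℕ) : WithBot ℕ∞) := by exact_mod_cast h1
    have h5 : d + 1 = d := by exact_mod_cast h4
    omega
  obtain ⟨r, hr, hr0⟩ := Submodule.exists_mem_ne_zero_of_ne_bot hm
  have hker : (RingHom.ker ε).IsPrime := RingHom.ker_isPrime _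
  have hy : ∃ y ∈ RingHom.ker ε, Prime y := by
    have hCr : (MvPolynomial.C r : MvPolynomial (Fin d) R) ≠ 0 := by simpa using hr0
    have key : ∀ a : MvPolynomial (Fin d) R, a ≠ 0 → ∀ s : R, a = MvPolynomial.C s → s ∈ RingHom.ker ε →
        ∃ y ∈ RingHom.ker ε, Prime y := by
      intro a
      induction a using UniqueFactorizationMonoid.induction_on_prime with
      | h₁ => intro h; exact absurd rfl h
      | h₂ x hx =>
        intro _ s hs hs'
        exfalso
        rw [hs] at hx
        obtain ⟨t, ht, ht'⟩ := MvPolynomial.isUnit_iff_eq_C_of_isReduced.1 hx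
        rw [hinjC ht'] at hs'
        exact hker.ne_top (Ideal.eq_top_of_isUnit_mem _ hs' ht)
      | h₃ a p ha hp ih =>
        intro hpa s hs hs'
        have hdeg : (p * a).totalDegree = 0 := by rw [hs]; simp
        rw [MvPolynomial.totalDegree_mul_of_isDomain hp.ne_zero ha] at hdeg
        have h1 := MvPolynomial.totalDegree_eq_zero_iff_eq_C.1 (show p.totalDegree = 0 by omega)
        have h2 := MvPolynomial.totalDegree_eq_zero_iff_eq_C.1 (show a.totalDegree = 0 by omega)
        rw [h1, h2, ← map_mul] at hs
        rw [← hinjC hs] at hs'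
        rcases hker.mem_or_mem hs' with h | h
        · refine ⟨_, h, ?_⟩
          rw [h1] at hp
          exact (MvPolynomial.prime_C_iff _).1 hp
        · exact ih ha _ h2 h
    exact key _ hCr _ rfl hr
  obtain ⟨y, hym, hyp⟩ := hy
  have hspan : Ideal.span {y} = RingHom.ker ε := by
    have h1 : (Ideal.span {y}).IsMaximal :=
      hmax _ (by simpa using hyp.ne_zero) ((Ideal.span_singleton_prime hyp.ne_zero).2 hyp)
    exact h1.eq_of_le hker.ne_top (by simpa [Ideal.span_le] using hym)
  refine ⟨y, hyp.ne_zero, hyp.not_unit, ?_⟩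
  have hdegy : 0 < (e (MvPolynomial.C y)).totalDegree := by
    rw [pos_iff_ne_zero]
    intro h0
    have h1 := MvPolynomial.totalDegree_eq_zero_iff_eq_C.1 h0
    have h2 : y = ι ((e (MvPolynomial.C y)).coeff 0) := by
      apply hinjC
      apply e.injective
      rw [hιe, ← h1]
    have h3 : ε y = 0 := hym
    rw [h2, hει] at h3
    rw [h3] at h2
    simp at h2
    exact hyp.ne_zero h2
  have main : ∀ n : ℕ, ∀ r : R, (e (MvPolynomial.C r)).totalDegree < n →
      ∃ p : Polynomial Z, r = p.eval₂ ι y := by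
    intro n
    induction n with
    | zero => intro r h; omega
    | succ n ih =>
      intro r hrn
      have h1 : r - ι (ε r) ∈ RingHom.ker ε := by
        rw [RingHom.mem_ker, map_sub, hει, sub_self]
      rw [← hspan, Ideal.mem_span_singleton] at h1
      obtain ⟨q, hq⟩ := h1
      by_cases hq0 : q = 0
      · refine ⟨Polynomial.C (ε r), ?_⟩
        rw [hq0, mul_zero, sub_eq_zero] at hq
        simpa using hq
      have h2 : (e (MvPolynomial.C (y * q))).totalDegree ≤ (e (MvPolynomial.C r)).totalDegree := by
        rw [← hq, map_sub, map_sub, hιe]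
        exact MvPolynomial.totalDegree_sub_C_le _ _
      rw [map_mul, map_mul, MvPolynomial.totalDegree_mul_of_isDomain (by simpa using hyp.ne_zero)
        (by simpa using hq0)] at h2
      obtain ⟨p, hp⟩ := ih q (by omega)
      refine ⟨Polynomial.C (ε r) + Polynomial.X * p, ?_⟩
      simp only [Polynomial.eval₂_add, Polynomial.eval₂_C, Polynomial.eval₂_X_mul]
      rw [← hp, mul_comm q y, ← hq]
      ring
  exact fun r => main _ r (Nat.lt_succ_self _)

lemma amitsur {D ι : Type*} [DivisionRing D] [Fintype ι] (b : ι → D)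
    (hb : LinearIndependent (Subring.center D) b) :
    ∀ n : ℕ, ∀ a : ι → D, (Function.support a).ncard ≤ n →
    (∀ x, ∑ i, a i * x * b i = 0) → a = 0 := by
  intro n
  induction n with
  | zero =>
    intro a ha _
    have := (Set.ncard_eq_zero (Set.toFinite _)).1 (Nat.le_zero.1 ha)
    simpa using this
  | succ n ih =>
    intro a ha h
    by_contra hne
    obtain ⟨j, hj⟩ := Function.ne_iff.1 hne
    simp only [Pi.zero_apply] at hj
    have hcent : ∀ i, (a j)⁻¹ * a i ∈ Subring.center D := by
      intro i
      rw [Subring.mem_center_iff]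
      intro y
      have h0 := ih (fun i => y * ((a j)⁻¹ * a i) - ((a j)⁻¹ * a i) * y) ?_ ?_
      · have := congrFun h0 i
        simpa [sub_eq_zero] using this
      · have hss : Function.support (fun i => y * ((a j)⁻¹ * a i) - ((a j)⁻¹ * a i) * y) ⊆
            Function.support a \ {j} := by
          intro i hi
          simp only [Function.mem_support] at hi
          refine ⟨fun h0 => hi (by rw [h0]; simp), fun h0 => hi ?_⟩
          rw [Set.mem_singleton_iff] at h0
          subst h0
          simp [hj]
        have h1 := Set.ncard_le_ncard hss (Set.toFinite _)
        rw [Set.ncard_sdiff_singleton_of_mem (by simpa using hj)] at h1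
        omega
      · intro x
        have e1 := congrArg (fun t => y * (a j)⁻¹ * t) (h x)
        have e2 := congrArg (fun t => (a j)⁻¹ * t) (h (y * x))
        simp only [Finset.mul_sum, mul_zero] at e1 e2
        simp only [sub_mul, Finset.sum_sub_distrib]
        rw [sub_eq_zero]
        trans (0 : D)
        · rw [← e1]; exact Finset.sum_congr rfl fun i _ => by simp only [mul_assoc]
        · rw [← e2]; exact Finset.sum_congr rfl fun i _ => by simp only [mul_assoc]
    have h1 := h 1
    have h2 : ∑ i, (⟨_, hcent i⟩ : Subring.center D) • b i = 0 := by
      have := congrArg (fun t => (a j)⁻¹ * t) h1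
      simpa [Finset.mul_sum, Subring.smul_def, mul_assoc] using this
    have h3 := Fintype.linearIndependent_iff.1 hb _ h2 j
    have h4 := congrArg Subtype.val h3
    simp [hj] at h4

lemma inner_of_deriv {D : Type*} [DivisionRing D] [Module.Finite (Subring.center D) D]
    (δ : D →ₗ[Subring.center D] D) (hδ : ∀ a b, δ (a * b) = δ a * b + a * δ b) :
    ∃ e : D, ∀ y, δ y = e * y - y * e := by
  let b := Module.finBasis (Subring.center D) D
  set n := Module.finrank (Subring.center D) D with hn
  let Ψ : (Fin n → D) →ₗ[Subring.center D] (D →ₗ[Subring.center D] D) :=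
    ∑ i, (((LinearMap.mul (Subring.center D) D).flip.flip.compr₂
      ((LinearMap.mul (Subring.center D) D).flip (b i))).comp (LinearMap.proj i))
  have hΨ : ∀ a x, Ψ a x = ∑ i, a i * x * b i := by
    intro a x
    simp [Ψ]
  have hinj : Function.Injective Ψ := by
    rw [injective_iff_map_eq_zero]
    intro a ha
    exact amitsur b b.linearIndependent _ a le_rfl (fun x => by rw [← hΨ, ha]; rfl)
  have hsurj : Function.Surjective Ψ := by
    rw [← LinearMap.injective_iff_surjective_of_finrank_eq_finrank]
    · exact hinj
    · rw [Module.finrank_linearMap, Module.finrank_pi_fintype]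
      simp
      left; rfl
  obtain ⟨a, ha⟩ := hsurj δ
  have hone := b.sum_repr 1
  obtain ⟨j, hj⟩ : ∃ j, b.repr 1 j ≠ 0 := by
    by_contra hcon
    push Not at hcon
    simp [hcon] at hone
  have key : ∀ y i, a i * y - y * a i = δ y * (b.repr 1 i : D) := by
    intro y i
    have := amitsur b b.linearIndependent _
      (fun i => a i * y - y * a i - δ y * (b.repr 1 i : D)) le_rfl ?_
    · have h2 := congrFun this i
      simpa [sub_eq_zero] using h2
    · intro x
      have h1 := hδ y x
      have h2 : ∑ i, δ y * (b.repr 1 i : D) * x * b i = δ y * x := by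
        have : x = x * 1 := by simp
        conv_rhs => rw [this, ← hone]
        rw [Finset.mul_sum, Finset.mul_sum]
        refine Finset.sum_congr rfl fun i _ => ?_
        have := (Subring.mem_center_iff.1 (b.repr 1 i).2) x
        rw [Subring.smul_def, smul_eq_mul, mul_assoc, mul_assoc, ← mul_assoc _ x, ← this, mul_assoc]
      simp only [sub_mul, Finset.sum_sub_distrib, h2]
      have h3 : δ (y * x) = ∑ i, a i * y * x * b i := by
        rw [← ha, hΨ]; exact Finset.sum_congr rfl fun i _ => by simp only [mul_assoc]
      have h4 : y * δ x = ∑ i, y * a i * x * b i := by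
        rw [← ha, hΨ, Finset.mul_sum]; exact Finset.sum_congr rfl fun i _ => by simp only [mul_assoc]
      rw [← h3, ← h4, h1]
      abel
  have hj' : (b.repr 1 j : D) ≠ 0 := fun h => hj (Subtype.ext h)
  have hc : ∀ y : D, y * (b.repr 1 j : D)⁻¹ = (b.repr 1 j : D)⁻¹ * y :=
    Subring.mem_center_iff.1 (b.repr 1 j)⁻¹.2
  refine ⟨a j * (b.repr 1 j : D)⁻¹, fun y => ?_⟩
  have h1 := key y j
  rw [mul_assoc, ← hc, ← mul_assoc, ← mul_assoc, ← sub_mul, h1, mul_assoc, mul_inv_cancel₀ hj',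
    mul_one]

lemma center_coeff {S G : Type*} [Ring S] [AddCommMonoid G] (x : AddMonoidAlgebra S G) :
    x ∈ Subring.center (AddMonoidAlgebra S G) ↔ ∀ g, x.coeff g ∈ Subring.center S := by
  constructor
  · intro h g
    rw [Subring.mem_center_iff] at h ⊢
    intro s
    have := congrArg (fun q => q.coeff g) (h (AddMonoidAlgebra.single 0 s))
    simpa [AddMonoidAlgebra.coeff_single_zero_mul, AddMonoidAlgebra.coeff_mul_single_zero] using this
  · intro h
    rw [← AddMonoidAlgebra.sum_coeff_single x]
    refine Subring.sum_mem _ fun g _ => ?_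
    rw [Subring.mem_center_iff]
    intro q
    have := AddMonoidAlgebra.single_commute (m := g) (r := x.coeff g) (fun _ => AddCommute.all _ _)
      (fun r' => (Subring.mem_center_iff.1 (h g) r').symm) q
    exact this.symm

noncomputable def centerE (S G : Type*) [Ring S] [AddCommMonoid G] :
    AddMonoidAlgebra (Subring.center S) G ≃+* Subring.center (AddMonoidAlgebra S G) :=
  RingEquiv.ofBijective
    ((AddMonoidAlgebra.mapRingHom G (Subring.center S).subtype).codRestrict
      (Subring.center (AddMonoidAlgebra S G)) (fun x => by
        rw [center_coeff]; intro g; simp)) (by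
    constructor
    · intro a b h
      have h' := congrArg Subtype.val h
      ext g
      have := congrArg (fun q => q.coeff g) h'
      simpa using this
    · rintro ⟨x, hx⟩
      rw [center_coeff] at hx
      refine ⟨AddMonoidAlgebra.ofCoeff (Finsupp.onFinset x.coeff.support (fun g => ⟨x.coeff g, hx g⟩) ?_), ?_⟩
      · intro g hg
        rw [Finsupp.mem_support_iff]
        exact fun h => hg (Subtype.ext h)
      · apply Subtype.ext
        ext g
        simp)

lemma centerE_coeff {S G : Type*} [Ring S] [AddCommMonoid G]
    (x : AddMonoidAlgebra (Subring.center S) G) (g : G) :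
    ((centerE S G x : AddMonoidAlgebra S G)).coeff g = (x.coeff g : S) := by
  change (AddMonoidAlgebra.mapRingHom G (Subring.center S).subtype x).coeff g = _
  simp

lemma centerE_single {S G : Type*} [Ring S] [AddCommMonoid G] (g : G) (s : Subring.center S) :
    ((centerE S G (AddMonoidAlgebra.single g s) : AddMonoidAlgebra S G)) = AddMonoidAlgebra.single g (s : S) := by
  change AddMonoidAlgebra.mapRingHom G (Subring.center S).subtype _ = _
  simp

noncomputable def centerPoly (D : Type*) [Ring D] :
    Polynomial (Subring.center D) ≃+* Subring.center (Polynomial D) :=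
  ((Polynomial.toFinsuppIso _).trans (centerE D ℕ)).trans
    (Subring.centerCongr (Polynomial.toFinsuppIso D)).symm

lemma centerPoly_C {D : Type*} [Ring D] (z : Subring.center D) :
    (centerPoly D (Polynomial.C z) : Polynomial D) = Polynomial.C (z : D) := by
  apply (Polynomial.toFinsuppIso D).injective
  have : (Polynomial.toFinsuppIso D) (centerPoly D (Polynomial.C z) : Polynomial D)
    = (centerE D ℕ ((Polynomial.toFinsuppIso _) (Polynomial.C z)) : AddMonoidAlgebra D ℕ) := by
    change (Polynomial.toFinsuppIso D) ((Polynomial.toFinsuppIso D).symm _) = _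
    rw [RingEquiv.apply_symm_apply]
    rfl
  rw [this]
  simp [centerE_single]

noncomputable def ev0 (k B : Type*) [Field k] [Ring B] [Algebra k B] (d : ℕ) :
    AddMonoidAlgebra B (Fin d →₀ ℕ) →ₐ[k] B where
  toFun P := P.coeff 0
  map_one' := by simp [AddMonoidAlgebra.one_def]
  map_zero' := by simp
  map_add' := by simp
  map_mul' x y := by
    rw [AddMonoidAlgebra.coeff_mul_antidiag x y 0 {(0,0)}]
    · simp
    · rintro ⟨a, b⟩; simp [Prod.ext_iff]
  commutes' r := by simp

lemma cancel_poly {k D B : Type*} [Field k] [DivisionRing D] [Algebra k D] [FiniteDimensional k D]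
    [Ring B] [Algebra k B] (d : ℕ)
    (φ : AddMonoidAlgebra (Polynomial D) (Fin d →₀ ℕ) ≃ₐ[k] AddMonoidAlgebra B (Fin d →₀ ℕ)) :
    Nonempty (Polynomial D ≃ₐ[k] B) := by
  let e : MvPolynomial (Fin d) (Subring.center B) ≃+*
      MvPolynomial (Option (Fin d)) (Subring.center D) :=
    (((((centerE B (Fin d →₀ ℕ)).trans
      (Subring.centerCongr φ.toRingEquiv).symm).trans
      (centerE (Polynomial D) (Fin d →₀ ℕ)).symm).trans
      (AddMonoidAlgebra.mapRingEquiv (Fin d →₀ ℕ) (centerPoly D)).symm)).trans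
      (MvPolynomial.optionEquivRight (Subring.center D) (Fin d)).symm.toRingEquiv
  let ψ : D →ₐ[k] B := ((ev0 k B d).comp φ.toAlgHom).comp
    (((AddMonoidAlgebra.singleZeroAlgHom).comp (Polynomial.CAlgHom : D →ₐ[k] Polynomial D)) : D →ₐ[k] AddMonoidAlgebra (Polynomial D) (Fin d →₀ ℕ))
  have hψ : ∀ a, ψ a = (φ (AddMonoidAlgebra.single 0 (Polynomial.C a))).coeff 0 := fun a => rfl
  obtain ⟨y, hy0, hyu, hgen⟩ := comm_cancel d e
  set ι := ((MvPolynomial.constantCoeff).comp (e.symm.toRingHom.comp MvPolynomial.C)) with hι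
  have hιψ : ∀ z : Subring.center D, (ι z : B) = ψ (z : D) := by
    intro z
    rw [hψ]
    have h1 : (ι z : B) = ((centerE B (Fin d →₀ ℕ) (e.symm (MvPolynomial.C z)) : AddMonoidAlgebra B (Fin d →₀ ℕ))).coeff 0 := by
      rw [centerE_coeff]; rfl
    rw [h1]
    congr 2
    have h2 : (centerE B (Fin d →₀ ℕ) (e.symm (MvPolynomial.C z))) =
        Subring.centerCongr φ.toRingEquiv ((centerE (Polynomial D) (Fin d →₀ ℕ))
          (AddMonoidAlgebra.mapRingEquiv (Fin d →₀ ℕ) (centerPoly D)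
            (MvPolynomial.optionEquivRight (Subring.center D) (Fin d) (MvPolynomial.C z)))) := by
      simp only [e, RingEquiv.symm_trans_apply, RingEquiv.symm_symm, RingEquiv.apply_symm_apply]
      rfl
    rw [h2]
    change φ _ = φ _
    congr 1
    rw [MvPolynomial.optionEquivRight_C]
    change ((centerE (Polynomial D) (Fin d →₀ ℕ)) (AddMonoidAlgebra.mapRingEquiv (Fin d →₀ ℕ) (centerPoly D) (AddMonoidAlgebra.single 0 (Polynomial.C z))) : AddMonoidAlgebra (Polynomial D) (Fin d →₀ ℕ)) = _
    rw [AddMonoidAlgebra.mapRingEquiv_single, centerE_single, centerPoly_C]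
  have hyc : ∀ b : B, Commute b (y : B) := fun b => Subring.mem_center_iff.1 y.2 b
  let f : Polynomial D →ₐ[k] B := Polynomial.eval₂AlgHom ψ (y : B) (fun a => hyc _)
  have hfC : ∀ a, f (Polynomial.C a) = ψ a := fun a => by simp [f]
  have hfX : f Polynomial.X = y := by simp [f]
  have hcen : ∀ r ∈ Subring.center B, r ∈ f.range := by
    intro r hr
    obtain ⟨p, hp⟩ := hgen ⟨r, hr⟩
    have hp' : r = ((p.eval₂ ι y : Subring.center B) : B) := congrArg Subtype.val hp
    rw [hp', Polynomial.eval₂_eq_sum, Polynomial.sum_def]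
    push_cast
    refine sum_mem fun i _ => mul_mem ?_ (pow_mem (show (y : B) ∈ f.range from ⟨_, hfX⟩) _)
    rw [hιψ]
    exact ⟨_, hfC _⟩
  have hcen2 : ∀ x ∈ Subring.center (AddMonoidAlgebra (Polynomial D) (Fin d →₀ ℕ)),
      ev0 k B d (φ x) ∈ f.range := by
    intro x hx
    apply hcen
    rw [Subring.mem_center_iff] at hx ⊢
    intro b
    have := congrArg (fun t => ev0 k B d (φ t)) (hx (φ.symm (AddMonoidAlgebra.single 0 b)))
    simp only [map_mul, AlgEquiv.apply_symm_apply] at this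
    have h2 : ev0 k B d (AddMonoidAlgebra.single 0 b) = b := by
      change (AddMonoidAlgebra.single 0 b).coeff 0 = b
      simp
    rwa [h2] at this
  have hall : ∀ P, ev0 k B d (φ P) ∈ f.range := by
    intro P
    induction P using AddMonoidAlgebra.induction_linear with
    | zero => simp
    | add a b ha hb => rw [map_add, map_add]; exact add_mem ha hb
    | single g q =>
      induction q using Polynomial.induction_on' with
      | add p q hp hq => rw [AddMonoidAlgebra.single_add, map_add, map_add]; exact add_mem hp hq
      | monomial n a =>
        have : (AddMonoidAlgebra.single g (Polynomial.monomial n a) : AddMonoidAlgebra (Polynomial D) (Fin d →₀ ℕ)) =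
          AddMonoidAlgebra.single 0 (Polynomial.C a) * AddMonoidAlgebra.single g (Polynomial.X ^ n) := by
          rw [AddMonoidAlgebra.single_mul_single, zero_add, Polynomial.C_mul_X_pow_eq_monomial]
        rw [this, map_mul, map_mul]
        refine mul_mem ⟨_, hfC a⟩ (hcen2 _ ?_)
        rw [Subring.mem_center_iff]
        intro q
        exact (AddMonoidAlgebra.single_commute (fun _ => AddCommute.all _ _)
          (fun r' => Polynomial.X_pow_mul) q).symm
  have hsurj : Function.Surjective f := by
    intro b
    have := hall (φ.symm (AddMonoidAlgebra.single 0 b))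
    rw [AlgEquiv.apply_symm_apply] at this
    have h2 : ev0 k B d (AddMonoidAlgebra.single 0 b) = b := by
      change (AddMonoidAlgebra.single 0 b).coeff 0 = b
      simp
    rwa [h2] at this
  have hBdom : IsDomain B := by
    have hinj : Function.Injective (φ.symm.toRingHom.comp AddMonoidAlgebra.singleZeroRingHom : B →+* _) := by
      apply φ.symm.injective.comp
      exact AddMonoidAlgebra.single_right_injective
    haveI : Nontrivial B := ⟨⟨y, 0, fun h => hy0 (Subtype.ext h)⟩⟩
    haveI : NoZeroDivisors B := hinj.noZeroDivisors _ (map_zero _) (map_mul _)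
    exact NoZeroDivisors.to_isDomain B
  have hinj : Function.Injective f := by
    rw [injective_iff_map_eq_zero]
    intro p hp
    by_contra hp0
    let q := Polynomial.C (p.leadingCoeff)⁻¹ * p
    have hq : q.Monic := by
      rw [Polynomial.Monic, Polynomial.leadingCoeff_mul, Polynomial.leadingCoeff_C]
      exact inv_mul_cancel₀ (by simpa using hp0)
    have hfq : f q = 0 := by simp [q, hp]
    let L : (Fin q.natDegree → D) →ₗ[k] B :=
      ∑ i : Fin q.natDegree, ((LinearMap.mulRight k ((y : B) ^ (i : ℕ))).comp ψ.toLinearMap).comp (LinearMap.proj i)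
    have hL : Function.Surjective L := by
      intro b
      obtain ⟨r, rfl⟩ := hsurj b
      have h1 : f r = f (r %ₘ q) := by
        conv_lhs => rw [← Polynomial.modByMonic_add_div r q]
        simp [hfq]
      refine ⟨fun i => (r %ₘ q).coeff i, ?_⟩
      rw [h1]
      have hd : (r %ₘ q).degree < q.natDegree := by
        rw [← Polynomial.degree_eq_natDegree hq.ne_zero]
        exact Polynomial.degree_modByMonic_lt _ hq
      by_cases hz : r %ₘ q = 0
      · simp [L, hz]
      have h3 := congrArg f (Polynomial.as_sum_range' (r %ₘ q) q.natDegree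
        ((Polynomial.natDegree_lt_iff_degree_lt hz).2 hd))
      rw [h3, map_sum,
        ← Fin.sum_univ_eq_sum_range (fun i => f (Polynomial.monomial i ((r %ₘ q).coeff i)))]
      simp only [L, LinearMap.sum_apply]
      refine Finset.sum_congr rfl fun i _ => ?_
      rw [← Polynomial.C_mul_X_pow_eq_monomial, map_mul, map_pow, hfC, hfX]
      simp
    have : Module.Finite k B := Module.Finite.of_surjective L hL
    have hu : IsUnit (y : B) := FiniteDimensional.isUnit k (fun h => hy0 (Subtype.ext h))
    apply hyu
    obtain ⟨u, hu⟩ := hu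
    have hc : (↑u⁻¹ : B) ∈ Subring.center B := by
      rw [Subring.mem_center_iff]
      intro b
      have := (hyc b)
      rw [← hu] at this
      exact this.units_inv_right
    refine IsUnit.of_mul_eq_one ⟨_, hc⟩ (Subtype.ext ?_)
    simp [← hu]
  exact ⟨AlgEquiv.ofBijective f ⟨hinj, hsurj⟩⟩

lemma inner_of_deriv' {k D : Type*} [Field k] [Ring D] [IsDomain D] [Algebra k D]
    [FiniteDimensional k D] (δ : D →+ D) (hδ : ∀ a b, δ (a * b) = δ a * b + a * δ b)
    (hz : ∀ z ∈ Subring.center D, δ z = 0) :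
    ∃ e : D, ∀ y, δ y = e * y - y * e := by
  letI := divisionRingOfFiniteDimensional k D
  haveI : Module.Finite (Subring.center D) D := by
    obtain ⟨s, hs⟩ := (‹FiniteDimensional k D› : Module.Finite k D).fg_top
    refine ⟨⟨s, ?_⟩⟩
    rw [eq_top_iff]
    intro x _
    have hx : x ∈ Submodule.span k (s : Set D) := by rw [hs]; trivial
    induction hx using Submodule.span_induction with
    | mem x h => exact Submodule.subset_span h
    | zero => exact zero_mem _
    | add x y _ _ hx hy => exact add_mem (hx trivial) (hy trivial)
    | smul a x _ hx =>
      have hc : algebraMap k D a ∈ Subring.center D := by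
        rw [Subring.mem_center_iff]; intro g; exact (Algebra.commutes a g).symm
      have := Submodule.smul_mem _ (⟨_, hc⟩ : Subring.center D) (hx trivial)
      rw [Algebra.smul_def]
      exact this
  exact inner_of_deriv { δ with
    map_smul' := fun c x => by
      change δ ((c : D) * x) = (c : D) * δ x
      rw [hδ, hz _ c.2, zero_mul, zero_add] } hδ

section HS
variable {k A : Type*} [Field k] [Ring A] [IsDomain A] [Algebra k A] (D : ℕ → A →ₗ[k] A)

def hsKer (h0 : D 0 = LinearMap.id) (hmul : ∀ (n : ℕ) (a b : A),
        D n (a * b) = ∑ i ∈ Finset.range (n + 1), D i a * D (n - i) b) : Subalgebra k A where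
  carrier := {a | ∀ n ≥ 1, D n a = 0}
  mul_mem' := by
    intro a b ha hb n hn
    rw [hmul]
    refine Finset.sum_eq_zero fun i hi => ?_
    by_cases hi0 : i = 0
    · subst hi0; rw [hb _ (by omega), mul_zero]
    · rw [ha _ (by omega), zero_mul]
  add_mem' := by
    intro a b ha hb n hn
    rw [map_add, ha n hn, hb n hn, add_zero]
  algebraMap_mem' := by
    intro r n hn
    rw [Algebra.algebraMap_eq_smul_one, map_smul]
    suffices D n 1 = 0 by rw [this, smul_zero]
    induction n using Nat.strong_induction_on with
    | _ n ih =>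
      have h := hmul n 1 1
      rw [Finset.sum_range_succ, Finset.sum_range_eq_add_Ico _ (by omega)] at h
      rw [Finset.sum_eq_zero (s := Finset.Ico 1 n)] at h
      · simp [h0] at h
        exact h
      · intro i hi
        rw [Finset.mem_Ico] at hi
        rw [ih i hi.2 hi.1, zero_mul]

variable {D}
variable (h0 : D 0 = LinearMap.id) (hmul : ∀ (n : ℕ) (a b : A),
        D n (a * b) = ∑ i ∈ Finset.range (n + 1), D i a * D (n - i) b)

lemma hs_mem {a : A} : a ∈ hsKer D h0 hmul ↔ ∀ n ≥ 1, D n a = 0 := Iff.rfl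

include h0 in
lemma hs_left {c : A} (hc : c ∈ hsKer D h0 hmul) (a : A) (n : ℕ) : D n (c * a) = c * D n a := by
  rw [hmul, Finset.sum_eq_single 0]
  · simp [h0]
  · intro i _ hi; rw [hc i (by omega), zero_mul]
  · simp

include h0 in
lemma hs_right {c : A} (hc : c ∈ hsKer D h0 hmul) (a : A) (n : ℕ) : D n (a * c) = D n a * c := by
  rw [hmul, Finset.sum_eq_single n]
  · simp [h0]
  · intro i hi hi'
    rw [Finset.mem_range] at hi
    rw [hc (n - i) (by omega), mul_zero]
  · simp

include hmul in
lemma hs_top {a b : A} {M N : ℕ} (ha : ∀ m > M, D m a = 0) (hb : ∀ m > N, D m b = 0) :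
    D (M + N) (a * b) = D M a * D N b := by
  rw [hmul, Finset.sum_eq_single M]
  · simp
  · intro i hi hi'
    rw [Finset.mem_range] at hi
    rcases lt_or_gt_of_ne hi' with h | h
    · rw [hb _ (by omega), mul_zero]
    · rw [ha _ (by omega), zero_mul]
  · intro h; simp at h

include hmul in
lemma hs_above {a b : A} {M N : ℕ} (ha : ∀ m > M, D m a = 0) (hb : ∀ m > N, D m b = 0) :
    ∀ m > M + N, D m (a * b) = 0 := by
  intro m hm
  rw [hmul]
  refine Finset.sum_eq_zero fun i hi => ?_
  rw [Finset.mem_range] at hi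
  by_cases h : M < i
  · rw [ha _ h, zero_mul]
  · rw [hb _ (by omega), mul_zero]

include h0 hmul in
lemma hs_pow {x : A} {N : ℕ} (hx : ∀ m > N, D m x = 0) (j : ℕ) :
    (∀ m > j * N, D m (x ^ j) = 0) ∧ D (j * N) (x ^ j) = (D N x) ^ j := by
  induction j with
  | zero =>
    constructor
    · intro m hm
      rw [pow_zero]
      exact (one_mem (hsKer D h0 hmul) : _) m (by omega)
    · simp [h0]
  | succ j ih =>
    rw [pow_succ, Nat.succ_mul]
    refine ⟨hs_above hmul ih.1 hx, ?_⟩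
    rw [hs_top hmul ih.1 hx, ih.2, pow_succ]

/-- injectivity of evaluation -/
lemma hs_eval_inj {x : A} {N : ℕ} (hN : 1 ≤ N) (hx : ∀ m > N, D m x = 0) (hxN : D N x ≠ 0)
    (p : Polynomial (hsKer D h0 hmul))
    (hp : p.eval₂ (hsKer D h0 hmul).val.toRingHom x = 0) : p = 0 := by
  by_contra hp0
  have h1 := congrArg (D (p.natDegree * N)) hp
  rw [Polynomial.eval₂_eq_sum_range, map_sum, map_zero, Finset.sum_range_succ,
    Finset.sum_eq_zero] at h1
  · have h2 := hs_left h0 hmul (p.coeff p.natDegree).2 (x ^ p.natDegree) (p.natDegree * N)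
    rw [(hs_pow h0 hmul hx p.natDegree).2] at h2
    rw [zero_add] at h1
    have h3 : ((p.coeff p.natDegree : hsKer D h0 hmul) : A) * D N x ^ p.natDegree = 0 := by
      rw [← h2]; exact h1
    rcases mul_eq_zero.1 h3 with h | h
    · apply hp0
      rw [← Polynomial.leadingCoeff_eq_zero]
      exact Subtype.ext h
    · exact pow_ne_zero _ hxN h
  · intro i hi
    rw [Finset.mem_range] at hi
    have h2 := hs_left h0 hmul (p.coeff i).2 (x ^ i) (p.natDegree * N)
    refine h2.trans ?_
    rw [(hs_pow h0 hmul hx i).1, mul_zero]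
    exact Nat.mul_lt_mul_of_pos_right hi hN

lemma hs_finite {x : A} {N : ℕ} (hN : 1 ≤ N) (hx : ∀ m > N, D m x = 0) (hxN : D N x ≠ 0)
    (V : Submodule k A) (hV1 : (1 : A) ∈ V)
    (hVfd : FiniteDimensional k V)
    (hVgen : Algebra.adjoin k (V : Set A) = ⊤)
    (C : ℕ) (hgrowth : ∀ n : ℕ, 1 ≤ n → Module.finrank k ↥(V ^ n) ≤ C * n) :
    FiniteDimensional k (hsKer D h0 hmul) := by
  have hmono : ∀ {i j : ℕ}, i ≤ j → V ^ i ≤ V ^ j := fun h =>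
    pow_le_pow_right' (Submodule.one_le.2 hV1) h
  have hex : ∀ a : A, ∃ n, a ∈ V ^ n := by
    intro a
    have ha : a ∈ Algebra.adjoin k (V : Set A) := by rw [hVgen]; trivial
    induction ha using Algebra.adjoin_induction with
    | mem x h => exact ⟨1, by simpa using h⟩
    | algebraMap r => exact ⟨1, by
        rw [pow_one, Algebra.algebraMap_eq_smul_one]; exact Submodule.smul_mem _ _ hV1⟩
    | add x y _ _ hx hy =>
      obtain ⟨i, hi⟩ := hx
      obtain ⟨j, hj⟩ := hy
      exact ⟨max i j, add_mem (hmono (le_max_left _ _) hi) (hmono (le_max_right _ _) hj)⟩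
    | mul x y _ _ hx hy =>
      obtain ⟨i, hi⟩ := hx
      obtain ⟨j, hj⟩ := hy
      exact ⟨i + j, by rw [pow_add]; exact Submodule.mul_mem_mul hi hj⟩
  obtain ⟨m, hm⟩ := hex x
  have hrank : Module.rank k (hsKer D h0 hmul) ≤ (C * m : ℕ) := by
    apply rank_le
    intro s hs
    choose w hw using hex
    let W := s.sup (fun c => w (c : A)) + 1
    have hsW : ∀ c ∈ s, (c : A) ∈ V ^ W := fun c hc =>
      hmono ((Finset.le_sup (f := fun c : hsKer D h0 hmul => w (c : A)) hc).trans (Nat.le_succ _)) (hw _)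
    have hbound : ∀ n : ℕ, s.card * (n + 1) ≤ C * (W + m * n) := by
      intro n
      have hfin : Module.Finite k ↥(V ^ (W + m * n)) := Module.Finite.iff_fg.2
        (Submodule.FG.pow (Module.Finite.iff_fg.1 hVfd) _)
      let v : s × Fin (n + 1) → ↥(V ^ (W + m * n)) := fun q => ⟨((q.1 : hsKer D h0 hmul) : A) * x ^ (q.2 : ℕ), by
        have h1 : ((q.1 : hsKer D h0 hmul) : A) * x ^ (q.2 : ℕ) ∈ V ^ W * V ^ (m * (q.2 : ℕ)) :=
          Submodule.mul_mem_mul (hsW _ q.1.2) (by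
            rw [pow_mul]; exact Submodule.pow_mem_pow _ hm _)
        rw [← pow_add] at h1
        refine hmono ?_ h1
        have := q.2.2
        gcongr
        omega⟩
      have hli : LinearIndependent k v := by
        rw [Fintype.linearIndependent_iff]
        intro g hg
        let p : Polynomial (hsKer D h0 hmul) :=
          ∑ j : Fin (n+1), Polynomial.monomial (j : ℕ) (∑ c : s, g (c, j) • (c : hsKer D h0 hmul))
        have hp : p.eval₂ (hsKer D h0 hmul).val.toRingHom x = 0 := by
          have := congrArg Subtype.val hg
          simp only [v, Submodule.coe_sum, Submodule.coe_smul, Submodule.coe_zero] at this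
          rw [Polynomial.eval₂_finset_sum]
          rw [← this, Fintype.sum_prod_type_right]
          refine Finset.sum_congr rfl fun j _ => ?_
          rw [Polynomial.eval₂_monomial]
          simp [Finset.sum_mul]
        have hp0 := hs_eval_inj h0 hmul hN hx hxN p hp
        rintro ⟨c, j⟩
        have h1 := congrArg (fun q => q.coeff (j : ℕ)) hp0
        simp only [p, Polynomial.finset_sum_coeff, Polynomial.coeff_monomial, Polynomial.coeff_zero,
          Fin.val_inj, Finset.sum_ite_eq', Finset.mem_univ, if_true] at h1
        exact Fintype.linearIndependent_iff.1 hs _ h1 c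
      have h1 := hli.fintype_card_le_finrank
      simp only [Fintype.card_prod, Fintype.card_coe, Fintype.card_fin] at h1
      exact h1.trans (hgrowth _ (by omega))
    by_contra hcon
    push Not at hcon
    have h1 := hbound (C * W)
    have h2 : (C * m + 1) * (C * W + 1) ≤ s.card * (C * W + 1) := Nat.mul_le_mul_right _ hcon
    nlinarith
  exact Module.rank_lt_aleph0_iff.1 (hrank.trans_lt (Cardinal.natCast_lt_aleph0))

end HS

lemma hs_deg {k A : Type*} [Field k] [Ring A] [Algebra k A] {D : ℕ → A →ₗ[k] A}
    (hnil : ∀ a : A, ∃ N : ℕ, ∀ n ≥ N, D n a = 0) (a : A) (n : ℕ) (hn : D n a ≠ 0) :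
    ∃ m ≥ n, D m a ≠ 0 ∧ ∀ j > m, D j a = 0 := by
  obtain ⟨N, hN⟩ := hnil a
  have hle : n ≤ N := by
    by_contra h; exact hn (hN n (by omega))
  classical
  refine ⟨Nat.findGreatest (fun j => D j a ≠ 0) N, Nat.le_findGreatest hle hn,
    Nat.findGreatest_spec (P := fun j => D j a ≠ 0) hle hn, ?_⟩
  intro j hj
  by_cases hjN : j ≤ N
  · have := Nat.findGreatest_is_greatest hj hjN
    simpa using this
  · exact hN j (by omega)

lemma choose_dvd {k : Type*} [Field k] {n m : ℕ} (hn : 1 ≤ n)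
    (h1 : ∀ j, 1 ≤ j → j < n → (n.choose j : k) = 0)
    (h2 : ∀ j, 1 ≤ j → j < n → (m.choose j : k) = 0) : n ∣ m := by
  have key : ∀ m : ℕ, (∀ j, 1 ≤ j → j < n → (m.choose j : k) = 0) ↔
      (Polynomial.X : Polynomial k) ^ n ∣ (1 + Polynomial.X) ^ m - 1 := by
    intro m
    rw [Polynomial.X_pow_dvd_iff]
    refine ⟨fun h d hd => ?_, fun h j hj hjn => ?_⟩
    · rw [Polynomial.coeff_sub, Polynomial.coeff_one_add_X_pow, Polynomial.coeff_one]
      by_cases hd0 : d = 0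
      · subst hd0; simp
      · rw [h d (by omega) hd]; simp [hd0]
    · have := h j hjn
      rw [Polynomial.coeff_sub, Polynomial.coeff_one_add_X_pow, Polynomial.coeff_one] at this
      simpa [show j ≠ 0 by omega] using this
  rw [key] at h1 h2
  have h3 : (Polynomial.X : Polynomial k) ^ n ∣ ((1 + Polynomial.X) ^ n) ^ (m / n) - 1 :=
    h1.trans (sub_one_dvd_pow_sub_one _ _)
  have h4 : (Polynomial.X : Polynomial k) ^ n ∣ (1 + Polynomial.X) ^ (m % n) - 1 := by
    have e1 : (1 + Polynomial.X : Polynomial k) ^ m =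
        ((1 + Polynomial.X) ^ n) ^ (m / n) * (1 + Polynomial.X) ^ (m % n) := by
      rw [← pow_mul, ← pow_add, Nat.div_add_mod]
    have e2 : (1 + Polynomial.X : Polynomial k) ^ (m % n) - 1 =
      ((1 + Polynomial.X) ^ m - 1) -
        (((1 + Polynomial.X) ^ n) ^ (m / n) - 1) * (1 + Polynomial.X) ^ (m % n) := by
      rw [e1]; ring
    rw [e2]
    exact dvd_sub h2 (h3.mul_right _)
  rw [← key] at h4
  by_contra hcon
  have hpos : 1 ≤ m % n := by
    rw [Nat.dvd_iff_mod_eq_zero] at hcon; omega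
  have := h4 (m % n) hpos (Nat.mod_lt _ hn)
  simp at this

lemma aeval_comm {k A : Type*} [Field k] [Ring A] [Algebra k A] (x z : A)
    (hz : Commute z (x * z - z * x)) (p : Polynomial k) :
    x * Polynomial.aeval z p - Polynomial.aeval z p * x =
      Polynomial.aeval z (Polynomial.derivative p) * (x * z - z * x) := by
  have hpow : ∀ n : ℕ, x * z ^ n - z ^ n * x = (n : A) * z ^ (n - 1) * (x * z - z * x) := by
    intro n
    induction n with
    | zero => simp
    | succ n ih =>
      have e1 : x * z ^ (n + 1) - z ^ (n + 1) * x =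
        (x * z ^ n - z ^ n * x) * z + z ^ n * (x * z - z * x) := by
        rw [pow_succ]; noncomm_ring
      rw [e1, ih, mul_assoc _ _ z, ← hz.eq, ← mul_assoc _ z, mul_assoc _ _ z]
      rcases n with _ | n
      · simp
      · rw [Nat.add_sub_cancel, ← pow_succ]
        push_cast
        noncomm_ring
  induction p using Polynomial.induction_on' with
  | add p q hp hq =>
    simp only [map_add, add_mul, mul_add]
    rw [← hp, ← hq]; abel
  | monomial n a =>
    rw [Polynomial.derivative_monomial, Polynomial.aeval_monomial, Polynomial.aeval_monomial]
    have e1 : x * (algebraMap k A a * z ^ n) - algebraMap k A a * z ^ n * x =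
      algebraMap k A a * (x * z ^ n - z ^ n * x) := by
      rw [← mul_assoc, ← Algebra.commutes, mul_sub, mul_assoc, mul_assoc]
    rw [e1, hpow, map_mul, map_natCast]
    simp only [mul_assoc]

lemma hs_structure {k A : Type*} [Field k] [Ring A] [IsDomain A] [Algebra k A]
    (V : Submodule k A) (hV1 : (1 : A) ∈ V)
    (hVfd : FiniteDimensional k V)
    (hVgen : Algebra.adjoin k (V : Set A) = ⊤)
    (C : ℕ) (hgrowth : ∀ n : ℕ, 1 ≤ n → Module.finrank k ↥(V ^ n) ≤ C * n)
    (hinsep : ∀ F : Subalgebra k A, IsField F →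
      ∀ x : F, IsIntegral k x ∧ (minpoly k x).Separable)
    (D : ℕ → A →ₗ[k] A)
    (h0 : D 0 = LinearMap.id)
    (hmul : ∀ (n : ℕ) (a b : A),
        D n (a * b) = ∑ i ∈ Finset.range (n + 1), D i a * D (n - i) b)
    (hit : ∀ (i j : ℕ) (a : A), D i (D j a) = (i + j).choose i • D (i + j) a)
    (hnil : ∀ a : A, ∃ N : ℕ, ∀ n ≥ N, D n a = 0)
    (hne : ∃ n ≥ 1, ∃ a : A, D n a ≠ 0) :
    ∃ K : Subalgebra k A, FiniteDimensional k K ∧ Nonempty (Polynomial K ≃ₐ[k] A) := by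
  classical
  set K := hsKer D h0 hmul with hK
  have hmem : ∀ a, a ∈ K ↔ ∀ n ≥ 1, D n a = 0 := fun a => Iff.rfl
  have hex : ∃ n, 1 ≤ n ∧ ∃ a, D n a ≠ 0 ∧ ∀ j > n, D j a = 0 := by
    obtain ⟨n, hn, a, ha⟩ := hne
    obtain ⟨m, hm, h1, h2⟩ := hs_deg hnil a n ha
    exact ⟨m, le_trans hn hm, a, h1, h2⟩
  obtain ⟨hn, x0, hx0, hx0'⟩ := Nat.find_spec hex
  have hmin := fun m => @Nat.find_min _ _ hex m
  set n := Nat.find hex with hndef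
  have hfinK : FiniteDimensional k K := hs_finite h0 hmul hn hx0' hx0 V hV1 hVfd hVgen C hgrowth
  refine ⟨K, hfinK, ?_⟩
  -- small elements lie in the kernel
  have hsmall : ∀ a, (∀ j ≥ n, D j a = 0) → a ∈ K := by
    intro a ha
    rw [hmem]
    by_contra hcon
    push Not at hcon
    obtain ⟨i, hi, hia⟩ := hcon
    obtain ⟨m, hm, h1, h2⟩ := hs_deg hnil a i hia
    have hmn : m < n := by
      by_contra h; exact h1 (ha m (by omega))
    exact hmin m hmn ⟨by omega, a, h1, h2⟩
  have htop : ∀ a m, (∀ j > m, D j a = 0) → D m a ∈ K := by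
    intro a m h i hi
    rw [hit, h _ (by omega), smul_zero]
  have hchoose : ∀ a m, D m a ≠ 0 → (∀ j > m, D j a = 0) →
      ∀ j, 1 ≤ j → j < n → (m.choose j : k) = 0 := by
    intro a m h1 h2 j hj hjn
    by_contra hcon
    have hjm : j ≤ m := by
      by_contra h
      rw [Nat.choose_eq_zero_of_lt (by omega)] at hcon
      simp at hcon
    refine hmin j hjn ⟨hj, D (m - j) a, ?_, ?_⟩
    · rw [hit, Nat.add_sub_cancel' hjm, ← Nat.cast_smul_eq_nsmul k]
      exact smul_ne_zero hcon h1
    · intro i hi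
      rw [hit, h2 _ (by omega), smul_zero]
  have hdvd : ∀ a m, D m a ≠ 0 → (∀ j > m, D j a = 0) → n ∣ m := fun a m h1 h2 =>
    choose_dvd hn (hchoose x0 n hx0 hx0') (hchoose a m h1 h2)
  -- normalisation
  obtain ⟨x1, hx1, hx1'⟩ : ∃ x1, D n x1 = 1 ∧ ∀ j > n, D j x1 = 0 := by
    have hc : D n x0 ∈ K := htop _ _ hx0'
    have hu : IsUnit (⟨D n x0, hc⟩ : K) := FiniteDimensional.isUnit k
      (fun h => hx0 (congrArg Subtype.val h))
    obtain ⟨c, hc'⟩ := hu.exists_left_inv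
    refine ⟨(c : A) * x0, ?_, ?_⟩
    · rw [hs_left h0 hmul c.2]
      exact congrArg Subtype.val hc'
    · intro j hj
      rw [hs_left h0 hmul c.2, hx0' j hj, mul_zero]
  have hcomm : ∀ c : K, x1 * c - c * x1 ∈ K := by
    intro c
    apply hsmall
    intro j hj
    rw [map_sub, hs_left h0 hmul c.2, hs_right h0 hmul c.2]
    rcases eq_or_lt_of_le hj with h | h
    · rw [← h, hx1]; simp
    · rw [hx1' j h]; simp
  let δ : K →+ K :=
    { toFun := fun c => ⟨x1 * c - c * x1, hcomm c⟩
      map_zero' := by ext; simp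
      map_add' := fun a b => by ext; simp [mul_add, add_mul]; abel }
  have hδ : ∀ a b, δ (a * b) = δ a * b + a * δ b := by
    intro a b
    ext
    simp only [δ, AddMonoidHom.coe_mk, ZeroHom.coe_mk, MulMemClass.coe_mul, AddMemClass.coe_add]
    noncomm_ring
  have hδz : ∀ z ∈ Subring.center K, δ z = 0 := by
    intro z hz
    rw [Subring.mem_center_iff] at hz
    have hzc : z ∈ Subalgebra.center k K := by
      rw [Subalgebra.mem_center_iff]; exact hz
    let F : Subalgebra k A := (Subalgebra.center k K).map K.val
    have hF : IsField F := by
      refine ⟨⟨0, 1, zero_ne_one⟩, ?_, ?_⟩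
      · rintro ⟨_, a, ha, rfl⟩ ⟨_, b, hb, rfl⟩
        apply Subtype.ext
        have h := congrArg (fun t : K => (t : A)) ((Subalgebra.mem_center_iff.1 hb) a)
        exact h
      · rintro ⟨_, a, ha, rfl⟩ hne
        have ha0 : a ≠ 0 := by
          rintro rfl
          exact hne (Subtype.ext (by simp))
        obtain ⟨u, hu⟩ := FiniteDimensional.isUnit k ha0
        have huc : (↑u⁻¹ : K) ∈ Subalgebra.center k K := by
          rw [Subalgebra.mem_center_iff]
          intro b
          have : Commute b (u : K) := by rw [hu]; exact Subalgebra.mem_center_iff.1 ha b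
          exact this.units_inv_right
        refine ⟨⟨_, _, huc, rfl⟩, Subtype.ext ?_⟩
        have : a * (↑u⁻¹ : K) = 1 := by rw [← hu]; simp
        have h := congrArg (fun t : K => (t : A)) this
        exact h
    obtain ⟨-, hsep⟩ := hinsep F hF ⟨(z : A), z, hzc, rfl⟩
    set zF : F := ⟨(z : A), z, hzc, rfl⟩ with hzF
    have hcz : Commute (z : A) (x1 * z - z * x1) :=
      (congrArg Subtype.val (hz (δ z))).symm
    have h1 := aeval_comm x1 (z : A) hcz (minpoly k zF)
    have hval : ∀ p : Polynomial k, Polynomial.aeval (z : A) p = F.val (Polynomial.aeval zF p) := by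
      intro p
      rw [← Polynomial.aeval_algHom_apply]; rfl
    have h2 : Polynomial.aeval (z : A) (minpoly k zF) = 0 := by
      rw [hval, minpoly.aeval, map_zero]
    rw [h2, mul_zero, zero_mul, sub_zero] at h1
    apply Subtype.ext
    change x1 * z - z * x1 = 0
    rcases mul_eq_zero.1 h1.symm with h | h
    · exfalso
      obtain ⟨a, b, hab⟩ := hsep
      have := congrArg (Polynomial.aeval (z : A)) hab
      rw [map_add, map_mul, map_mul, h2, h] at this
      simp at this
    · exact h
  obtain ⟨e, he⟩ := inner_of_deriv' (k := k) δ hδ hδz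
  set x := x1 - (e : A) with hxdef
  have hxn : D n x = 1 := by
    rw [hxdef, map_sub, hx1, e.2 n hn, sub_zero]
  have hxn' : ∀ j > n, D j x = 0 := by
    intro j hj
    rw [hxdef, map_sub, hx1' j hj, e.2 j (by omega), sub_zero]
  have hxc : ∀ c : K, Commute (K.val c) x := by
    intro c
    have h1 : x1 * c - c * x1 = e * c - c * e := congrArg Subtype.val (he c)
    change (c : A) * (x1 - e) = (x1 - e) * c
    rw [mul_sub, sub_mul]
    have h2 : x1 * (c : A) = e * c - c * e + c * x1 := by rw [← h1]; abel
    rw [h2]; abel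
  let f : Polynomial K →ₐ[k] A := Polynomial.eval₂AlgHom K.val x hxc
  have hinj : Function.Injective f := by
    rw [injective_iff_map_eq_zero]
    intro p hp
    exact hs_eval_inj h0 hmul hn hxn' (by rw [hxn]; exact one_ne_zero) p hp
  have hfC : ∀ c, f (Polynomial.C c) = (c : A) := fun c => by simp [f]
  have hfX : f Polynomial.X = x := by simp [f]
  have hsurj : ∀ N : ℕ, ∀ a, (∀ m ≥ N, D m a = 0) → a ∈ f.range := by
    intro N
    induction N with
    | zero =>
      intro a ha
      have : a = 0 := by simpa [h0] using ha 0 le_rfl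
      rw [this]; exact zero_mem _
    | succ N ih =>
      intro a ha
      by_cases hN : D N a = 0
      · apply ih
        intro m hm
        rcases eq_or_lt_of_le hm with h | h
        · rw [← h]; exact hN
        · exact ha m h
      have ha' : ∀ j > N, D j a = 0 := fun j hj => ha j hj
      obtain ⟨q, hq⟩ := hdvd a N hN ha'
      have hc : D N a ∈ K := htop a N ha'
      have hp := hs_pow h0 hmul hxn' q
      rw [hxn, one_pow, mul_comm q n, ← hq] at hp
      have h1 : a - D N a * x ^ q ∈ f.range := by
        apply ih
        intro m hm
        rw [map_sub, hs_left h0 hmul hc]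
        rcases eq_or_lt_of_le hm with h | h
        · rw [← h, hp.2, mul_one, sub_self]
        · rw [ha' m h, hp.1 m h, mul_zero, sub_zero]
      have h2 : D N a * x ^ q ∈ f.range :=
        mul_mem (show D N a ∈ f.range from ⟨_, hfC ⟨_, hc⟩⟩)
          (pow_mem (show x ∈ f.range from ⟨_, hfX⟩) _)
      have := add_mem h1 h2
      rwa [sub_add_cancel] at this
  exact ⟨AlgEquiv.ofBijective f ⟨hinj, fun a => by
    obtain ⟨N, hN⟩ := hnil a
    exact hsurj N a hN⟩⟩

lemma cancel_poly' {k D B : Type*} [Field k] [Ring D] [IsDomain D] [Algebra k D]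
    [FiniteDimensional k D] [Ring B] [Algebra k B] (d : ℕ)
    (φ : AddMonoidAlgebra (Polynomial D) (Fin d →₀ ℕ) ≃ₐ[k] AddMonoidAlgebra B (Fin d →₀ ℕ)) :
    Nonempty (Polynomial D ≃ₐ[k] B) := by
  letI := divisionRingOfFiniteDimensional k D
  exact cancel_poly d φ


/-- Let `A` be an affine domain of GK dimension one over `k` such that `k` is
inseparably closed in `A` and `ML^I(A) ≠ A`. Then `A` is strongly
cancellative: for every `d ≥ 1`, an isomorphism of polynomial rings in `d`
central commuting variables `A[t₁,…,t_d] ≅ B[t₁,…,t_d]` implies `A ≅ B`.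
Here `A[t₁,…,t_d]` is realized as `AddMonoidAlgebra A (Fin d →₀ ℕ)`. -/
theorem stmt_10 (k A : Type*) [Field k] [Ring A] [IsDomain A] [Algebra k A]
    (V : Submodule k A) (hV1 : (1 : A) ∈ V)
    (hVfd : FiniteDimensional k V)
    (hVgen : Algebra.adjoin k (V : Set A) = ⊤)
    (C : ℕ) (hgrowth : ∀ n : ℕ, 1 ≤ n → Module.finrank k ↥(V ^ n) ≤ C * n)
    (hinf : ¬ Module.Finite k A)
    (hinsep : ∀ F : Subalgebra k A, IsField F →
      ∀ x : F, IsIntegral k x ∧ (minpoly k x).Separable)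
    (hML : ∃ D : ℕ → A →ₗ[k] A,
      (D 0 = LinearMap.id) ∧
      (∀ (n : ℕ) (a b : A),
        D n (a * b) = ∑ i ∈ Finset.range (n + 1), D i a * D (n - i) b) ∧
      (∀ (i j : ℕ) (a : A), D i (D j a) = (i + j).choose i • D (i + j) a) ∧
      (∀ a : A, ∃ N : ℕ, ∀ n ≥ N, D n a = 0) ∧
      (∃ n ≥ 1, ∃ a : A, D n a ≠ 0)) :
    ∀ d : ℕ, 1 ≤ d → ∀ (B : Type*) [Ring B] [Algebra k B],
      (AddMonoidAlgebra A (Fin d →₀ ℕ) ≃ₐ[k] AddMonoidAlgebra B (Fin d →₀ ℕ)) →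
      Nonempty (A ≃ₐ[k] B) := by
  obtain ⟨D, h0, hmul, hit, hnil, hne⟩ := hML
  intro d _ B _ _ φ
  obtain ⟨K, hK, ⟨e⟩⟩ := hs_structure V hV1 hVfd hVgen C hgrowth hinsep D h0 hmul hit hnil hne
  have ψ : AddMonoidAlgebra (Polynomial K) (Fin d →₀ ℕ) ≃ₐ[k] AddMonoidAlgebra A (Fin d →₀ ℕ) :=
    AddMonoidAlgebra.mapAlgEquiv k (Fin d →₀ ℕ) e
  obtain ⟨g⟩ := cancel_poly' d (ψ.trans φ)
  exact ⟨e.symm.trans g⟩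
end

section
/- Let k be a field of characteristic zero and let R be a finitely generated commutative k-algebra that is an integral domain of Krull dimension one. Then either ML(R) = R, i.e., every locally nilpotent k-linear derivation of R is identically zero, or there is a k-subalgebra k' of R which is a field, finite-dimensional over k, such that R is isomorphic as a k-algebra to the polynomial ring k'[t]. -/
open Polynomial

lemma aux_trdeg (k R : Type*) [Field k] [CommRing R] [IsDomain R] [Algebra k R]
    (hfg : Algebra.FiniteType k R) (hdim : ringKrullDim R = 1) : Algebra.trdeg k R ≤ 1 := by
  obtain ⟨s, g, hinj, hint⟩ := exists_integral_inj_algHom_of_fg k R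
  let := g.toRingHom.toAlgebra
  have : IsScalarTower k (MvPolynomial (Fin s) k) R :=
    IsScalarTower.of_algebraMap_eq fun x => (g.commutes x).symm
  have : Algebra.IsIntegral (MvPolynomial (Fin s) k) R := ⟨hint⟩
  have : FaithfulSMul (MvPolynomial (Fin s) k) R :=
    (faithfulSMul_iff_algebraMap_injective _ _).2 hinj
  have hs : s ≤ 1 := by
    have h1 : ringKrullDim (MvPolynomial (Fin s) k) = s := by
      rw [MvPolynomial.ringKrullDim_of_isNoetherianRing, ringKrullDim_eq_zero_of_field]
      simp
    obtain ⟨l, hl⟩ := Order.le_krullDim_iff.1 h1.ge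
    obtain ⟨⟨P, hP, hPl⟩⟩ := Ideal.nonempty_primesOver (S := R) (RelSeries.head l).asIdeal
    obtain ⟨L, hL, -⟩ := Ideal.exists_ltSeries_of_hasGoingUp l P
    have h2 : ((s : ℕ) : WithBot ℕ∞) ≤ ringKrullDim R :=
      Order.le_krullDim_iff.2 ⟨L, hL.trans hl⟩
    rw [hdim] at h2
    exact_mod_cast h2
  have h := lift_trdeg_add_eq k (MvPolynomial (Fin s) k) R
  rw [MvPolynomial.trdeg_of_isDomain, trdeg_eq_zero] at h
  simp at h
  rw [← h]
  exact_mod_cast hs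

lemma aux_transc {A R : Type*} [CommRing A] [CharZero A] [IsDomain A] [CommRing R] [IsDomain R]
    [Algebra A R] [FaithfulSMul A R] (d : Derivation A R R) (r : R) (hr : d r ≠ 0) :
    ∀ (n : ℕ) (p : A[X]), p.natDegree ≤ n → aeval r p = 0 → p = 0 := by
  have key : ∀ a : A, aeval r (C a) = 0 → C a = 0 := by
    intro a h
    rw [aeval_C, map_eq_zero_iff _ (FaithfulSMul.algebraMap_injective A R)] at h
    simp [h]
  intro n
  induction n with
  | zero =>
    intro p hp h
    rw [eq_C_of_natDegree_le_zero hp] at h ⊢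
    exact key _ h
  | succ n ih =>
    intro p hp h
    have h1 : d (aeval r p) = 0 := by rw [h, map_zero]
    rw [Derivation.map_aeval, smul_eq_mul] at h1
    have h2 := (mul_eq_zero.1 h1).resolve_right hr
    have h3 := ih _ ((natDegree_derivative_le p).trans (by omega)) h2
    have h4 : p.natDegree = 0 := natDegree_eq_zero_of_derivative_eq_zero h3
    rw [eq_C_of_natDegree_le_zero h4.le] at h ⊢
    exact key _ h

lemma aux_integrate {A : Type*} [Field A] [CharZero A] (p : A[X]) :
    ∃ q : A[X], derivative q = p := by
  induction p using Polynomial.induction_on' with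
  | add p q hp hq =>
    obtain ⟨a, rfl⟩ := hp
    obtain ⟨b, rfl⟩ := hq
    exact ⟨a + b, by simp⟩
  | monomial n a =>
    refine ⟨monomial (n + 1) (a / (n + 1)), ?_⟩
    rw [derivative_monomial]
    have : (n + 1 : A) ≠ 0 := by exact_mod_cast n.succ_ne_zero
    simp [this]

/-- (Crachiola–Makar-Limanov) For an affine commutative domain `R` of Krull
dimension one over a field `k` of characteristic zero, either every locally
nilpotent `k`-derivation of `R` is zero (`ML(R) = R`), or `R ≅ k'[t]` for some
finite field extension `k'` of `k` inside `R`. -/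
theorem stmt_11 (k R : Type*) [Field k] [CharZero k]
    [CommRing R] [IsDomain R] [Algebra k R]
    (hfg : Algebra.FiniteType k R) (hdim : ringKrullDim R = 1) :
    (∀ δ : Derivation k R R, (∀ a : R, ∃ n : ℕ, (δ.toLinearMap ^ n) a = 0) → δ = 0) ∨
    (∃ k' : Subalgebra k R, IsField k' ∧ FiniteDimensional k k' ∧
      Nonempty (R ≃ₐ[k] Polynomial k')) := by
  by_cases H : ∀ δ : Derivation k R R, (∀ a : R, ∃ n : ℕ, (δ.toLinearMap ^ n) a = 0) → δ = 0
  · exact Or.inl H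
  right
  push Not at H
  obtain ⟨δ, hnil, hδ⟩ := H
  have htr := aux_trdeg k R hfg hdim
  let A : Subalgebra k R :=
    { carrier := {a | δ a = 0}
      mul_mem' := fun {a b} (ha : δ a = 0) (hb : δ b = 0) => by simp [ha, hb]
      add_mem' := fun {a b} (ha : δ a = 0) (hb : δ b = 0) => by simp [ha, hb]
      algebraMap_mem' := fun r => by simp }
  have hA : ∀ a : R, a ∈ A ↔ δ a = 0 := fun a => Iff.rfl
  let d : Derivation A R R :=
    { toFun := δ
      map_add' := fun a b => map_add δ a b
      map_smul' := fun a b => by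
        have : δ (a : R) = 0 := a.2
        simp [Subalgebra.smul_def, this]
      map_one_eq_zero' := by simp
      leibniz' := fun a b => by simp }
  have hd : ∀ a, d a = δ a := fun a => rfl
  have : CharZero A := by
    have : CharZero R := charZero_of_injective_algebraMap (algebraMap k R).injective
    infer_instance
  -- local slice
  obtain ⟨r, hr, hr2⟩ : ∃ r, δ r ≠ 0 ∧ δ (δ r) = 0 := by
    obtain ⟨x, hx⟩ : ∃ x, δ x ≠ 0 := by
      by_contra h
      push Not at h
      exact hδ (Derivation.ext h)
    classical
    have hn := Nat.find_spec (hnil x)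
    have hmin := fun m => Nat.find_min (hnil x) (m := m)
    generalize Nat.find (hnil x) = n at hn hmin
    match n, hn, hmin with
    | 0, hn, _ => exact absurd (by simp at hn; simp [hn]) hx
    | 1, hn, _ => exact absurd (by simpa using hn) hx
    | n + 2, hn, hmin =>
      refine ⟨(δ.toLinearMap ^ n) x, ?_, ?_⟩
      · have := hmin (n + 1) (by omega)
        rw [pow_succ'] at this
        exact this
      · rw [pow_succ', pow_succ'] at hn
        exact hn
  have htrans : ∀ r : R, δ r ≠ 0 → Transcendental A r := by
    rintro r hr ⟨p, hp, hp0⟩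
    exact hp (aux_transc d r hr _ p le_rfl hp0)
  have halg : Algebra.IsAlgebraic k A := by
    rw [← trdeg_eq_zero_iff]
    by_contra h0
    have : Algebra.Transcendental A R := ⟨⟨r, htrans r hr⟩⟩
    have h1 : 1 ≤ Algebra.trdeg A R := Cardinal.one_le_iff_pos.2 (trdeg_pos A R)
    have h2 : 1 ≤ Algebra.trdeg k A := Cardinal.one_le_iff_ne_zero.2 h0
    have h3 := trdeg_add_eq k A (A := R)
    have h4 := (add_le_add h2 h1).trans (h3.le.trans htr)
    norm_num at h4
  have hint : Algebra.IsIntegral k A := Algebra.isAlgebraic_iff_isIntegral.1 halg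
  have hfield : IsField A := isField_of_isIntegral_of_isField' (Field.toIsField k)
  obtain ⟨u, hu⟩ := hfield.mul_inv_cancel (a := (⟨δ r, hr2⟩ : A))
    (fun h => hr (congrArg Subtype.val h))
  have hs : δ ((u : R) * r) = 1 := by
    have h1 : δ (u : R) = 0 := u.2
    have h2 := congrArg Subtype.val hu
    simp at h2
    rw [Derivation.leibniz, h1, smul_zero, add_zero, smul_eq_mul, mul_comm, h2]
  set s : R := u * r with hsdef
  have hint' : ∀ p : A[X], ∃ q : A[X], derivative q = p := by
    let := hfield.toField
    intro p
    exact aux_integrate p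
  have hsurj : Function.Surjective (aeval s : A[X] →ₐ[A] R) := by
    have : ∀ n : ℕ, ∀ b : R, (δ.toLinearMap ^ n) b = 0 → ∃ p : A[X], aeval s p = b := by
      intro n
      induction n with
      | zero => intro b hb; exact ⟨0, by simpa using hb.symm⟩
      | succ n ih =>
        intro b hb
        rw [pow_succ] at hb
        obtain ⟨p, hp⟩ := ih (δ b) hb
        obtain ⟨q, rfl⟩ := hint' p
        have h1 : δ (b - aeval s q) = 0 := by
          rw [map_sub, ← hd (aeval s q), Derivation.map_aeval, hd, hs, hp]; simp
        refine ⟨q + C ⟨b - aeval s q, h1⟩, ?_⟩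
        rw [map_add, aeval_C]
        exact add_sub_cancel _ _
    intro b
    obtain ⟨n, hn⟩ := hnil b
    exact this n b hn
  have hinj : Function.Injective (aeval s : A[X] →ₐ[A] R) :=
    transcendental_iff_injective.1 (htrans s (by rw [hs]; exact one_ne_zero))
  let e : A[X] ≃ₐ[A] R := AlgEquiv.ofBijective _ ⟨hinj, hsurj⟩
  let e' : R ≃ₐ[k] A[X] := (e.restrictScalars k).symm
  refine ⟨A, hfield, ?_, ⟨e'⟩⟩
  have hft : Algebra.FiniteType k A := by
    let ev : A[X] →ₐ[k] A := (aeval (0 : A) : A[X] →ₐ[A] A).restrictScalars k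
    refine Algebra.FiniteType.of_surjective (ev.comp e'.toAlgHom) ?_
    intro a
    refine ⟨e'.symm (C a), ?_⟩
    simp [ev]
  exact Algebra.IsIntegral.finite
end
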